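/- arXiv:1709.05979 — 8 statements merged into one kernel-verified Lean document; each statement's English description precedes it below -/
import Mathlib

section
/- Let s ≥ 1, q₀ = 2^s, q = 2q₀², m = q − 2q₀ + 1, and let K be any field of characteristic 2. If x, y, t ∈ K satisfy y^q + y = x^{q₀}(x^q + x) and t^m = x^q + x, then y^{q²} + y^q · t^{m(q−1)} + y^q + y · t^{m(q−1)} + t^{(q+q₀)m} = 0. -/
/-- The coordinate functions `y, t` of the Skabelund curve `S̃_q` satisfy the
plane-model equation `F(y,t) = 0`. -/
theorem skabelund_suzuki_plane_model_identity
    (s : ℕ) (hs : 1 ≤ s) (q₀ q m : ℕ)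
    (hq₀ : q₀ = 2 ^ s) (hq : q = 2 * q₀ ^ 2) (hm : m = q - 2 * q₀ + 1)
    (K : Type*) [Field K] [CharP K 2] (x y t : K)
    (h1 : y ^ q + y = x ^ q₀ * (x ^ q + x))
    (h2 : t ^ m = x ^ q + x) :
    y ^ (q ^ 2) + y ^ q * t ^ (m * (q - 1)) + y ^ q
      + y * t ^ (m * (q - 1)) + t ^ ((q + q₀) * m) = 0 := by
  have hq' : q = 2 ^ (2 * s + 1) := by rw [hq, hq₀]; ring
  have hqpos : 1 ≤ q := by rw [hq']; exact Nat.one_le_two_pow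
  have : Fact (Nat.Prime 2) := ⟨Nat.prime_two⟩
  have fq : ∀ a b : K, (a + b) ^ q = a ^ q + b ^ q := by
    intro a b
    rw [hq']
    exact add_pow_char_pow a b 2 _
  have fq0 : ∀ a b : K, (a + b) ^ q₀ = a ^ q₀ + b ^ q₀ := by
    intro a b
    rw [hq₀]
    exact add_pow_char_pow a b 2 _
  have e1 : y ^ (q ^ 2) + y ^ q = (x ^ q) ^ q₀ * (t ^ m) ^ q := by
    have h := congrArg (fun z => z ^ q) h1
    simp only [fq, mul_pow] at h
    rw [h2, fq, pow_two, pow_mul, h, pow_right_comm x q q₀]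
  have e2 : (y ^ q + y) * t ^ (m * (q - 1)) = x ^ q₀ * (t ^ m) ^ q := by
    rw [h1, ← h2, pow_mul, mul_assoc, ← pow_succ', Nat.sub_add_cancel hqpos]
  have e3 : t ^ ((q + q₀) * m) = (t ^ m) ^ q * ((x ^ q) ^ q₀ + x ^ q₀) := by
    rw [← fq0, ← h2, ← pow_add, ← pow_mul, mul_comm m]
  have two : (2 : K) = 0 := CharP.cast_eq_zero K 2
  linear_combination e1 + e2 + e3
    + (t ^ m) ^ q * ((x ^ q) ^ q₀ + x ^ q₀) * two
end

section
/- Let s ≥ 1, q₀ = 2^s, q = 2q₀², m = q − 2q₀ + 1, and let K be an algebraically closed field of characteristic 2. Then the bivariate polynomial F(Y,T) = Y^{q²} + Y^q T^{m(q−1)} + Y^q + Y T^{m(q−1)} + T^{(q+q₀)m} ∈ K[Y,T] is irreducible and has total degree q². -/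
theorem sk_identity {Ω : Type*} [Field Ω] [CharP Ω 2] (s q₀ q : ℕ)
    (hq₀ : q₀ = 2 ^ s) (hq : q = 2 * q₀ ^ 2) (x y u : Ω)
    (hx : x ^ q = x + u) (hy : y ^ q = y + x ^ q₀ * u) :
    (x * y ^ (2 * q₀) + (x ^ (2 * q₀ + 1) + y ^ (2 * q₀)) ^ (2 * q₀)) ^ q =
     (x * y ^ (2 * q₀) + (x ^ (2 * q₀ + 1) + y ^ (2 * q₀)) ^ (2 * q₀)) + u * y ^ (2 * q₀) := by
  have hp : Fact (Nat.Prime 2) := ⟨Nat.prime_two⟩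
  have h2 : 2 * q₀ = 2 ^ (s + 1) := by rw [hq₀]; ring
  have hqq : q = 2 ^ (2 * s + 1) := by rw [hq, hq₀]; ring
  have A : ∀ a b : Ω, (a + b) ^ (2 * q₀) = a ^ (2 * q₀) + b ^ (2 * q₀) := by
    intro a b; rw [h2]; exact add_pow_char_pow a b _ _
  have B : ∀ a b : Ω, (a + b) ^ q = a ^ q + b ^ q := by
    intro a b; rw [hqq]; exact add_pow_char_pow a b _ _
  have hxx : ∀ a : Ω, (a ^ q₀) ^ (2 * q₀) = a ^ q := by
    intro a; rw [← pow_mul]; congr 1; rw [hq]; ring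
  have hyy : (y ^ (2 * q₀)) ^ q = y ^ (2 * q₀) + (x + u) * u ^ (2 * q₀) := by
    rw [pow_right_comm, hy, A, mul_pow, hxx, hx]
  have hx2 : (x ^ (2 * q₀)) ^ q = x ^ (2 * q₀) + u ^ (2 * q₀) := by
    rw [pow_right_comm, hx, A]
  have h2z : (2 : Ω) = 0 := CharTwo.two_eq_zero
  have hz : (x ^ (2 * q₀ + 1) + y ^ (2 * q₀)) ^ q =
      (x ^ (2 * q₀ + 1) + y ^ (2 * q₀)) + x ^ (2 * q₀) * u := by
    rw [B, pow_succ, mul_pow, hx2, hx, hyy]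
    linear_combination (u ^ (2 * q₀) * (x + u)) * h2z
  have hx4 : (x ^ (2 * q₀)) ^ (2 * q₀) = (x + u) ^ 2 := by
    rw [← hx, ← pow_mul, ← pow_mul]; congr 1; rw [hq]; ring
  rw [B, mul_pow, pow_right_comm (x ^ (2 * q₀ + 1) + y ^ (2 * q₀)) (2 * q₀) q, hz, A _ (x ^ (2 * q₀) * u), mul_pow, hx4, hx, hyy]
  linear_combination (u ^ (2 * q₀) * (x + u) ^ 2) * h2z

theorem sk_val {Ω Γ : Type*} [Field Ω] [LinearOrderedCommGroupWithZero Γ] (v : Valuation Ω Γ)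
    (q : ℕ) (a b : Ω) (h : b ^ q = b + a) (hq : 2 ≤ q) (ha : 1 < v a) :
    v b ^ q = v a ∧ 1 < v b := by
  have hb : 1 < v b := by
    by_contra! hb
    have : v a ≤ 1 := by
      have : a = b ^ q - b := by rw [h]; ring
      rw [this]
      refine (v.map_sub _ _).trans (max_le ?_ hb)
      rw [map_pow]; exact pow_le_one₀ zero_le hb
    exact absurd ha (not_lt.mpr this)
  refine ⟨?_, hb⟩
  have h1 : v b < v (b ^ q) := by
    rw [map_pow]; exact lt_self_pow₀ hb (by omega)
  have : a = b ^ q - b := by rw [h]; ring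
  rw [this, v.map_sub_eq_of_lt_left h1, map_pow]

theorem sk_val_w {Ω Γ : Type*} [Field Ω] [CharP Ω 2] [LinearOrderedCommGroupWithZero Γ]
    (v : Valuation Ω Γ) (s q₀ q m : ℕ)
    (hq₀ : q₀ = 2 ^ s) (hq : q = 2 * q₀ ^ 2) (hm : m + 2 * q₀ = q + 1) (x y t : Ω)
    (hm0 : m ≠ 0) (ht : 1 < v t)
    (hx : x ^ q = x + t ^ m) (hy : y ^ q = y + x ^ q₀ * t ^ m) :
    v (x * y ^ (2 * q₀) + (x ^ (2 * q₀ + 1) + y ^ (2 * q₀)) ^ (2 * q₀)) ^ (q ^ 2)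
      = v t ^ (q ^ 2 + 1) := by
  have hq00 : 1 ≤ q₀ := by rw [hq₀]; exact Nat.one_le_two_pow
  have hq2 : 2 ≤ q := by rw [hq]; nlinarith
  have hw := sk_identity s q₀ q hq₀ hq x y (t ^ m) hx hy
  set w := x * y ^ (2 * q₀) + (x ^ (2 * q₀ + 1) + y ^ (2 * q₀)) ^ (2 * q₀)
  have hu : 1 < v (t ^ m) := by rw [map_pow]; exact one_lt_pow₀ ht hm0
  obtain ⟨x1, x2⟩ := sk_val v q _ _ hx hq2 hu
  have hxu : 1 < v (x ^ q₀ * t ^ m) := by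
    rw [map_mul]
    refine one_lt_mul_of_lt_of_le ?_ hu.le
    rw [map_pow]; exact one_lt_pow₀ x2 (by omega)
  obtain ⟨y1, y2⟩ := sk_val v q _ _ hy hq2 hxu
  have hyu : 1 < v (t ^ m * y ^ (2 * q₀)) := by
    rw [map_mul]
    refine one_lt_mul_of_lt_of_le hu ?_
    rw [map_pow]; exact (one_lt_pow₀ y2 (by omega)).le
  obtain ⟨w1, w2⟩ := sk_val v q _ _ hw hq2 hyu
  have e1 : v w ^ (q ^ 2) = v x ^ (q * (q + 2 * q₀ + 1)) := by
    rw [pow_two, pow_mul, w1, map_mul, ← x1, map_pow, mul_pow, pow_right_comm _ (2 * q₀) q, y1,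
      map_mul, map_pow, ← x1, ← pow_add, ← pow_mul, ← pow_mul, ← pow_add]
    congr 1
    nlinarith
  rw [e1, pow_mul, x1, map_pow, ← pow_mul]
  congr 1
  zify at hm hq ⊢
  have : (m : ℤ) = q + 1 - 2 * q₀ := by linarith
  rw [this]
  linear_combination 2 * hq

open Polynomial in
theorem sk_exists_val (K Ω : Type*) [Field K] [IsAlgClosed K] [Field Ω] [Algebra K Ω]
    (t : Ω) (ht : Transcendental K t) :
    ∃ V : ValuationSubring Ω, (∀ c : K, V.valuation (algebraMap K Ω c) ≤ 1) ∧
      1 < V.valuation t := by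
  have key : ∀ x : Ω, IsIntegral K x → x ∈ (algebraMap K Ω).range := fun x hx =>
    minpoly.mem_range_of_degree_eq_one K x
      (IsAlgClosed.degree_eq_one_of_irreducible K (minpoly.irreducible hx))
  have h1 : IsIntegrallyClosedIn (algebraMap K Ω).range Ω := by
    rw [Subring.isIntegrallyClosedIn_iff]
    intro x hx
    apply key
    obtain ⟨p, hp, hpx⟩ := hx
    have hs : Function.Surjective (algebraMap K Ω).rangeRestrict :=
      (algebraMap K Ω).rangeRestrict_surjective
    have hl : p ∈ lifts (algebraMap K Ω).rangeRestrict := by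
      rw [lifts_iff_coeff_lifts]; intro n; exact hs _
    obtain ⟨r, hr, -, hr2⟩ := lifts_and_degree_eq_and_monic hl hp
    refine ⟨r, hr2, ?_⟩
    rw [← hpx, ← hr, eval₂_map]
    rfl
  have h2 : t ∉ (algebraMap K Ω).range := by
    rintro ⟨c, rfl⟩
    exact ht (isAlgebraic_algebraMap c)
  obtain ⟨V, hV, hV2⟩ := Subring.exists_le_valuationSubring_of_isIntegrallyClosedIn h2
  refine ⟨V, fun c => ?_, ?_⟩
  · rw [V.valuation_le_one_iff]; exact hV ⟨c, rfl⟩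
  · rw [← not_le, V.valuation_le_one_iff]; exact hV2

open Polynomial in
theorem sk_val_poly {K Ω Γ : Type*} [Field K] [Field Ω] [Algebra K Ω]
    [LinearOrderedCommGroupWithZero Γ] (v : Valuation Ω Γ) (t : Ω)
    (hv : ∀ c : K, v (algebraMap K Ω c) ≤ 1) (ht : 1 < v t) (p : K[X]) (hp : p ≠ 0) :
    v (aeval t p) = v t ^ p.natDegree := by
  have hv1 : ∀ c : K, c ≠ 0 → v (algebraMap K Ω c) = 1 := by
    intro c hc
    refine le_antisymm (hv c) ?_
    have h := hv c⁻¹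
    rw [map_inv₀, map_inv₀] at h
    have h0 : 0 < v (algebraMap K Ω c) := by
      rw [zero_lt_iff, Valuation.ne_zero_iff]; simpa using hc
    exact (inv_le_one₀ h0).mp h
  have hlast : v (p.coeff p.natDegree • t ^ p.natDegree) = v t ^ p.natDegree := by
    rw [Algebra.smul_def, map_mul, hv1 _ (by simpa using hp), one_mul, map_pow]
  rw [aeval_eq_sum_range, Finset.sum_range_succ, Valuation.map_add_eq_of_lt_right, hlast]
  rw [hlast]
  apply Valuation.map_sum_lt
  · exact pow_ne_zero _ (zero_lt_one.trans ht).ne'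
  · intro i hi
    rw [Algebra.smul_def, map_mul, map_pow]
    refine (mul_le_of_le_one_left zero_le (hv _)).trans_lt ?_
    exact pow_lt_pow_right₀ ht (Finset.mem_range.mp hi)

open Polynomial in
theorem sk_degree {K k Ω Γ : Type*} [Field K] [Field k] [Field Ω] [Algebra K[X] k]
    [IsFractionRing K[X] k] [Algebra K Ω] [Algebra k Ω] [Algebra K[X] Ω] [IsScalarTower K[X] k Ω]
    [IsScalarTower K K[X] Ω] [IsAlgClosure k Ω]
    [LinearOrderedCommGroupWithZero Γ] (v : Valuation Ω Γ)
    (hv : ∀ c : K, v (algebraMap K Ω c) ≤ 1) (ht : 1 < v (algebraMap K[X] Ω X))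
    (N : ℕ) (w : Ω)
    (hw : ∀ σ : Ω ≃ₐ[k] Ω, v (σ w) ^ N = v (algebraMap K[X] Ω X) ^ (N + 1)) :
    N ∣ (minpoly k w).natDegree := by
  set t := algebraMap K[X] Ω X with htdef
  have : IsAlgClosed Ω := IsAlgClosure.isAlgClosed k
  have : Algebra.IsAlgebraic k Ω := IsAlgClosure.isAlgebraic
  have : Normal k Ω := IsAlgClosure.normal k Ω
  have hint : IsIntegral k w := Algebra.IsIntegral.isIntegral w
  have ht0 : 0 < v t := zero_lt_one.trans ht
  have hw0 : w ≠ 0 := by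
    rintro rfl
    have h := hw AlgEquiv.refl
    rw [map_zero, map_zero] at h
    rcases Nat.eq_zero_or_pos N with rfl | hN
    · simp at h; exact absurd h ht.ne
    · rw [zero_pow hN.ne'] at h
      exact pow_ne_zero _ ht0.ne' h.symm
  have hpoly : ∀ p : K[X], p ≠ 0 → ∃ n : ℤ, v (algebraMap K[X] Ω p) = v t ^ n := by
    intro p hp
    refine ⟨p.natDegree, ?_⟩
    rw [zpow_natCast, ← sk_val_poly v t hv ht p hp, htdef]
    congr 1
    have : algebraMap K[X] Ω p = IsScalarTower.toAlgHom K K[X] Ω p := rfl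
    have h2 : algebraMap K[X] Ω X = IsScalarTower.toAlgHom K K[X] Ω X := rfl
    rw [this, h2, aeval_algHom_apply, aeval_X_left_apply]
  have hrat : ∀ c : k, c ≠ 0 → ∃ n : ℤ, v (algebraMap k Ω c) = v t ^ n := by
    intro c hc
    obtain ⟨a, b, hb, rfl⟩ := IsFractionRing.div_surjective (A := K[X]) c
    have ha : a ≠ 0 := by rintro rfl; simp at hc
    obtain ⟨n1, h1⟩ := hpoly a ha
    obtain ⟨n2, h2⟩ := hpoly b (nonZeroDivisors.ne_zero hb)
    refine ⟨n1 - n2, ?_⟩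
    rw [map_div₀, ← IsScalarTower.algebraMap_apply, ← IsScalarTower.algebraMap_apply, map_div₀,
      h1, h2, zpow_sub₀ ht0.ne']
  obtain ⟨n, hn⟩ := hrat ((minpoly k w).coeff 0) (minpoly.coeff_zero_ne_zero hint hw0)
  have hspl := IsAlgClosed.splits ((minpoly k w).map (algebraMap k Ω))
  have hprod := hspl.coeff_zero_eq_prod_roots_of_monic ((minpoly.monic hint).map _)
  have hcard := hspl.natDegree_eq_card_roots
  rw [natDegree_map] at hcard hprod
  rw [coeff_map] at hprod
  rw [hprod, map_mul, map_pow, Valuation.map_neg, map_one, one_pow, one_mul] at hn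
  have hroots : ∀ r ∈ ((minpoly k w).map (algebraMap k Ω)).roots,
      v r ^ N = v t ^ (N + 1) := by
    intro r hr
    rw [mem_roots_map (minpoly.ne_zero hint)] at hr
    obtain ⟨σ, hσ⟩ := IsConjRoot.exists_algEquiv (K := k) (x := r) (y := w)
      (isConjRoot_iff_aeval_eq_zero (K := k) hint |>.mpr hr).symm
    rw [← hσ]; exact hw σ
  have hgen : ∀ S : Multiset Ω, (∀ r ∈ S, v r ^ N = v t ^ (N + 1)) →
      v S.prod ^ N = v t ^ ((N + 1) * Multiset.card S) := by
    intro S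
    induction S using Multiset.induction_on with
    | empty => intro _; simp
    | cons a S ih =>
      intro h
      rw [Multiset.prod_cons, map_mul, mul_pow, h a (Multiset.mem_cons_self a S),
        ih (fun r hr => h r (Multiset.mem_cons_of_mem hr)), Multiset.card_cons, ← pow_add]
      congr 1; ring
  have h := hgen _ hroots
  rw [hn, ← hcard, ← zpow_natCast, ← zpow_natCast, ← zpow_mul] at h
  have h' := zpow_right_injective₀ ht0 ht.ne' h
  push_cast at h'
  have : (N : ℤ) ∣ ((minpoly k w).natDegree : ℤ) :=
    ⟨n - (minpoly k w).natDegree, by linarith⟩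
  exact_mod_cast this

open Polynomial in
theorem sk_irred (s q₀ q m : ℕ)
    (hq₀ : q₀ = 2 ^ s) (hq : q = 2 * q₀ ^ 2) (hm : m + 2 * q₀ = q + 1) (hm0 : m ≠ 0)
    (K : Type*) [Field K] [IsAlgClosed K] [CharP K 2] (G : K[X][X])
    (hG : G = X ^ (q ^ 2) + X ^ q * C X ^ (m * (q - 1)) + X ^ q + X * C X ^ (m * (q - 1))
      + C X ^ ((q + q₀) * m)) (hmon : G.Monic) (hdeg : G.natDegree = q ^ 2) :
    Irreducible G := by
  rw [hmon.irreducible_iff_irreducible_map_fraction_map (K := FractionRing K[X])]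
  set k := FractionRing K[X]
  let Ω := AlgebraicClosure k
  have hp : Fact (Nat.Prime 2) := ⟨Nat.prime_two⟩
  have : CharP Ω 2 := charP_of_injective_algebraMap (algebraMap K Ω).injective 2
  have hq00 : 1 ≤ q₀ := by rw [hq₀]; exact Nat.one_le_two_pow
  have hq2 : 2 ≤ q := by rw [hq]; nlinarith
  have hinj : Function.Injective (algebraMap K[X] Ω) := by
    rw [IsScalarTower.algebraMap_eq K[X] k Ω]
    exact (algebraMap k Ω).injective.comp (IsFractionRing.injective K[X] k)
  set t : Ω := algebraMap K[X] Ω X with ht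
  have htr : Transcendental K t := by
    rw [ht, transcendental_algebraMap_iff hinj]
    exact transcendental_X K
  have ht0 : t ≠ 0 := by
    intro h; rw [h] at htr; exact htr isAlgebraic_zero
  obtain ⟨V, hV1, hV2⟩ := sk_exists_val K Ω t htr
  obtain ⟨y, hy⟩ := IsAlgClosed.exists_aeval_eq_zero Ω (G.map (algebraMap K[X] k)) (by
    rw [hmon.degree_map, degree_eq_natDegree hmon.ne_zero, hdeg]
    have : q ^ 2 ≠ 0 := by positivity
    exact_mod_cast this)
  have hint : IsIntegral k y := Algebra.IsIntegral.isIntegral y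
  -- rational expressions for x and w
  let xf : Ω → Ω := fun b => ((b ^ q + b) / t ^ m) ^ (2 * q₀) + t ^ m
  let wf : Ω → Ω := fun b => xf b * b ^ (2 * q₀) +
    (xf b ^ (2 * q₀ + 1) + b ^ (2 * q₀)) ^ (2 * q₀)
  have hval : ∀ b : Ω, aeval b (G.map (algebraMap K[X] k)) = 0 →
      V.valuation (wf b) ^ (q ^ 2) = V.valuation t ^ (q ^ 2 + 1) := by
    intro b hb
    rw [aeval_map_algebraMap, hG] at hb
    simp only [map_add, map_mul, map_pow, aeval_X, aeval_C] at hb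
    rw [← ht] at hb
    have h2z : (2 : Ω) = 0 := CharTwo.two_eq_zero
    have hqq : q = 2 ^ (2 * s + 1) := by rw [hq, hq₀]; ring
    have B : ∀ a b : Ω, (a + b) ^ q = a ^ q + b ^ q := by
      intro a b; rw [hqq]; exact add_pow_char_pow a b _ _
    have B0 : ∀ a b : Ω, (a + b) ^ q₀ = a ^ q₀ + b ^ q₀ := by
      intro a b; rw [hq₀]; exact add_pow_char_pow a b _ _
    have B2 : ∀ a b : Ω, (a + b) ^ (2 * q₀) = a ^ (2 * q₀) + b ^ (2 * q₀) := by
      intro a b; rw [show 2 * q₀ = 2 ^ (s + 1) by rw [hq₀]; ring]; exact add_pow_char_pow a b _ _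
    have hu0 : t ^ m ≠ 0 := pow_ne_zero _ ht0
    rw [pow_mul t m, mul_comm (q + q₀) m, pow_mul t m] at hb
    set u := t ^ m with hu
    obtain ⟨a, ha⟩ : ∃ a, a = (b ^ q + b) / u := ⟨_, rfl⟩
    have hau : b ^ q + b = a * u := by rw [ha, div_mul_cancel₀ _ hu0]
    have haq : a ^ q = a + u ^ q₀ := by
      have e1 : (a * u) ^ q + u ^ (q - 1) * (a * u) = u ^ (q + q₀) := by
        rw [← hau, B, ← pow_mul, ← pow_two]
        linear_combination hb - u ^ (q + q₀) * h2z
      have e2 : u ^ (q - 1) * u = u ^ q := by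
        rw [← pow_succ]; congr 1; omega
      have e3 : u ^ q * (a ^ q) = u ^ q * (a + u ^ q₀) := by
        rw [mul_pow, pow_add] at e1
        linear_combination e1 - a * e2 - u ^ q * a * h2z
      exact mul_left_cancel₀ (pow_ne_zero _ hu0) e3
    have hxb : xf b = a ^ (2 * q₀) + u := by simp only [xf]; rw [ha]
    have hx0 : xf b ^ q₀ = a := by
      rw [hxb, B0, ← pow_mul, show 2 * q₀ * q₀ = q by rw [hq]; ring, haq]
      linear_combination u ^ q₀ * h2z
    have hxq : xf b ^ q = xf b + u := by
      have : xf b ^ q = (xf b ^ q₀) ^ (2 * q₀) := by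
        rw [← pow_mul]; congr 1; rw [hq]; ring
      rw [this, hx0, hxb]
      linear_combination -u * h2z
    apply sk_val_w V.valuation s q₀ q m hq₀ hq hm (xf b) b t hm0 hV2 hxq
    rw [hx0]
    linear_combination hau - b * h2z
  have hdiv := sk_degree (k := k) V.valuation hV1 hV2 (q ^ 2) (wf y) (by
    intro σ
    have : σ (wf y) = wf (σ y) := by
      have hσ : σ t = t := by
        rw [ht, IsScalarTower.algebraMap_apply K[X] k Ω, σ.commutes]
      simp only [wf, xf, map_add, map_mul, map_pow, map_div₀, hσ]
    rw [this]
    apply hval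
    rw [← AlgEquiv.coe_toAlgHom, aeval_algHom_apply, hy, map_zero])
  have hwint : IsIntegral k (wf y) := Algebra.IsIntegral.isIntegral _
  have hle : (minpoly k (wf y)).natDegree ≤ (minpoly k y).natDegree := by
    rw [← IntermediateField.adjoin.finrank hwint, ← IntermediateField.adjoin.finrank hint]
    have : FiniteDimensional k (IntermediateField.adjoin k {y}) :=
      IntermediateField.adjoin.finiteDimensional hint
    apply IntermediateField.finrank_le_of_le_right
    rw [IntermediateField.adjoin_simple_le_iff]
    have hyE := IntermediateField.mem_adjoin_simple_self k y
    have htE : t ∈ IntermediateField.adjoin k {y} := by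
      rw [ht, IsScalarTower.algebraMap_apply K[X] k Ω]
      exact IntermediateField.algebraMap_mem _ _
    have hxE : xf y ∈ IntermediateField.adjoin k {y} :=
      add_mem (pow_mem (div_mem (add_mem (pow_mem hyE _) hyE) (pow_mem htE _)) _) (pow_mem htE _)
    exact add_mem (mul_mem hxE (pow_mem hyE _))
      (pow_mem (add_mem (pow_mem hxE _) (pow_mem hyE _)) _)
  have hge : q ^ 2 ≤ (minpoly k y).natDegree :=
    (Nat.le_of_dvd (minpoly.natDegree_pos hwint) hdiv).trans hle
  have heq : G.map (algebraMap K[X] k) = minpoly k y := by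
    apply eq_of_monic_of_dvd_of_natDegree_le (minpoly.monic hint) (hmon.map _) (minpoly.dvd k y hy)
    rw [hmon.natDegree_map, hdeg]; exact hge
  rw [heq]
  exact minpoly.irreducible hint

/-- The plane model `F(Y,T) = Y^{q²} + Y^q T^{m(q-1)} + Y^q + Y T^{m(q-1)} + T^{(q+q₀)m}`
of the Skabelund curve `S̃_q` is absolutely irreducible of total degree `q²`. -/
theorem skabelund_suzuki_plane_model_irreducible
    (s : ℕ) (hs : 1 ≤ s) (q₀ q m : ℕ)
    (hq₀ : q₀ = 2 ^ s) (hq : q = 2 * q₀ ^ 2) (hm : m = q - 2 * q₀ + 1)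
    (K : Type*) [Field K] [IsAlgClosed K] [CharP K 2]
    (F : MvPolynomial (Fin 2) K)
    (hF : F = MvPolynomial.X 0 ^ (q ^ 2)
        + MvPolynomial.X 0 ^ q * MvPolynomial.X 1 ^ (m * (q - 1))
        + MvPolynomial.X 0 ^ q
        + MvPolynomial.X 0 * MvPolynomial.X 1 ^ (m * (q - 1))
        + MvPolynomial.X 1 ^ ((q + q₀) * m)) :
    Irreducible F ∧ F.totalDegree = q ^ 2 := by
  have hq00 : 2 ≤ q₀ := by
    rw [hq₀]; calc 2 = 2 ^ 1 := rfl
      _ ≤ 2 ^ s := Nat.pow_le_pow_right (by norm_num) hs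
  have hqq : 2 * (2 * q₀) ≤ 2 * q := by rw [hq]; nlinarith
  have hq2 : 2 ≤ q := by omega
  have hm1 : m + 2 * q₀ = q + 1 := by omega
  have hm0 : m ≠ 0 := by omega
  let e := (MvPolynomial.finSuccEquiv K 1).trans
    (Polynomial.mapAlgEquiv (MvPolynomial.uniqueAlgEquiv K (Fin 1)))
  have hX0 : e (MvPolynomial.X 0) = Polynomial.X := by
    simp [e, MvPolynomial.finSuccEquiv_X_zero]
  have hX1 : e (MvPolynomial.X 1) = Polynomial.C Polynomial.X := by
    have : (1 : Fin 2) = Fin.succ 0 := rfl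
    simp only [e, this, AlgEquiv.trans_apply, MvPolynomial.finSuccEquiv_X_succ]
    simp
  obtain ⟨hmon, hdeg⟩ : (e F).Monic ∧ (e F).natDegree = q ^ 2 := by
    have hR : (Polynomial.X ^ q * Polynomial.C Polynomial.X ^ (m * (q - 1)) + Polynomial.X ^ q
        + Polynomial.X * Polynomial.C Polynomial.X ^ (m * (q - 1))
        + Polynomial.C Polynomial.X ^ ((q + q₀) * m) :
        Polynomial (Polynomial K)).natDegree < q ^ 2 := by
      refine lt_of_le_of_lt (b := q) ?_ (by nlinarith)
      simp only [← Polynomial.C_pow]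
      compute_degree!
      all_goals omega
    have hsplit : e F = Polynomial.X ^ (q ^ 2) +
        (Polynomial.X ^ q * Polynomial.C Polynomial.X ^ (m * (q - 1)) + Polynomial.X ^ q
        + Polynomial.X * Polynomial.C Polynomial.X ^ (m * (q - 1))
        + Polynomial.C Polynomial.X ^ ((q + q₀) * m)) := by
      rw [hF]
      simp only [map_add, map_mul, map_pow, hX0, hX1]
      ring
    have hRd := Polynomial.degree_le_natDegree.trans_lt (Nat.cast_lt (α := WithBot ℕ).mpr hR)
    rw [hsplit]
    constructor
    · exact Polynomial.monic_X_pow_add hRd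
    · rw [Polynomial.natDegree_add_eq_left_of_natDegree_lt, Polynomial.natDegree_X_pow]
      rwa [Polynomial.natDegree_X_pow]
  constructor
  · rw [← MulEquiv.irreducible_iff e]
    apply sk_irred s q₀ q m hq₀ hq hm1 hm0 K (e F) _ hmon hdeg
    rw [hF]
    simp only [map_add, map_mul, map_pow, hX0, hX1]
  · apply le_antisymm
    · have hmz : (m : ℤ) = q + 1 - 2 * q₀ := by omega
      have b1 : q + m * (q - 1) ≤ q ^ 2 := by
        zify [show 1 ≤ q by omega]
        rw [hmz]
        have : (2 : ℤ) ≤ q₀ := by exact_mod_cast hq00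
        have : (2 : ℤ) ≤ q := by exact_mod_cast hq2
        nlinarith
      have b2 : (q + q₀) * m ≤ q ^ 2 := by
        zify
        rw [hmz]
        have : (2 : ℤ) ≤ q₀ := by exact_mod_cast hq00
        have : (2 : ℤ) ≤ q := by exact_mod_cast hq2
        have h : (q : ℤ) = 2 * q₀ ^ 2 := by exact_mod_cast hq
        nlinarith
      have p0 : ∀ n, (MvPolynomial.X 0 ^ n : MvPolynomial (Fin 2) K).totalDegree ≤ n :=
        fun n => (MvPolynomial.totalDegree_X_pow _ _).le
      have p1 : ∀ n, (MvPolynomial.X 1 ^ n : MvPolynomial (Fin 2) K).totalDegree ≤ n :=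
        fun n => (MvPolynomial.totalDegree_X_pow _ _).le
      rw [hF]
      refine (MvPolynomial.totalDegree_add _ _).trans (max_le ?_ ((p1 _).trans b2))
      refine (MvPolynomial.totalDegree_add _ _).trans (max_le ?_ ?_)
      · refine (MvPolynomial.totalDegree_add _ _).trans (max_le ?_ ((p0 _).trans (by nlinarith)))
        refine (MvPolynomial.totalDegree_add _ _).trans (max_le (p0 _) ?_)
        exact (MvPolynomial.totalDegree_mul _ _).trans ((add_le_add (p0 _) (p1 _)).trans b1)
      · refine (MvPolynomial.totalDegree_mul _ _).trans ((add_le_add ?_ (p1 _)).trans b1)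
        rw [MvPolynomial.totalDegree_X]; omega
    · rw [← hdeg]
      have : (e F).natDegree ≤ F.degreeOf 0 := by
        rw [← MvPolynomial.natDegree_finSuccEquiv]
        exact Polynomial.natDegree_map_le
      exact this.trans (MvPolynomial.degreeOf_le_totalDegree _ _)
end

section
/- Let s ≥ 1, q₀ = 2^s, q = 2q₀², m = q − 2q₀ + 1, and let K be any field of characteristic 2. If x, y, t ∈ K satisfy y^q + y = x^{q₀}(x^q + x) and t^m = x^q + x, and t ≠ 0, then x = ((y^q + y) · t^{−m})^{2q₀} + t^m. -/
/-- On the Skabelund curve `S̃_q`, the coordinate `x` is expressed rationally in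
terms of `y` and `t`: `x = ((y^q + y) t^{-m})^{2q₀} + t^m` whenever `t ≠ 0`. -/
theorem skabelund_suzuki_x_rational_in_y_t
    (s : ℕ) (hs : 1 ≤ s) (q₀ q m : ℕ)
    (hq₀ : q₀ = 2 ^ s) (hq : q = 2 * q₀ ^ 2) (hm : m = q - 2 * q₀ + 1)
    (K : Type*) [Field K] [CharP K 2] (x y t : K)
    (h1 : y ^ q + y = x ^ q₀ * (x ^ q + x))
    (h2 : t ^ m = x ^ q + x)
    (ht : t ≠ 0) :
    x = ((y ^ q + y) * (t ^ m)⁻¹) ^ (2 * q₀) + t ^ m := by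
  have h0 : t ^ m ≠ 0 := pow_ne_zero _ ht
  have e : q₀ * (2 * q₀) = q := by rw [hq]; ring
  rw [h1, ← h2, mul_assoc, mul_inv_cancel₀ h0, mul_one, ← pow_mul, e, h2, ← add_assoc,
    CharTwo.add_self_eq_zero, zero_add]
end

section
/- Let s ≥ 1, q₀ = 3^s, q = 3q₀², m = q − 3q₀ + 1, and let K be an algebraically closed field of characteristic 3. Then the bivariate polynomial G(Y,T) = T^{q³} − Y^{q²} T^{m(q−1)(q+3q₀)} − Y^{q²} T^{mq(q−1)} − Y^{q²} + Y^q T^{m(q−1)(q+3q₀+1)} + Y^q T^{m(q−1)(q+3q₀)} + Y^q T^{mq(q−1)} − Y T^{m(q−1)(q+3q₀+1)} − T^{mq(q+3q₀+1)} ∈ K[Y,T] is irreducible and has total degree q³. -/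
open Polynomial

/-- absolute value from a degree-like function -/
noncomputable def skAbv {R : Type*} [CommRing R] [IsDomain R] (o : R → ℤ)
    (hmul : ∀ p q, p ≠ 0 → q ≠ 0 → o (p * q) = o p + o q)
    (hadd : ∀ p q, p ≠ 0 → q ≠ 0 → p + q ≠ 0 → o (p + q) ≤ max (o p) (o q)) :
    {v : AbsoluteValue R ℝ // IsNonarchimedean v ∧ ∀ p, p ≠ 0 → v p = (2 : ℝ) ^ (o p)} := by
  classical
  let f : R → ℝ := fun p => if p = 0 then 0 else (2 : ℝ) ^ (o p)
  have hf : ∀ p, 0 ≤ f p := by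
    intro p; simp only [f]; split_ifs <;> positivity
  have hna : ∀ p q, f (p + q) ≤ max (f p) (f q) := by
    intro p q
    by_cases hp : p = 0
    · subst hp; simp
    by_cases hq : q = 0
    · subst hq; simp
    by_cases hpq : p + q = 0
    · rw [hpq]; simp only [f, if_true]; exact le_max_of_le_left (hf p)
    simp only [f, hp, hq, hpq, if_false]
    rcases le_max_iff.1 (hadd p q hp hq hpq) with h | h
    · exact le_max_of_le_left (zpow_le_zpow_right₀ (by norm_num) h)
    · exact le_max_of_le_right (zpow_le_zpow_right₀ (by norm_num) h)
  refine ⟨⟨⟨f, ?_⟩, hf, ?_, ?_⟩, hna, ?_⟩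
  · intro p q
    by_cases hp : p = 0
    · simp [f, hp]
    by_cases hq : q = 0
    · simp [f, hq]
    simp [f, hp, hq, hmul p q hp hq, zpow_add₀]
  · intro p
    simp only [f]
    split_ifs with h
    · simp [h]
    · simp only [h, iff_false]; positivity
  · intro p q
    refine (hna p q).trans ?_
    exact max_le (le_add_of_nonneg_right (hf q)) (le_add_of_nonneg_left (hf p))
  · intro p hp
    change f p = _
    simp [f, hp]

lemma skDegAbv (K : Type*) [Field K] (k : ℕ) :
    ∃ v : AbsoluteValue K[X] ℝ, IsNonarchimedean v ∧
      ∀ p, p ≠ 0 → v p = (2 : ℝ) ^ ((k : ℤ) * p.natDegree) := by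
  obtain ⟨v, h1, h2⟩ := skAbv (R := K[X]) (fun p => (k : ℤ) * p.natDegree)
    (fun p q hp hq => by simp [natDegree_mul hp hq, mul_add])
    (fun p q hp hq hpq => by
      have := natDegree_add_le p q
      rw [← mul_max_of_nonneg _ _ (by positivity)]
      gcongr
      exact_mod_cast this)
  exact ⟨v, h1, h2⟩

lemma skOrdAbv (K : Type*) [Field K] (k : ℕ) :
    ∃ v : AbsoluteValue K[X] ℝ, IsNonarchimedean v ∧
      ∀ p, p ≠ 0 → v p = (2 : ℝ) ^ (-((k : ℤ) * p.rootMultiplicity 1)) := by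
  obtain ⟨v, h1, h2⟩ := skAbv (R := K[X]) (fun p => -((k : ℤ) * p.rootMultiplicity 1))
    (fun p q hp hq => by
      simp [rootMultiplicity_mul (mul_ne_zero hp hq), mul_add, add_comm])
    (fun p q hp hq hpq => by
      have := rootMultiplicity_add (p := p) (q := q) 1 hpq
      rcases min_le_iff.1 this with h | h
      · apply le_max_of_le_left; gcongr
      · apply le_max_of_le_right; gcongr)
  exact ⟨v, h1, h2⟩

section gauss
variable {A : Type*} [CommRing A] [IsDomain A] (v : AbsoluteValue A ℝ) (hna : IsNonarchimedean v)
  (c : ℝ) (hc : 0 < c)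

include hc in
lemma skNormLe (P : A[X]) (M : ℝ) (h : ∀ i, v (P.coeff i) * c ^ i ≤ M) : P.gaussNorm v c ≤ M := by
  obtain ⟨i, hi⟩ := exists_eq_gaussNorm v c P
  rw [hi]; exact h i

lemma skMulEq {a b x y : ℝ} (ha : 0 ≤ a) (hax : a ≤ x) (hby : b ≤ y) (hx : 0 < x) (hy : 0 < y)
    (h : x * y ≤ a * b) : a = x ∧ b = y := by
  have hb : 0 < b := by
    by_contra hb
    push Not at hb
    have := mul_pos hx hy
    nlinarith
  constructor
  · apply le_antisymm hax
    by_contra hlt; push Not at hlt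
    nlinarith
  · apply le_antisymm hby
    by_contra hlt; push Not at hlt
    nlinarith

include hc hna in
lemma skPos {P : A[X]} (h : P ≠ 0) : 0 < P.gaussNorm v c := by
  have := P.gaussNorm_nonneg v hc.le
  refine lt_of_le_of_ne this (fun h0 => h ?_)
  exact (gaussNorm_eq_zero_iff v P (fun x hx => (AbsoluteValue.eq_zero v).mp hx) hc).1 h0.symm

include hc hna in
lemma skLead {H₁ H₂ : A[X]} (h1 : H₁ ≠ 0) (h2 : H₂ ≠ 0)
    (h : (H₁ * H₂).gaussNorm v c ≤ v (H₁ * H₂).leadingCoeff * c ^ (H₁ * H₂).natDegree) :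
    v H₁.leadingCoeff * c ^ H₁.natDegree = H₁.gaussNorm v c ∧
    v H₂.leadingCoeff * c ^ H₂.natDegree = H₂.gaussNorm v c := by
  rw [gaussNorm_mul hna hc, leadingCoeff_mul, natDegree_mul h1 h2, map_mul] at h
  refine skMulEq (by positivity) (le_gaussNorm v _ hc.le _) (le_gaussNorm v _ hc.le _)
    (skPos v hna c hc h1) (skPos v hna c hc h2) (h.trans (le_of_eq ?_))
  ring

include hc hna in
lemma skConst {H₁ H₂ : A[X]} (h1 : H₁ ≠ 0) (h2 : H₂ ≠ 0)
    (h : (H₁ * H₂).gaussNorm v c ≤ v ((H₁ * H₂).coeff 0)) :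
    v (H₁.coeff 0) = H₁.gaussNorm v c ∧ v (H₂.coeff 0) = H₂.gaussNorm v c := by
  rw [gaussNorm_mul hna hc, mul_coeff_zero, map_mul] at h
  refine skMulEq (by positivity) ?_ ?_
    (skPos v hna c hc h1) (skPos v hna c hc h2) h
  · simpa using le_gaussNorm v H₁ hc.le 0
  · simpa using le_gaussNorm v H₂ hc.le 0

include hc hna in
lemma skOne {H₁ H₂ : A[X]} (h1 : H₁ ≠ 0) (h2 : H₂ ≠ 0)
    (h : (H₁ * H₂).gaussNorm v c ≤ v ((H₁ * H₂).coeff 1) * c) :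
    (v (H₁.coeff 0) = H₁.gaussNorm v c ∧ v (H₂.coeff 1) * c = H₂.gaussNorm v c) ∨
    (v (H₂.coeff 0) = H₂.gaussNorm v c ∧ v (H₁.coeff 1) * c = H₁.gaussNorm v c) := by
  have e : (H₁ * H₂).coeff 1 = H₁.coeff 0 * H₂.coeff 1 + H₂.coeff 0 * H₁.coeff 1 := by
    rw [mul_coeff_one]; ring
  have a1 := le_gaussNorm v H₁ hc.le 0
  have a2 := le_gaussNorm v H₂ hc.le 0
  have b1 := le_gaussNorm v H₁ hc.le 1
  have b2 := le_gaussNorm v H₂ hc.le 1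
  simp only [pow_zero, mul_one, pow_one] at a1 a2 b1 b2
  rw [gaussNorm_mul hna hc, e] at h
  have p1 := skPos v hna c hc h1
  have p2 := skPos v hna c hc h2
  rcases le_max_iff.1 (hna (H₁.coeff 0 * H₂.coeff 1) (H₂.coeff 0 * H₁.coeff 1)) with k | k
  · left
    refine skMulEq (by positivity) a1 b2 p1 p2 ?_
    refine h.trans ((mul_le_mul_of_nonneg_right k hc.le).trans (le_of_eq ?_))
    rw [map_mul]; ring
  · right
    refine skMulEq (by positivity) a2 b1 p2 p1 ?_
    rw [mul_comm]
    refine h.trans ((mul_le_mul_of_nonneg_right k hc.le).trans (le_of_eq ?_))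
    rw [map_mul]; ring
end gauss

lemma skExp {a b : ℤ} (h : (2 : ℝ) ^ a = 2 ^ b) : a = b :=
  zpow_right_injective₀ (by norm_num) (by norm_num) h

/-- the core criterion -/
theorem skCore {K : Type*} [Field K] (n l r N : ℕ) (A2 A1 A0 F : K[X]) (hl : 1 < l) (hn : l < n)
    (hA2 : A2 ≠ 0) (hA1 : A1 ≠ 0) (hA0 : A0 ≠ 0) (hF : F ≠ 0)
    (hcop : IsCoprime A0 A2)
    (hr0 : A2.rootMultiplicity 1 = r) (hr1 : 1 ≤ A1.rootMultiplicity 1)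
    (hr2 : A0.rootMultiplicity 1 = 0)
    (hrl : r * (l - 1) ≤ n - 1) (hrn : Nat.Coprime (n - 1) r)
    (hd0 : n * A2.natDegree + N * n = n * F.natDegree)
    (hd1 : n * A1.natDegree + N * l ≤ n * F.natDegree)
    (hd2 : n * A0.natDegree + N ≤ n * F.natDegree)
    (hN : ¬ n ∣ N) :
    Irreducible (C A2 * X ^ n + C A1 * X ^ l + C A0 * X + C F : K[X][X]) := by
  set P : K[X][X] := C A2 * X ^ n + C A1 * X ^ l + C A0 * X + C F with hP
  have hco : ∀ i, P.coeff i = (if i = n then A2 else 0) + (if i = l then A1 else 0) +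
      (if i = 1 then A0 else 0) + (if i = 0 then F else 0) := by
    intro i
    simp only [hP, coeff_add, coeff_C_mul, coeff_X_pow, coeff_X, coeff_C, mul_ite, mul_one,
      mul_zero, eq_comm]
  have cn : P.coeff n = A2 := by
    rw [hco]; simp [show n ≠ l by omega, show n ≠ 1 by omega, show n ≠ 0 by omega]
  have cl : P.coeff l = A1 := by
    rw [hco]; simp [show l ≠ n by omega, show l ≠ 1 by omega, show l ≠ 0 by omega]
  have c1 : P.coeff 1 = A0 := by
    rw [hco]; simp [show 1 ≠ n by omega, show 1 ≠ l by omega]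
  have c0 : P.coeff 0 = F := by
    rw [hco]; simp [show 0 ≠ n by omega, show 0 ≠ l by omega]
  have cz : ∀ i, i ≠ n → i ≠ l → i ≠ 1 → i ≠ 0 → P.coeff i = 0 := by
    intro i h1 h2 h3 h4; rw [hco]; simp [h1, h2, h3, h4]
  have hdeg : P.natDegree = n := by
    apply natDegree_eq_of_le_of_coeff_ne_zero
    · rw [natDegree_le_iff_coeff_eq_zero]
      intro i hi
      exact cz i (by omega) (by omega) (by omega) (by omega)
    · rw [cn]; exact hA2
  have hlead : P.leadingCoeff = A2 := by rw [leadingCoeff, hdeg, cn]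
  have hP0 : P ≠ 0 := by
    intro h; rw [h] at hlead; simp at hlead; exact hA2 hlead.symm
  have hnorm : ∀ (v : AbsoluteValue K[X] ℝ) (c M : ℝ), 0 < c → 0 ≤ M → v A2 * c ^ n ≤ M →
      v A1 * c ^ l ≤ M → v A0 * c ≤ M → v F ≤ M → P.gaussNorm v c ≤ M := by
    intro v c M hc hM h1 h2 h3 h4
    refine skNormLe v c hc P M (fun i => ?_)
    by_cases i1 : i = n
    · subst i1; rwa [cn]
    by_cases i2 : i = l
    · subst i2; rwa [cl]
    by_cases i3 : i = 1
    · subst i3; rwa [c1, pow_one]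
    by_cases i4 : i = 0
    · subst i4; rwa [c0, pow_zero, mul_one]
    rw [cz i i1 i2 i3 i4]; simpa using hM
  -- infinity: no linear factors
  have hinf : ∀ H₁ H₂ : K[X][X], P = H₁ * H₂ → H₂.natDegree ≠ 1 := by
    intro H₁ H₂ h hd
    have h1 : H₁ ≠ 0 := by rintro rfl; simp at h; exact hP0 h
    have h2 : H₂ ≠ 0 := by rintro rfl; simp at h; exact hP0 h
    obtain ⟨v, hna, hv⟩ := skDegAbv K n
    have hc : (0 : ℝ) < 2 ^ (N : ℤ) := by positivity
    have hPn : P.gaussNorm v (2 ^ (N : ℤ)) ≤ 2 ^ ((n : ℤ) * F.natDegree) := by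
      apply hnorm v _ _ hc (by positivity)
      · rw [hv _ hA2, ← zpow_natCast, ← zpow_mul, ← zpow_add₀ (by norm_num)]
        apply zpow_le_zpow_right₀ (by norm_num)
        exact_mod_cast hd0.le
      · rw [hv _ hA1, ← zpow_natCast, ← zpow_mul, ← zpow_add₀ (by norm_num)]
        apply zpow_le_zpow_right₀ (by norm_num)
        exact_mod_cast hd1
      · rw [hv _ hA0, ← zpow_add₀ (by norm_num)]
        apply zpow_le_zpow_right₀ (by norm_num)
        exact_mod_cast hd2
      · rw [hv _ hF]
    have k1 := (skLead v hna _ hc h1 h2 (by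
      rw [← h, hlead, hdeg]
      refine hPn.trans (le_of_eq ?_)
      rw [hv _ hA2, ← zpow_natCast, ← zpow_mul, ← zpow_add₀ (by norm_num)]
      congr 1
      exact_mod_cast hd0.symm)).2
    have k2 := (skConst v hna _ hc h1 h2 (by
      rw [← h, c0, hv _ hF]; exact hPn)).2
    rw [← k2, hd, pow_one, hv _ (leadingCoeff_ne_zero.2 h2), hv, ← zpow_add₀ (by norm_num)] at k1
    · have := skExp k1
      apply hN
      have : (n : ℤ) ∣ N := ⟨(H₂.coeff 0).natDegree - (H₂.leadingCoeff).natDegree, by linarith⟩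
      exact_mod_cast this
    · intro h0
      have hh := skPos v hna _ hc h2
      rw [← k2, h0] at hh
      simp at hh
  -- the place T = 1
  have hone : ∀ H₁ H₂ : K[X][X], P = H₁ * H₂ → H₁.natDegree = 0 ∨ H₂.natDegree = 0 := by
    suffices hs : ∀ (v : AbsoluteValue K[X] ℝ), IsNonarchimedean v →
        (∀ p, p ≠ 0 → v p = (2 : ℝ) ^ (-(((n - 1 : ℕ) : ℤ) * p.rootMultiplicity 1))) →
        ∀ H₁ H₂ : K[X][X], P = H₁ * H₂ → H₁ ≠ 0 → H₂ ≠ 0 →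
        v H₁.leadingCoeff * (2 ^ (r : ℤ)) ^ H₁.natDegree = H₁.gaussNorm v (2 ^ (r : ℤ)) →
        v H₂.leadingCoeff * (2 ^ (r : ℤ)) ^ H₂.natDegree = H₂.gaussNorm v (2 ^ (r : ℤ)) →
        v (H₁.coeff 0) = H₁.gaussNorm v (2 ^ (r : ℤ)) →
        v (H₂.coeff 1) * (2 ^ (r : ℤ)) = H₂.gaussNorm v (2 ^ (r : ℤ)) → H₁.natDegree = 0 by
      intro H₁ H₂ h
      have h1 : H₁ ≠ 0 := by rintro rfl; simp at h; exact hP0 h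
      have h2 : H₂ ≠ 0 := by rintro rfl; simp at h; exact hP0 h
      obtain ⟨v, hna, hv⟩ := skOrdAbv K (n - 1)
      have hc : (0 : ℝ) < 2 ^ (r : ℤ) := by positivity
      have hA2' : v A2 * (2 ^ (r : ℤ)) ^ n = 2 ^ (r : ℤ) := by
        rw [hv _ hA2, ← zpow_natCast, ← zpow_mul, ← zpow_add₀ (by norm_num), hr0]
        congr 1
        push_cast [Nat.cast_sub (show 1 ≤ n by omega)]
        ring
      have hA0' : v A0 * (2 ^ (r : ℤ)) = 2 ^ (r : ℤ) := by
        rw [hv _ hA0, hr2]; simp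
      have hPn : P.gaussNorm v (2 ^ (r : ℤ)) ≤ 2 ^ (r : ℤ) := by
        apply hnorm v _ _ hc (by positivity)
        · exact hA2'.le
        · rw [hv _ hA1, ← zpow_natCast, ← zpow_mul, ← zpow_add₀ (by norm_num)]
          apply zpow_le_zpow_right₀ (by norm_num)
          have e1 : r * (l - 1) ≤ (n - 1) * A1.rootMultiplicity 1 :=
            hrl.trans (Nat.le_mul_of_pos_right _ hr1)
          zify [show 1 ≤ l by omega] at e1
          linarith
        · exact hA0'.le
        · rw [hv _ hF]
          apply zpow_le_zpow_right₀ (by norm_num)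
          have : (0 : ℤ) ≤ (((n - 1 : ℕ) : ℤ) * F.rootMultiplicity 1) := by positivity
          have : (0 : ℤ) ≤ r := by positivity
          linarith
      obtain ⟨k1, k2⟩ := skLead v hna _ hc h1 h2 (by
        rw [← h, hlead, hdeg, hA2']; exact hPn)
      rcases skOne v hna _ hc h1 h2 (by rw [← h, c1, hA0']; exact hPn) with ⟨k3, k4⟩ | ⟨k3, k4⟩
      · left; exact hs v hna hv H₁ H₂ h h1 h2 k1 k2 k3 k4
      · right; exact hs v hna hv H₂ H₁ (by rw [h, mul_comm]) h2 h1 k2 k1 k3 k4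
    intro v hna hv H₁ H₂ h h1 h2 k1 k2 k3 k4
    have hc : (0 : ℝ) < 2 ^ (r : ℤ) := by positivity
    have n1 : H₁.coeff 0 ≠ 0 := by
      intro h0
      have hh := skPos v hna _ hc h1
      rw [← k3, h0] at hh
      simp at hh
    have n2 : H₂.coeff 1 ≠ 0 := by
      intro h0
      have hh := skPos v hna _ hc h2
      rw [← k4, h0] at hh
      simp at hh
    have hsum : H₁.natDegree + H₂.natDegree = n := by
      rw [← hdeg, h, natDegree_mul h1 h2]
    have hd2 : 1 ≤ H₂.natDegree := le_natDegree_of_ne_zero n2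
    have hd2' : H₂.natDegree ≠ 1 := hinf H₁ H₂ h
    rw [← k3, hv _ n1, hv _ (leadingCoeff_ne_zero.2 h1), ← zpow_natCast, ← zpow_mul,
      ← zpow_add₀ (by norm_num)] at k1
    have e1 := skExp k1
    have dv : (((n - 1 : ℕ) : ℤ)) ∣ ((r * H₁.natDegree : ℕ) : ℤ) :=
      ⟨(H₁.leadingCoeff.rootMultiplicity 1 : ℤ) - (H₁.coeff 0).rootMultiplicity 1, by
        rw [Nat.cast_mul]; linarith⟩
    have dv' : (n - 1) ∣ H₁.natDegree := hrn.dvd_of_dvd_mul_left (by exact_mod_cast dv)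
    by_contra hne
    have := Nat.le_of_dvd (Nat.pos_of_ne_zero hne) dv'
    omega
  -- finish
  have hunit : ∀ H₁ H₂ : K[X][X], P = H₁ * H₂ → H₁.natDegree = 0 → IsUnit H₁ := by
    intro H₁ H₂ h hd
    rw [eq_C_of_natDegree_eq_zero hd] at h ⊢
    have hh : ∀ i, H₁.coeff 0 ∣ P.coeff i := by
      intro i; rw [h, coeff_C_mul]; exact dvd_mul_right _ _
    have := hcop.isUnit_of_dvd' (c1 ▸ hh 1) (cn ▸ hh n)
    exact this.map C
  constructor
  · intro hu
    have := natDegree_eq_zero_of_isUnit hu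
    omega
  · intro H₁ H₂ h
    rcases hone H₁ H₂ h with k | k
    · left; exact hunit H₁ H₂ h k
    · right; exact hunit H₂ H₁ (by rw [h, mul_comm]) k

lemma skArith (q₀ q m : ℕ) (h3 : 3 ≤ q₀) (hq : q = 3 * q₀ ^ 2) (hm : m = q - 3 * q₀ + 1) :
    m + 3 * q₀ = q + 1 ∧ 3 * (3 * q₀) ≤ q + 0 * m ∧ 27 ≤ q ∧ 1 ≤ m ∧
    m * (q - 1) * (q + 3 * q₀ + 1) + 2 * q ^ 2 + 1 = q ^ 3 + 2 * q ∧
    m * q * (q + 3 * q₀ + 1) + q ^ 2 = q ^ 3 + q ∧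
    m * (q - 1) * (q + 3 * q₀) + 3 * q ^ 2 + 3 * q₀ = q ^ 3 + 3 * q₀ * q + 2 * q ∧
    m * q * (q - 1) + 3 * q₀ * q ^ 2 + q = q ^ 3 + 3 * q₀ * q := by
  have h1 : 3 * (3 * q₀) ≤ q := by nlinarith
  have h2 : 27 ≤ q := by nlinarith
  have h4 : m + 3 * q₀ = q + 1 := by omega
  have hmz : (m : ℤ) = q - 3 * q₀ + 1 := by omega
  have hqz : (q : ℤ) = 3 * (q₀ : ℤ) ^ 2 := by exact_mod_cast hq
  refine ⟨h4, by omega, h2, by omega, ?_, ?_, ?_, ?_⟩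
  all_goals
    zify [show 1 ≤ q by omega]
    rw [hmz]
  · linear_combination (3 * (q : ℤ) - 3) * hqz
  · linear_combination (3 * (q : ℤ)) * hqz
  · linear_combination (3 * (q : ℤ) - 3) * hqz
  · ring

lemma skArith2 (q₀ q a c : ℕ) (h3 : 3 * (3 * q₀) ≤ q) (hq : 27 ≤ q) (haq : a < q ^ 3)
    (fc : c + 2 * q ^ 2 + 1 = q ^ 3 + 2 * q)
    (fa : a + 3 * q ^ 2 + 3 * q₀ = q ^ 3 + 3 * q₀ * q + 2 * q) :
    q ^ 2 * c + (q ^ 3 - a) * q ≤ q ^ 2 * q ^ 3 ∧ q ^ 2 * c + (q ^ 3 - a) ≤ q ^ 2 * q ^ 3 ∧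
    3 * q₀ * (q - 1) ≤ q ^ 2 - 1 := by
  obtain ⟨N, hN⟩ := Nat.exists_eq_add_of_le haq.le
  have e : q ^ 3 - a = N := by omega
  have g2 : 27 * q ≤ q ^ 2 := by nlinarith
  have hN4 : N ≤ 4 * q ^ 2 := by nlinarith
  have hcq : c + q ^ 2 ≤ q ^ 3 := by nlinarith
  have k : q ^ 2 * c + q ^ 2 * q ^ 2 ≤ q ^ 2 * q ^ 3 := by
    rw [← mul_add]; exact Nat.mul_le_mul_left _ hcq
  have k2 : N * q ≤ q ^ 2 * q ^ 2 := by
    calc N * q ≤ (4 * q ^ 2) * q := Nat.mul_le_mul_right _ hN4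
      _ = q ^ 2 * (4 * q) := by ring
      _ ≤ q ^ 2 * q ^ 2 := Nat.mul_le_mul_left _ (by omega)
  have k3 : N ≤ N * q := Nat.le_mul_of_pos_right _ (by omega)
  rw [e]
  refine ⟨by omega, by omega, ?_⟩
  calc 3 * q₀ * (q - 1) ≤ (q + 1) * (q - 1) := Nat.mul_le_mul_right _ (by omega)
    _ = q ^ 2 - 1 := by rw [← Nat.sq_sub_sq]; 

lemma skRoot {K : Type*} [Field K] [CharP K 3] (M q₀ : ℕ) (hMpos : 0 < M) (hM : (M : K) = -1)
    (hq : (q₀ : K) = 0) (k : ℕ) :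
    (-((X : K[X]) ^ (M * (q₀ + 1)) + X ^ (M * q₀) + 1) ^ k).rootMultiplicity 1 = k := by
  classical
  have hK3 : (3 : K) = 0 := by exact_mod_cast CharP.cast_eq_zero K 3
  rw [← count_roots, roots_neg, roots_pow, Multiset.count_nsmul, count_roots]
  set R : K[X] := X ^ (M * (q₀ + 1)) + X ^ (M * q₀) + 1 with hR
  have hd : (derivative R).eval 1 = -1 := by
    simp [hR, derivative_X_pow, hM, hq]
  have hR0 : R ≠ 0 := by
    intro h; rw [h] at hd; simp at hd
  have h1 : 0 < R.rootMultiplicity 1 := by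
    rw [rootMultiplicity_pos hR0]
    simp [hR, IsRoot]
    linear_combination hK3
  have h2 : ¬ 1 < R.rootMultiplicity 1 := by
    rw [one_lt_rootMultiplicity_iff_isRoot hR0]
    rintro ⟨-, h⟩
    rw [IsRoot, hd] at h
    simp at h
  rw [show R.rootMultiplicity 1 = 1 by omega, mul_one]

theorem skMain (s : ℕ) (hs : 1 ≤ s) (q₀ q m : ℕ)
    (hq₀ : q₀ = 3 ^ s) (hq : q = 3 * q₀ ^ 2) (hm : m = q - 3 * q₀ + 1)
    (K : Type*) [Field K] [CharP K 3] :
    Irreducible (C (-(X ^ (m * (q - 1) * (q + 3 * q₀)) + X ^ (m * q * (q - 1)) + 1)) * X ^ (q ^ 2)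
      + C (X ^ (m * (q - 1) * (q + 3 * q₀ + 1)) + X ^ (m * (q - 1) * (q + 3 * q₀))
          + X ^ (m * q * (q - 1))) * X ^ q
      + C (- X ^ (m * (q - 1) * (q + 3 * q₀ + 1))) * X
      + C (X ^ (q ^ 3) - X ^ (m * q * (q + 3 * q₀ + 1))) : K[X][X]) := by
  have h3 : 3 ≤ q₀ := by
    rw [hq₀]; calc 3 = 3 ^ 1 := rfl
      _ ≤ 3 ^ s := Nat.pow_le_pow_right (by norm_num) hs
  obtain ⟨f1, f2, f3, f4, fc, ff, fa, fb⟩ := skArith q₀ q m h3 hq hm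
  have hK3 : (3 : K) = 0 := by exact_mod_cast CharP.cast_eq_zero K 3
  have hq0K : (q₀ : K) = 0 := by
    rw [hq₀, Nat.cast_pow, show ((3 : ℕ) : K) = 0 by exact_mod_cast hK3, zero_pow (by omega)]
  have hqK : (q : K) = 0 := by rw [hq]; push_cast; rw [hK3]; ring
  have hmK : (m : K) = 1 := by
    have := congrArg (Nat.cast : ℕ → K) f1
    push_cast at this
    rw [hq0K, hqK] at this
    simpa using this
  have hM : (((m * (q - 1) : ℕ)) : K) = -1 := by
    rw [Nat.cast_mul, hmK, Nat.cast_sub (by omega), hqK]; simp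
  have eA : X ^ (m * (q - 1) * (q + 3 * q₀)) + X ^ (m * q * (q - 1)) + 1 =
      ((X : K[X]) ^ (m * (q - 1) * (q₀ + 1)) + X ^ (m * (q - 1) * q₀) + 1) ^ (3 * q₀) := by
    rw [hq₀, show 3 * 3 ^ s = 3 ^ (s + 1) by ring]
    have : Fact (Nat.Prime 3) := ⟨Nat.prime_three⟩
    rw [add_pow_char_pow, add_pow_char_pow, one_pow, ← pow_mul, ← pow_mul]
    have e : q = 3 ^ s * 3 ^ (s + 1) := by rw [hq, hq₀]; ring
    congr 3
    · rw [mul_assoc _ (3 ^ s + 1)]; congr 1; rw [add_mul, ← e]; ring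
    · rw [mul_assoc _ (3 ^ s), ← e]; ring
  have hMpos : 0 < m * (q - 1) := Nat.mul_pos f4 (by omega)
  set a := m * (q - 1) * (q + 3 * q₀) with ha
  set b := m * q * (q - 1) with hb
  set c := m * (q - 1) * (q + 3 * q₀ + 1) with hc
  set f := m * q * (q + 3 * q₀ + 1) with hf
  have hba : b < a := by
    rw [ha, hb, show m * q * (q - 1) = m * (q - 1) * q by ring]
    exact Nat.mul_lt_mul_of_pos_left (by omega) hMpos
  have hac : a < c := Nat.mul_lt_mul_of_pos_left (by omega) hMpos
  have hb0 : 0 < b := Nat.mul_pos (Nat.mul_pos f4 (by omega)) (by omega)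
  have g2 : 27 * q ≤ q ^ 2 := by rw [pow_two]; exact Nat.mul_le_mul_right _ f3
  have g1 : 3 * (3 * q₀) * q ≤ q ^ 2 := by
    rw [pow_two]; exact Nat.mul_le_mul_right _ (by omega)
  have hfq : f < q ^ 3 := by linarith
  have haq : a < q ^ 3 := by linarith
  have hrm : (-(X ^ a + X ^ b + 1) : K[X]).rootMultiplicity 1 = 3 * q₀ := by
    rw [eA]
    exact skRoot _ _ hMpos hM hq0K _
  clear eA hM hMpos
  clear_value a b c f
  obtain ⟨hq1, hq2, hq3⟩ := skArith2 q₀ q a c (by omega) f3 haq fc fa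
  have dR : (X ^ a + X ^ b + 1 : K[X]).natDegree = a := by
    have h1 : (X ^ a + X ^ b : K[X]).natDegree = a := by
      rw [natDegree_add_eq_left_of_natDegree_lt] <;> simp [hba]
    rw [natDegree_add_eq_left_of_natDegree_lt, h1]
    rw [h1, natDegree_one]; omega
  have dA1 : (X ^ c + X ^ a + X ^ b : K[X]).natDegree = c := by
    have h1 : (X ^ c + X ^ a : K[X]).natDegree = c := by
      rw [natDegree_add_eq_left_of_natDegree_lt] <;> simp [hac]
    rw [natDegree_add_eq_left_of_natDegree_lt, h1]
    rw [h1, natDegree_X_pow]; omega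
  have dA0 : (-X ^ c : K[X]).natDegree = c := by simp
  have dF : (X ^ (q ^ 3) - X ^ f : K[X]).natDegree = q ^ 3 := by
    rw [natDegree_sub_eq_left_of_natDegree_lt] <;> simp [hfq]
  have nR : (X ^ a + X ^ b + 1 : K[X]) ≠ 0 := by
    intro h; rw [h] at dR; simp at dR; omega
  have nA1 : (X ^ c + X ^ a + X ^ b : K[X]) ≠ 0 := by
    intro h; rw [h] at dA1; simp at dA1; omega
  have nF : (X ^ (q ^ 3) - X ^ f : K[X]) ≠ 0 := by
    intro h; rw [h] at dF; simp at dF; omega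
  apply skCore (q ^ 2) q (3 * q₀) (q ^ 3 - a)
  · omega
  · linarith
  · exact neg_ne_zero.2 nR
  · exact nA1
  · simp
  · exact nF
  · rw [IsCoprime.neg_left_iff, IsCoprime.neg_right_iff]
    apply IsCoprime.pow_left
    refine ⟨-(X ^ (a - 1) + X ^ (b - 1)), 1, ?_⟩
    rw [neg_mul, add_mul, ← pow_succ, ← pow_succ, Nat.sub_add_cancel (by omega),
      Nat.sub_add_cancel (by omega)]
    ring
  · exact hrm
  · rw [Nat.one_le_iff_ne_zero, ← Nat.pos_iff_ne_zero, rootMultiplicity_pos nA1]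
    simp [IsRoot]
    linear_combination hK3
  · apply rootMultiplicity_eq_zero
    simp [IsRoot]
  · exact hq3
  · have hdv : 3 * q₀ ∣ q ^ 2 := ⟨q₀ * q, by rw [pow_two]; nth_rw 1 [hq]; ring⟩
    apply Nat.Coprime.coprime_dvd_right hdv
    · have : q ^ 2 = (q ^ 2 - 1) + 1 := by
        have : 1 ≤ q ^ 2 := by linarith
        omega
      nth_rw 2 [this]
      simp
  · rw [natDegree_neg, dR, dF]
    zify [haq.le]; ring
  · rw [dA1, dF]
    exact hq1
  · rw [dA0, dF]
    exact hq2
  · rintro ⟨k, hk⟩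
    have hN : q ^ 3 - a + 3 * q₀ * q + 2 * q = 3 * q ^ 2 + 3 * q₀ := by omega
    rw [hk] at hN
    have hdv : q ∣ 3 * q₀ := by
      have h1 : q ∣ 3 * q ^ 2 + 3 * q₀ := by
        rw [← hN]; exact ⟨q * k + 3 * q₀ + 2, by ring⟩
      exact (Nat.dvd_add_right ⟨3 * q, by ring⟩).1 h1
    have := Nat.le_of_dvd (by omega) hdv
    omega

lemma skTD {K : Type*} [Field K] (i j D : ℕ) (h : i + j < D) :
    (MvPolynomial.X 0 ^ i * MvPolynomial.X 1 ^ j : MvPolynomial (Fin 2) K).totalDegree < D := by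
  refine lt_of_le_of_lt (MvPolynomial.totalDegree_mul _ _) ?_
  simpa [MvPolynomial.totalDegree_X_pow] using h

lemma skTDadd {K : Type*} [Field K] {D : ℕ} {p q : MvPolynomial (Fin 2) K}
    (hp : p.totalDegree < D) (hq : q.totalDegree < D) : (p + q).totalDegree < D :=
  lt_of_le_of_lt (MvPolynomial.totalDegree_add _ _) (max_lt hp hq)

lemma skTDneg {K : Type*} [Field K] {D : ℕ} {q : MvPolynomial (Fin 2) K}
    (hq : q.totalDegree < D) : (-q).totalDegree < D := by
  rwa [MvPolynomial.totalDegree_neg]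

/-- The plane model of the Skabelund curve `R̃_q` is absolutely irreducible of
total degree `q³`. -/
theorem skabelund_ree_plane_model_irreducible
    (s : ℕ) (hs : 1 ≤ s) (q₀ q m : ℕ)
    (hq₀ : q₀ = 3 ^ s) (hq : q = 3 * q₀ ^ 2) (hm : m = q - 3 * q₀ + 1)
    (K : Type*) [Field K] [IsAlgClosed K] [CharP K 3]
    (G : MvPolynomial (Fin 2) K)
    (hG : G = MvPolynomial.X 1 ^ (q ^ 3)
        - MvPolynomial.X 0 ^ (q ^ 2) * MvPolynomial.X 1 ^ (m * (q - 1) * (q + 3 * q₀))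
        - MvPolynomial.X 0 ^ (q ^ 2) * MvPolynomial.X 1 ^ (m * q * (q - 1))
        - MvPolynomial.X 0 ^ (q ^ 2)
        + MvPolynomial.X 0 ^ q * MvPolynomial.X 1 ^ (m * (q - 1) * (q + 3 * q₀ + 1))
        + MvPolynomial.X 0 ^ q * MvPolynomial.X 1 ^ (m * (q - 1) * (q + 3 * q₀))
        + MvPolynomial.X 0 ^ q * MvPolynomial.X 1 ^ (m * q * (q - 1))
        - MvPolynomial.X 0 * MvPolynomial.X 1 ^ (m * (q - 1) * (q + 3 * q₀ + 1))
        - MvPolynomial.X 1 ^ (m * q * (q + 3 * q₀ + 1))) :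
    Irreducible G ∧ G.totalDegree = q ^ 3 := by
  constructor
  · let e : MvPolynomial (Fin 2) K ≃ₐ[K] K[X][X] :=
      (MvPolynomial.finSuccEquiv K 1).trans
        (Polynomial.mapAlgEquiv (MvPolynomial.uniqueAlgEquiv K (Fin 1)))
    have e0 : e (MvPolynomial.X 0) = X := by
      simp [e, MvPolynomial.finSuccEquiv_X_zero]
    have e1 : e (MvPolynomial.X 1) = C X := by
      have : (1 : Fin 2) = Fin.succ 0 := rfl
      simp only [e, AlgEquiv.trans_apply, this, MvPolynomial.finSuccEquiv_X_succ]
      simp [MvPolynomial.uniqueAlgEquiv]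
    rw [← MulEquiv.irreducible_iff e]
    have := skMain s hs q₀ q m hq₀ hq hm K
    convert this using 1
    rw [hG]
    simp only [map_add, map_sub, map_mul, map_pow, e0, e1, map_neg, map_one]
    ring
  · have h3 : 3 ≤ q₀ := by
      rw [hq₀]; calc 3 = 3 ^ 1 := rfl
        _ ≤ 3 ^ s := Nat.pow_le_pow_right (by norm_num) hs
    obtain ⟨f1, f2, f3, f4, fc, ff, fa, fb⟩ := skArith q₀ q m h3 hq hm
    have g1 : 9 * q₀ * q ≤ q ^ 2 := by nlinarith
    have g2 : 27 * q ≤ q ^ 2 := by nlinarith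
    have g3 : 9 * q ^ 2 ≤ 3 * q₀ * q ^ 2 := by nlinarith
    have t1 := skTD (K := K) (q ^ 2) (m * (q - 1) * (q + 3 * q₀)) (q ^ 3) (by linarith)
    have t2 := skTD (K := K) (q ^ 2) (m * q * (q - 1)) (q ^ 3) (by linarith)
    have t3 := skTD (K := K) (q ^ 2) 0 (q ^ 3) (by nlinarith)
    have t4 := skTD (K := K) q (m * (q - 1) * (q + 3 * q₀ + 1)) (q ^ 3) (by linarith)
    have t5 := skTD (K := K) q (m * (q - 1) * (q + 3 * q₀)) (q ^ 3) (by linarith)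
    have t6 := skTD (K := K) q (m * q * (q - 1)) (q ^ 3) (by linarith)
    have t7 := skTD (K := K) 1 (m * (q - 1) * (q + 3 * q₀ + 1)) (q ^ 3) (by linarith)
    have t8 := skTD (K := K) 0 (m * q * (q + 3 * q₀ + 1)) (q ^ 3) (by linarith)
    have := skTDadd (skTDadd (skTDadd (skTDadd (skTDadd (skTDadd (skTDadd (skTDneg t1)
      (skTDneg t2)) (skTDneg t3)) t4) t5) t6) (skTDneg t7)) (skTDneg t8)
    have hG' := hG
    rw [← MvPolynomial.totalDegree_X_pow (R := K) (1 : Fin 2) (q ^ 3)] at this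
    have r := MvPolynomial.totalDegree_add_eq_left_of_totalDegree_lt this
    rw [MvPolynomial.totalDegree_X_pow] at r
    rw [← r, hG]
    congr 1
    ring
end

section
/- Let H ⊆ ℕ be a numerical semigroup of genus g ≥ 1 which is symmetric (that is, 2g − 1 ∉ H). Then for every integer ℓ ≥ 3g − 1, the minimum of the set {ν_m : m ≥ ℓ} equals ℓ + 1 − g. -/
/-- For a symmetric numerical semigroup `H` of genus `g ≥ 1` with Feng–Rao function
`ν`, the order bound `min {ν_m : m ≥ ℓ}` equals `ℓ + 1 - g` for every `ℓ ≥ 3g - 1`. -/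
theorem symmetric_semigroup_order_bound
    (H : Set ℕ) (h0 : 0 ∈ H) (hadd : ∀ a ∈ H, ∀ b ∈ H, a + b ∈ H)
    (hfin : (Hᶜ : Set ℕ).Finite)
    (g : ℕ) (hg : g = Nat.card (Hᶜ : Set ℕ)) (hg1 : 1 ≤ g)
    (hsym : 2 * g - 1 ∉ H)
    (σ : ℕ → ℕ) (hσ : σ = Nat.nth (· ∈ H))
    (ν : ℕ → ℕ)
    (hν : ∀ m, ν m = Nat.card {p : ℕ × ℕ | σ p.1 + σ p.2 = σ m})
    (ℓ : ℕ) (hℓ : 3 * g - 1 ≤ ℓ) :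
    sInf {n : ℕ | ∃ m, ℓ ≤ m ∧ n = ν m} = ℓ + 1 - g := by
  classical
  set G : Finset ℕ := hfin.toFinset with hG
  have hmem : ∀ x, x ∈ G ↔ x ∉ H := by intro x; simp [hG]
  have hcard : G.card = g := by
    rw [hg, hG, ← Set.ncard_eq_toFinset_card _ hfin]; rfl
  have hgap : ∀ x, x ∉ H → x + 1 ≤ 2 * g := by
    intro x hx
    have hsub : Finset.range (x + 1) ⊆ G ∪ G.image (fun a => x - a) := by
      intro a ha
      rw [Finset.mem_range] at ha
      by_cases h1 : a ∈ H
      · have h2 : x - a ∉ H := by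
          intro h2
          apply hx
          have := hadd _ h1 _ h2
          rwa [show a + (x - a) = x by omega] at this
        refine Finset.mem_union_right _ (Finset.mem_image.2 ⟨x - a, (hmem _).2 h2, by omega⟩)
      · exact Finset.mem_union_left _ ((hmem _).2 h1)
    have h1 := Finset.card_le_card hsub
    have h2 := Finset.card_union_le G (G.image (fun a => x - a))
    have h3 : (G.image (fun a => x - a)).card ≤ G.card := Finset.card_image_le
    rw [Finset.card_range] at h1
    omega
  have hinf : {x | x ∈ H}.Infinite := by
    have : (Hᶜᶜ : Set ℕ).Infinite := hfin.infinite_compl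
    rw [compl_compl] at this; exact this
  have hσm : ∀ m, g ≤ m → σ m = m + g := by
    intro m hm
    have hH : m + g ∈ H := by
      by_contra h
      have := hgap _ h
      omega
    have hc : Nat.count (· ∈ H) (m + g) = m := by
      rw [Nat.count_eq_card_filter_range]
      have : (Finset.range (m + g)).filter (· ∈ H) = Finset.range (m + g) \ G := by
        ext a; simp [hmem]
      rw [this, Finset.card_sdiff_of_subset, Finset.card_range, hcard]
      · omega
      · intro a ha
        have := hgap a ((hmem a).1 ha)
        rw [Finset.mem_range]; omega
    have := Nat.nth_count (p := (· ∈ H)) hH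
    rw [hc] at this
    rw [hσ]; exact this
  have hσH : ∀ i, σ i ∈ H := by
    intro i; rw [hσ]; exact Nat.nth_mem_of_infinite hinf i
  have hσinj : Function.Injective σ := by
    rw [hσ]; exact Nat.nth_injective hinf
  have hσsurj : ∀ a ∈ H, ∃ i, σ i = a := by
    intro a ha
    exact ⟨Nat.count (· ∈ H) a, by rw [hσ]; exact Nat.nth_count (p := (· ∈ H)) ha⟩
  have key : ∀ m, 3 * g - 1 ≤ m → ν m = m + 1 - g := by
    intro m hm
    rw [hν, hσm m (by omega)]
    have himg : (fun p : ℕ × ℕ => σ p.1) '' {p : ℕ × ℕ | σ p.1 + σ p.2 = m + g} =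
        ((Finset.range (m + g + 1) \ (G ∪ G.image (fun a => m + g - a)) : Finset ℕ) : Set ℕ) := by
      ext a
      simp only [Set.mem_image, Set.mem_ofPred_eq, Finset.mem_coe, Finset.mem_sdiff,
        Finset.mem_range, Finset.mem_union, Finset.mem_image, not_or, not_exists, not_and, hmem]
      constructor
      · rintro ⟨⟨i, j⟩, hij, rfl⟩
        simp only at hij ⊢
        refine ⟨by omega, fun h => h (hσH i), fun b hb hb' => hb ?_⟩
        have := hgap b hb
        rw [show b = σ j by omega]
        exact hσH j
      · rintro ⟨h1, h2, h3⟩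
        obtain ⟨i, hi⟩ := hσsurj a (not_not.1 h2)
        have h4 : m + g - a ∈ H := by
          by_contra h
          exact h3 _ h (by omega)
        obtain ⟨j, hj⟩ := hσsurj _ h4
        exact ⟨(i, j), by simp only; omega, hi⟩
    have hinj : Set.InjOn (fun p : ℕ × ℕ => σ p.1) {p : ℕ × ℕ | σ p.1 + σ p.2 = m + g} := by
      rintro ⟨i, j⟩ h1 ⟨i', j'⟩ h2 h
      simp only [Set.mem_ofPred_eq] at h1 h2 h
      exact Prod.ext (hσinj h) (hσinj (by simp only; omega))
    have hn := Set.InjOn.ncard_image hinj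
    rw [himg, Set.ncard_coe_finset] at hn
    rw [Nat.card_coe_set_eq, ← hn, Finset.card_sdiff_of_subset, Finset.card_range,
      Finset.card_union_of_disjoint, Finset.card_image_of_injOn, hcard]
    · omega
    · intro a ha b hb hab
      have h1 := hgap a ((hmem a).1 ha)
      have h2 := hgap b ((hmem b).1 hb)
      simp only at hab
      omega
    · rw [Finset.disjoint_left]
      intro a ha hb
      obtain ⟨b, hb, hab⟩ := Finset.mem_image.1 hb
      have h1 := hgap a ((hmem a).1 ha)
      have h2 := hgap b ((hmem b).1 hb)
      omega
    · intro a ha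
      rw [Finset.mem_range]
      rcases Finset.mem_union.1 ha with ha | ha
      · have h1 := hgap a ((hmem a).1 ha)
        omega
      · obtain ⟨b, hb, hab⟩ := Finset.mem_image.1 ha
        omega
  apply le_antisymm
  · exact Nat.sInf_le ⟨ℓ, le_rfl, (key ℓ hℓ).symm⟩
  · refine le_csInf ⟨_, ℓ, le_rfl, rfl⟩ ?_
    rintro n ⟨m, hm, rfl⟩
    rw [key m (by omega)]
    omega
end

section
/- Let H ⊆ ℕ be a numerical semigroup of genus g ≥ 1 which is symmetric (that is, 2g − 1 ∉ H). If ℓ ∈ ℕ is such that σ_ℓ = 2g − 1 + e for some e ∈ H with e ≠ 0, then the minimum of the set {ν_m : m ≥ ℓ} equals ν_ℓ. -/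
open Classical in
theorem gaps_aux (H : Set ℕ) (hadd : ∀ a ∈ H, ∀ b ∈ H, a + b ∈ H)
    (Γ : Finset ℕ) (hΓ : ∀ x, x ∈ Γ ↔ x ∉ H)
    (hg1 : 1 ≤ Γ.card) (hsym : 2 * Γ.card - 1 ∉ H) :
    ∀ x, x ∉ H → x ≤ 2 * Γ.card - 1 ∧ 2 * Γ.card - 1 - x ∈ H := by
  set g := Γ.card with hg
  set K := (Finset.range (2 * g)).filter (· ∈ H) with hK
  set L := (Finset.range (2 * g)).filter (¬ · ∈ H) with hL
  have hKL : K.card + L.card = 2 * g := by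
    have := Finset.card_filter_add_card_filter_not (s := Finset.range (2 * g)) (· ∈ H)
    simpa using this
  have hLΓ : L ⊆ Γ := by
    intro x hx
    simp only [hL, Finset.mem_filter] at hx
    exact (hΓ x).2 hx.2
  have himg : K.image (fun x => 2 * g - 1 - x) ⊆ L := by
    intro y hy
    simp only [hK, hL, Finset.mem_image, Finset.mem_filter, Finset.mem_range] at hy ⊢
    obtain ⟨x, ⟨hx, hxH⟩, rfl⟩ := hy
    refine ⟨by omega, fun h => hsym ?_⟩
    have := hadd _ hxH _ h
    rwa [show x + (2 * g - 1 - x) = 2 * g - 1 by omega] at this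
  have hinj : (K.image (fun x => 2 * g - 1 - x)).card = K.card := by
    apply Finset.card_image_of_injOn
    intro a ha b hb hab
    simp only [hK, Finset.coe_filter, Finset.mem_range, Set.mem_setOf_eq] at ha hb hab
    omega
  have h1 := Finset.card_le_card hLΓ
  have h2 := Finset.card_le_card himg
  have hLe : L = Γ := Finset.eq_of_subset_of_card_le hLΓ (by omega)
  have hIe : K.image (fun x => 2 * g - 1 - x) = L :=
    Finset.eq_of_subset_of_card_le himg (by omega)
  intro x hx
  have hxL : x ∈ K.image (fun x => 2 * g - 1 - x) := by rw [hIe, hLe]; exact (hΓ x).2 hx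
  simp only [hK, Finset.mem_image, Finset.mem_filter, Finset.mem_range] at hxL
  obtain ⟨y, ⟨hy, hyH⟩, rfl⟩ := hxL
  refine ⟨by omega, ?_⟩
  rwa [show 2 * g - 1 - (2 * g - 1 - y) = y by omega]

open Classical in
theorem count_aux (H : Set ℕ) (Γ : Finset ℕ) (hΓ : ∀ x, x ∈ Γ ↔ x ∉ H) (n : ℕ)
    (hn : ∀ x ∈ Γ, x ≤ n) :
    n + 1 + (Γ ∩ Γ.image (fun x => n - x)).card =
      ((Finset.range (n + 1)).filter (fun a => a ∈ H ∧ n - a ∈ H)).card + 2 * Γ.card := by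
  have h1 := Finset.card_filter_add_card_filter_not (s := Finset.range (n + 1))
    (fun a => a ∈ H ∧ n - a ∈ H)
  have h2 : (Finset.range (n + 1)).filter (fun a => ¬ (a ∈ H ∧ n - a ∈ H)) =
      Γ ∪ Γ.image (fun x => n - x) := by
    ext x
    simp only [Finset.mem_filter, Finset.mem_range, Finset.mem_union, Finset.mem_image]
    constructor
    · rintro ⟨hx, h⟩
      by_cases hxH : x ∈ H
      · exact Or.inr ⟨n - x, (hΓ _).2 fun h' => h ⟨hxH, h'⟩, by omega⟩
      · exact Or.inl ((hΓ _).2 hxH)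
    · rintro (h | ⟨y, hy, rfl⟩)
      · have := hn x h
        exact ⟨by omega, fun h' => (hΓ _).1 h h'.1⟩
      · have := hn y hy
        refine ⟨by omega, fun h' => (hΓ _).1 hy ?_⟩
        have h3 := h'.2
        rwa [show n - (n - y) = y by omega] at h3
  have h3 : (Γ.image (fun x => n - x)).card = Γ.card := by
    apply Finset.card_image_of_injOn
    intro a ha b hb hab
    have := hn a ha
    have := hn b hb
    simp only at hab
    omega
  have h4 := Finset.card_union_add_card_inter Γ (Γ.image (fun x => n - x))
  rw [h2, Finset.card_range] at h1
  omega

/-- For a symmetric numerical semigroup `H` of genus `g ≥ 1` with Feng–Rao function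
`ν`, if `σ_ℓ = 2g - 1 + e` with `e` a nonzero element of `H`, then
`min {ν_m : m ≥ ℓ} = ν_ℓ`. -/
theorem symmetric_semigroup_order_bound_campillo_farran
    (H : Set ℕ) (h0 : 0 ∈ H) (hadd : ∀ a ∈ H, ∀ b ∈ H, a + b ∈ H)
    (hfin : (Hᶜ : Set ℕ).Finite)
    (g : ℕ) (hg : g = Nat.card (Hᶜ : Set ℕ)) (hg1 : 1 ≤ g)
    (hsym : 2 * g - 1 ∉ H)
    (σ : ℕ → ℕ) (hσ : σ = Nat.nth (· ∈ H))
    (ν : ℕ → ℕ)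
    (hν : ∀ m, ν m = Nat.card {p : ℕ × ℕ | σ p.1 + σ p.2 = σ m})
    (ℓ : ℕ) (e : ℕ) (he : e ∈ H) (he0 : e ≠ 0)
    (hℓ : σ ℓ = 2 * g - 1 + e) :
    sInf {n : ℕ | ∃ m, ℓ ≤ m ∧ n = ν m} = ν ℓ := by
  classical
  set Γ := hfin.toFinset with hΓd
  have hΓ : ∀ x, x ∈ Γ ↔ x ∉ H := by intro x; simp [hΓd]
  have hgc : g = Γ.card := by
    rw [hg, Nat.card_coe_set_eq, Set.ncard_eq_toFinset_card _ hfin]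
  have hgaps := gaps_aux H hadd Γ hΓ (hgc ▸ hg1) (hgc ▸ hsym)
  rw [← hgc] at hgaps
  have hinf : (setOf (· ∈ H)).Infinite := by
    have := hfin.infinite_compl
    rwa [compl_compl] at this
  have hmono : StrictMono σ := hσ ▸ Nat.nth_strictMono hinf
  have hmem : ∀ i, σ i ∈ H := fun i => hσ ▸ Nat.nth_mem_of_infinite hinf i
  have hsurj : ∀ a ∈ H, ∃ i, σ i = a := by
    intro a ha
    exact ⟨Nat.count (· ∈ H) a, hσ ▸ Nat.nth_count (p := (· ∈ H)) ha⟩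
  have hνc : ∀ m, ν m =
      ((Finset.range (σ m + 1)).filter (fun a => a ∈ H ∧ σ m - a ∈ H)).card := by
    intro m
    rw [hν, Nat.card_coe_set_eq, ← Set.ncard_coe_finset,
      ← Set.ncard_image_of_injOn (f := fun p : ℕ × ℕ => σ p.1)]
    · congr 1
      ext a
      simp only [Set.mem_image, Set.mem_setOf_eq, Finset.coe_filter, Finset.mem_range]
      constructor
      · rintro ⟨⟨i, j⟩, h, rfl⟩
        simp only at h ⊢
        refine ⟨by omega, hmem _, ?_⟩
        rw [show σ m - σ i = σ j by omega]
        exact hmem _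
      · rintro ⟨h1, h2, h3⟩
        obtain ⟨i, hi⟩ := hsurj _ h2
        obtain ⟨j, hj⟩ := hsurj _ h3
        exact ⟨(i, j), by simp only; omega, hi⟩
    · rintro ⟨i, j⟩ h ⟨i', j'⟩ h' hh
      simp only [Set.mem_setOf_eq] at h h' hh
      have e1 : i = i' := hmono.injective hh
      have e2 : j = j' := hmono.injective (by omega)
      rw [e1, e2]
  have hcount : ∀ m, ℓ ≤ m → σ ℓ ≤ σ m ∧
      σ m + 1 + (Γ ∩ Γ.image (fun x => σ m - x)).card = ν m + 2 * g := by
    intro m hm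
    have h1 := hmono.monotone hm
    refine ⟨h1, ?_⟩
    rw [hνc, hgc]
    apply count_aux H Γ hΓ
    intro x hx
    have := (hgaps x ((hΓ x).1 hx)).1
    omega
  have hempty : Γ ∩ Γ.image (fun x => σ ℓ - x) = ∅ := by
    rw [Finset.eq_empty_iff_forall_notMem]
    intro x hx
    simp only [Finset.mem_inter, Finset.mem_image] at hx
    obtain ⟨hx, y, hy, hxy⟩ := hx
    obtain ⟨a1, a2⟩ := hgaps x ((hΓ x).1 hx)
    obtain ⟨b1, b2⟩ := hgaps y ((hΓ y).1 hy)
    apply hsym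
    have := hadd _ (hadd _ a2 _ b2) _ he
    rwa [show 2 * g - 1 - x + (2 * g - 1 - y) + e = 2 * g - 1 by omega] at this
  have hl := (hcount ℓ le_rfl).2
  rw [hempty, Finset.card_empty] at hl
  apply le_antisymm
  · exact Nat.sInf_le ⟨ℓ, le_rfl, rfl⟩
  · refine le_csInf (s := {n : ℕ | ∃ m, ℓ ≤ m ∧ n = ν m}) ⟨ν ℓ, ℓ, le_rfl, rfl⟩ ?_
    rintro n ⟨m, hm, rfl⟩
    obtain ⟨h1, h2⟩ := hcount m hm
    omega
end

section
/- Let s ≥ 1, q₀ = 2^s, q = 2q₀², m = q − 2q₀ + 1, and let F be a finite field with q⁴ elements. Then the number of triples (x, y, t) ∈ F³ satisfying y^q + y = x^{q₀}(x^q + x) and t^m = x^q + x equals q⁵ − q⁴ + q³. -/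
open Polynomial in
theorem ska_card_le {F : Type*} [Field F] [Fintype F] (S : Set F) (p : F[X]) (hp : p ≠ 0) (n : ℕ)
    (hn : p.natDegree ≤ n) (h : ∀ a ∈ S, p.eval a = 0) : Nat.card S ≤ n := by
  classical
  rw [Nat.card_eq_fintype_card, ← Set.toFinset_card]
  refine (Polynomial.card_le_degree_of_subset_roots (p := p) ?_).trans hn
  intro a ha
  have ha' : a ∈ S := by simpa using ha
  rw [Polynomial.mem_roots hp]
  exact h a ha'

open Polynomial in
theorem ska_addmaps {F : Type*} [Field F] [Fintype F] [CharP F 2] (q : ℕ) (hq : 1 < q)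
    (hadd : ∀ a b : F, (a + b) ^ q = a ^ q + b ^ q) (hF : Fintype.card F = q ^ 4) :
    Nat.card {a : F | a ^ q + a = 0} = q ∧
    ∀ w : F, w + w ^ q + (w ^ q) ^ q + ((w ^ q) ^ q) ^ q = 0 → ∃ x : F, x ^ q + x = w := by
  let f : F →+ F := AddMonoidHom.mk' (fun a => a ^ q + a) (by intro a b; simp only [hadd]; ring)
  let g : F →+ F := AddMonoidHom.mk' (fun w => w + w ^ q + (w ^ q) ^ q + ((w ^ q) ^ q) ^ q)
    (by intro a b; simp only [hadd]; ring)
  have h4 : ∀ a : F, (((a ^ q) ^ q) ^ q) ^ q = a := by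
    intro a
    have := FiniteField.pow_card a
    rw [hF] at this
    rw [← pow_mul, ← pow_mul, ← pow_mul]
    convert this using 2; ring
  have hle : f.range ≤ g.ker := by
    rintro _ ⟨a, rfl⟩
    rw [AddMonoidHom.mem_ker]
    change (a^q+a) + (a^q+a) ^ q + ((a^q+a) ^ q) ^ q + (((a^q+a) ^ q) ^ q) ^ q = 0
    simp only [hadd, h4]
    linear_combination (a + a^q + (a^q)^q + ((a^q)^q)^q) * (CharTwo.two_eq_zero : (2:F) = 0)
  have h1 : Nat.card f.ker ≤ q := by
    refine ska_card_le (f.ker : Set F) (X ^ q + X) ?_ q ?_ ?_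
    · intro h
      have := congrArg (fun p => coeff p 1) h
      simp [coeff_X_pow, hq.ne] at this
    · compute_degree; omega
    · intro a ha
      have ha' : a ^ q + a = 0 := ha
      simpa using ha'
  have h2 : Nat.card g.ker ≤ q ^ 3 := by
    refine ska_card_le (g.ker : Set F) (X + X ^ q + X ^ (q*q) + X ^ (q*q*q)) ?_ _ ?_ ?_
    · intro h
      have := congrArg (fun p => coeff p 1) h
      have e2 : 1 ≠ q * q := by nlinarith
      have e3 : 1 ≠ q * q * q := by nlinarith [mul_pos (show 0 < q by omega) (show 0 < q by omega)]
      simp only [coeff_add, coeff_X_pow, coeff_X_one, coeff_zero, if_neg hq.ne, if_neg e2, if_neg e3] at this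
      simp at this
    · have e1 : 1 ≤ q ^ 3 := Nat.one_le_pow _ _ (by omega)
      have e2 : q ≤ q ^ 3 := Nat.le_self_pow (by norm_num) q
      have e3 : q * q ≤ q ^ 3 := by rw [← sq]; exact Nat.pow_le_pow_right (by omega) (by norm_num)
      have e4 : q * q * q ≤ q ^ 3 := by apply le_of_eq; ring
      refine natDegree_add_le_of_degree_le (natDegree_add_le_of_degree_le (natDegree_add_le_of_degree_le ?_ ?_) ?_) ?_
      · simpa using e1
      all_goals simpa using (by assumption)
    · intro a ha
      have ha' : a + a ^ q + (a ^ q) ^ q + ((a ^ q) ^ q) ^ q = 0 := ha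
      simpa [pow_mul] using ha'
  have h3 : Nat.card f.ker * Nat.card f.range = q ^ 4 := by
    rw [← AddSubgroup.index_ker, AddSubgroup.card_mul_index, Nat.card_eq_fintype_card, hF]
  have h5 : Nat.card f.range ≤ Nat.card g.ker := AddSubgroup.card_le_of_le hle
  have hq3 : 0 < q ^ 3 := by positivity
  have h6 : Nat.card f.ker = q := by
    apply le_antisymm h1
    have : q * q ^ 3 ≤ Nat.card f.ker * q ^ 3 := by
      calc q * q ^ 3 = Nat.card f.ker * Nat.card f.range := by rw [h3]; ring
        _ ≤ _ := Nat.mul_le_mul_left _ (h5.trans h2)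
    exact Nat.le_of_mul_le_mul_right this hq3
  have h7 : Nat.card g.ker ≤ Nat.card f.range := by
    rw [h6] at h3
    have : q * Nat.card f.range = q * q ^ 3 := by rw [h3]; ring
    rw [Nat.eq_of_mul_eq_mul_left (by omega) this]; exact h2
  refine ⟨h6, fun w hw => ?_⟩
  have : w ∈ f.range := by
    rw [AddSubgroup.eq_of_le_of_card_ge hle h7]; exact hw
  exact this

theorem ska_mu {F : Type*} [Field F] [Fintype F] (a b : ℕ) (hb : 0 < b)
    (hF : Fintype.card F - 1 = a * b) (h0 : 0 < a) : Nat.card {z : F | z ^ b = 1} = b := by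
  classical
  obtain ⟨g, hg⟩ := IsCyclic.exists_ofOrder_eq_natCard (α := Fˣ)
  rw [Nat.card_eq_fintype_card, Fintype.card_units, hF] at hg
  have h1 : IsPrimitiveRoot (g : F) (a * b) := by
    rw [IsPrimitiveRoot.coe_units_iff, ← hg]; exact IsPrimitiveRoot.orderOf g
  have h2 : IsPrimitiveRoot ((g : F) ^ a) b := h1.pow (by positivity) rfl
  have := h2.card_nthRootsFinset
  conv_rhs => rw [← this]
  rw [← Nat.card_eq_finsetCard]
  apply Nat.card_congr
  apply Equiv.subtypeEquivRight
  intro x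
  rw [Polynomial.mem_nthRootsFinset hb]; rfl
/-- t-coordinates of points -/
def SkaP {F : Type*} [Field F] (q q₀ : ℕ) (u : F) : Prop :=
  ∃ x y : F, y ^ q + y = x ^ q₀ * (x ^ q + x) ∧ u = x ^ q + x

theorem ska_arith (s q₀ q m : ℕ) (hs : 1 ≤ s)
    (hq₀ : q₀ = 2 ^ s) (hq : q = 2 * q₀ ^ 2) (hm : m = q - 2 * q₀ + 1) :
    q = 2 ^ (2 * s + 1) ∧ m * (q + 2 * q₀ + 1) = q ^ 2 + 1 ∧ 1 < q ∧ Nat.Coprime m (q ^ 2 - 1) := by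
  have h2 : 2 ≤ q₀ := by rw [hq₀]; exact Nat.le_self_pow (by omega) 2
  have h3 : 2 * q₀ ≤ q := by rw [hq]; nlinarith
  have h4 : m * (q + 2 * q₀ + 1) = q ^ 2 + 1 := by
    obtain ⟨k, hk⟩ := Nat.exists_eq_add_of_le h3
    have : m = k + 1 := by omega
    rw [this]
    zify at *
    have : (k : ℤ) = q - 2 * q₀ := by linarith
    rw [this]
    linear_combination 2 * hq
  have h5 : 1 < q := by omega
  refine ⟨by rw [hq, hq₀]; ring, h4, h5, ?_⟩
  have h6 : 1 < q ^ 2 := by nlinarith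
  have h7 : Nat.Coprime (q ^ 2 + 1) (q ^ 2 - 1) := by
    have e : q ^ 2 + 1 = (q ^ 2 - 1) + 2 := by omega
    rw [e, Nat.coprime_self_add_left, Nat.coprime_two_left]
    have : Even (q ^ 2) := by rw [hq]; exact (even_two_mul _).pow_of_ne_zero (by norm_num)
    exact Nat.Even.sub_odd (by omega) this odd_one
  exact Nat.Coprime.coprime_dvd_left ⟨_, h4.symm⟩ h7

/-- necessity: two points in the same fibre -/
theorem ska_nec {F : Type*} [Field F] [CharP F 2] (q q₀ : ℕ)
    (hadd : ∀ a b : F, (a + b) ^ q = a ^ q + b ^ q)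
    (hadd0 : ∀ a b : F, (a + b) ^ q₀ = a ^ q₀ + b ^ q₀)
    (h4 : ∀ a : F, (((a ^ q) ^ q) ^ q) ^ q = a) (u : F) (h : SkaP q q₀ u) :
    u + u ^ q + (u ^ q) ^ q + ((u ^ q) ^ q) ^ q = 0 ∧ ((u ^ q) ^ q = u → u ^ q = u) := by
  obtain ⟨x, y, h1, h2⟩ := h
  have two : (2 : F) = 0 := CharTwo.two_eq_zero
  constructor
  · rw [h2]; simp only [hadd, h4]
    linear_combination (x + x^q + (x^q)^q + ((x^q)^q)^q) * two
  · intro hu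
    rw [← h2] at h1
    have e1 : x ^ q = x + u := by linear_combination -x * two - h2
    have g : ∀ w : F, w = y ^ q + y → w + w ^ q + (w ^ q) ^ q + ((w ^ q) ^ q) ^ q = 0 := by
      intro w hw
      rw [hw]; simp only [hadd, h4]
      linear_combination (y + y^q + (y^q)^q + ((y^q)^q)^q) * two
    have := g _ h1.symm
    have c : ∀ a : F, (a ^ q₀) ^ q = (a ^ q) ^ q₀ := fun a => by rw [← pow_mul, ← pow_mul, mul_comm]
    simp only [mul_pow, c, e1, hadd, hadd0, hu] at this
    have h8 : (u + u ^ q) ^ (q₀ + 1) = 0 := by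
      rw [pow_succ, hadd0]
      linear_combination this - (x ^ q₀ * (u + u^q) + u^q₀ * u^q) * two
    have := pow_eq_zero_iff (by omega) |>.1 h8
    linear_combination this - u * two

theorem ska_suf {F : Type*} [Field F] [CharP F 2] (q q₀ : ℕ) (hqq : q = 2 * q₀ ^ 2)
    (hadd : ∀ a b : F, (a + b) ^ q = a ^ q + b ^ q)
    (hadd0 : ∀ a b : F, (a + b) ^ q₀ = a ^ q₀ + b ^ q₀)
    (hsurj : ∀ w : F, w + w ^ q + (w ^ q) ^ q + ((w ^ q) ^ q) ^ q = 0 → ∃ x : F, x ^ q + x = w)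
    (d : F) (hd : d ^ (q + 2 * q₀ + 1) = 1) (hd1 : 1 + d ≠ 0) : SkaP q q₀ (1 + d)⁻¹ := by
  have two : (2 : F) = 0 := CharTwo.two_eq_zero
  have c : ∀ a : F, (a ^ q₀) ^ q = (a ^ q) ^ q₀ := fun a => by rw [← pow_mul, ← pow_mul, mul_comm]
  have hd0 : d ≠ 0 := by rintro rfl; simp at hd
  obtain ⟨D, hD⟩ : ∃ D, D = d ^ q₀ := ⟨_, rfl⟩
  have hD0 : D ≠ 0 := by rw [hD]; exact pow_ne_zero _ hd0
  have hdq : d ^ q * (d * D ^ 2) = 1 := by rw [hD, ← hd]; ring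
  have hDD : (D ^ q₀) ^ 2 = d ^ q := by rw [hD, hqq]; ring
  have hdqq : d ^ q = (d * D ^ 2)⁻¹ := eq_inv_of_mul_eq_one_left hdq
  have hDq : D ^ q = d * D := by
    rw [hD, c, hdqq, ← hD, inv_pow, mul_pow, ← hD, ← pow_mul, mul_comm 2, pow_mul, hDD, hdqq]
    field_simp
  have hdq2 : (d ^ q) ^ q = d⁻¹ := by
    rw [hdqq, inv_pow, mul_pow, ← pow_mul, mul_comm 2, pow_mul, hDq, hdqq]
    field_simp
  have nz : ∀ a n, (1 : F) + a ≠ 0 → (∀ b : F, (1 + b) ^ n = 1 + b ^ n) → 1 + a ^ n ≠ 0 := by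
    intro a n h h'; rw [← h']; exact pow_ne_zero _ h
  have k0 : ∀ b : F, (1 + b) ^ q₀ = 1 + b ^ q₀ := fun b => by rw [hadd0, one_pow]
  have k : ∀ b : F, (1 + b) ^ q = 1 + b ^ q := fun b => by rw [hadd, one_pow]
  have n1 : 1 + D ≠ 0 := by rw [hD]; exact nz _ _ hd1 k0
  have n2 : 1 + d * D ≠ 0 := by rw [← hDq]; exact nz _ _ n1 k
  have n3' : 1 + d ^ q ≠ 0 := nz _ _ hd1 k
  have n3 : 1 + d * D ^ 2 ≠ 0 := by
    intro h; apply n3'; rw [hdqq]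
    rw [show d * D ^ 2 = 1 by linear_combination h - two]; simp; linear_combination two
  obtain ⟨u, hu⟩ : ∃ u, u = (1 + d)⁻¹ := ⟨_, rfl⟩
  rw [← hu]
  have hu1 : u ^ q = d * D ^ 2 / (1 + d * D ^ 2) := by
    rw [hu, inv_pow, k, hdqq, show 1 + (d * D ^ 2)⁻¹ = (1 + d * D ^ 2) / (d * D ^ 2) by field_simp; ring, inv_div]
  have hU : u ^ q₀ = 1 / (1 + D) := by rw [hu, inv_pow, k0, ← hD, one_div]
  have hV : (u ^ q) ^ q₀ = 1 / (1 + d * D) := by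
    rw [← c, hU, div_pow, k, hDq, one_pow]
  have hu2 : (u ^ q) ^ q = 1 + u := by
    rw [hu, inv_pow, inv_pow, k, k, hdq2, show 1 + d⁻¹ = (1 + d) / d by field_simp; ring, inv_div]
    field_simp
    linear_combination -two
  obtain ⟨x, hx⟩ := hsurj u (by
    rw [hu2, k, hu]; linear_combination (1 + (1+d)⁻¹ + ((1+d)⁻¹)^q) * two)
  have e1 : x ^ q = x + u := by linear_combination hx - x * two
  obtain ⟨y, hy⟩ := hsurj (x ^ q₀ * u) (by
    simp only [mul_pow, c, e1, hadd, hadd0, hu2, one_pow]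
    rw [hV, hU, hu1, hu]
    field_simp
    grind)
  exact ⟨x, y, by rw [hx, hy], hx.symm⟩

theorem ska_one {F : Type*} [Field F] [CharP F 2] (q q₀ : ℕ)
    (hadd : ∀ a b : F, (a + b) ^ q = a ^ q + b ^ q)
    (hadd0 : ∀ a b : F, (a + b) ^ q₀ = a ^ q₀ + b ^ q₀)
    (hsurj : ∀ w : F, w + w ^ q + (w ^ q) ^ q + ((w ^ q) ^ q) ^ q = 0 → ∃ x : F, x ^ q + x = w) :
    SkaP q q₀ (1 : F) := by
  have two : (2 : F) = 0 := CharTwo.two_eq_zero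
  have c : ∀ a : F, (a ^ q₀) ^ q = (a ^ q) ^ q₀ := fun a => by rw [← pow_mul, ← pow_mul, mul_comm]
  obtain ⟨x, hx⟩ := hsurj 1 (by simp only [one_pow]; linear_combination 2 * two)
  have e1 : x ^ q = x + 1 := by linear_combination hx - x * two
  obtain ⟨y, hy⟩ := hsurj (x ^ q₀) (by
    simp only [c, e1, hadd, hadd0, one_pow]
    linear_combination (2 * x ^ q₀ + 3) * two)
  exact ⟨x, y, by rw [hx, hy, mul_one], hx.symm⟩

theorem ska_scale {F : Type*} [Field F] (q q₀ : ℕ) (u a : F) (ha : a ^ q = a) (h : SkaP q q₀ u) :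
    SkaP q q₀ (a * u) := by
  obtain ⟨x, y, h1, h2⟩ := h
  refine ⟨a * x, a ^ (q₀ + 1) * y, ?_, ?_⟩
  · have : (a ^ (q₀ + 1)) ^ q = a ^ (q₀ + 1) := by rw [← pow_mul, mul_comm, pow_mul, ha]
    rw [mul_pow, mul_pow, mul_pow, this, ha]
    linear_combination a ^ (q₀ + 1) * h1
  · rw [mul_pow, ha, h2]; ring

theorem ska_fibre {F : Type*} [Field F] [Fintype F] [CharP F 2] (q q₀ : ℕ)
    (hadd : ∀ a b : F, (a + b) ^ q = a ^ q + b ^ q)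
    (hadd0 : ∀ a b : F, (a + b) ^ q₀ = a ^ q₀ + b ^ q₀)
    (hker : Nat.card {a : F | a ^ q + a = 0} = q) (u : F) (h : SkaP q q₀ u) :
    Nat.card {p : F × F | p.2 ^ q + p.2 = p.1 ^ q₀ * (p.1 ^ q + p.1) ∧ u = p.1 ^ q + p.1}
      = q ^ 2 := by
  have two : (2 : F) = 0 := CharTwo.two_eq_zero
  have c : ∀ a : F, (a ^ q₀) ^ q = (a ^ q) ^ q₀ := fun a => by rw [← pow_mul, ← pow_mul, mul_comm]
  obtain ⟨x, y, h1, h2⟩ := h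
  have key : ∀ a : F, a ^ q + a = 0 ↔ a ^ q = a := fun a =>
    ⟨fun h => by linear_combination h - a * two, fun h => by linear_combination h + a * two⟩
  have hq2 : q ^ 2 = Nat.card ({a : F | a ^ q + a = 0} × {a : F | a ^ q + a = 0}) := by
    rw [Nat.card_prod, hker, sq]
  rw [hq2]
  symm
  refine Nat.card_congr ⟨fun p => ⟨(x + p.1.1, y + p.1.1 ^ q₀ * x + p.2.1), ?_⟩,
    fun p => (⟨p.1.1 + x, ?_⟩, ⟨p.1.2 + y + (p.1.1 + x) ^ q₀ * x, ?_⟩), ?_, ?_⟩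
  · obtain ⟨⟨a, ha⟩, ⟨b, hb⟩⟩ := p
    have ha' := (key a).1 ha
    have hb' := (key b).1 hb
    simp only [Set.mem_ofPred_eq, hadd, hadd0, mul_pow, c, ha', hb']
    constructor
    · linear_combination h1 + (b - x ^ q₀ * a  - a ^ q₀ * a) * two
    · linear_combination h2 - a * two
  · have := p.2.2
    simp only [Set.mem_ofPred_eq, hadd]
    linear_combination -this + h2 + (x ^ q + x) * two
  · obtain ⟨⟨a, b⟩, hp1, hp2⟩ := p
    simp only at hp1 hp2
    have e : a ^ q + x ^ q = a + x := by linear_combination -hp2 + h2 + (x ^ q - a) * two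
    simp only [Set.mem_ofPred_eq, hadd, hadd0, mul_pow, c]
    have e2 : (a ^ q) ^ q₀ + (x ^ q) ^ q₀ = a ^ q₀ + x ^ q₀ := by rw [← hadd0, e, hadd0]
    rw [e2]
    rw [← hp2] at hp1
    rw [← h2] at h1
    linear_combination hp1 + h1 - (a ^ q₀ + x ^ q₀) * h2 + (a ^ q₀ + x ^ q₀) * u * two
  · rintro ⟨⟨a, ha⟩, ⟨b, hb⟩⟩
    have e : x + a + x = a := by linear_combination x * two
    simp only [Prod.mk.injEq, Subtype.mk.injEq, e]
    exact ⟨trivial, by linear_combination (y + a ^ q₀ * x) * two⟩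
  · rintro ⟨⟨a, b⟩, hp⟩
    simp only [Prod.mk.injEq, Subtype.mk.injEq]
    exact ⟨by linear_combination x * two, by linear_combination (y + (a + x) ^ q₀ * x) * two⟩

theorem ska_fib_count {α β : Type*} [Finite α] [Finite β] (S : Set α) (T : Set β) (f : α → β)
    (n : ℕ) (hf : ∀ a ∈ S, f a ∈ T) (h : ∀ b ∈ T, Nat.card {a : α | a ∈ S ∧ f a = b} = n) :
    Nat.card S = Nat.card T * n := by
  classical
  let e : S ≃ Σ b : T, {a : α | a ∈ S ∧ f a = b.1} :=
    ⟨fun a => ⟨⟨f a.1, hf _ a.2⟩, ⟨a.1, a.2, rfl⟩⟩, fun p => ⟨p.2.1, p.2.2.1⟩,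
      fun a => rfl, by rintro ⟨⟨b, hb⟩, ⟨a, ha, hab⟩⟩; dsimp only at hab; subst hab; rfl⟩
  have := Fintype.ofFinite T
  rw [Nat.card_congr e, Nat.card_sigma, Finset.sum_congr rfl (fun b _ => h b.1 b.2)]
  simp [Nat.card_eq_fintype_card]

/-- The Skabelund curve `S̃_q` has exactly `q⁵ - q⁴ + q³` affine
`F_{q⁴}`-rational points. -/
theorem skabelund_suzuki_affine_point_count
    (s : ℕ) (hs : 1 ≤ s) (q₀ q m : ℕ)
    (hq₀ : q₀ = 2 ^ s) (hq : q = 2 * q₀ ^ 2) (hm : m = q - 2 * q₀ + 1)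
    (F : Type*) [Field F] [Fintype F] (hF : Fintype.card F = q ^ 4) :
    Nat.card {p : F × F × F |
        p.2.1 ^ q + p.2.1 = p.1 ^ q₀ * (p.1 ^ q + p.1) ∧
        p.2.2 ^ m = p.1 ^ q + p.1} = q ^ 5 - q ^ 4 + q ^ 3 := by
  obtain ⟨hq2, hmq, hq1, hcop⟩ := ska_arith s q₀ q m hs hq₀ hq hm
  have : Fact (Nat.Prime 2) := ⟨Nat.prime_two⟩
  have : CharP F 2 := charP_of_card_eq_prime_pow (p := 2) (f := (2 * s + 1) * 4) (by
    rw [hF, hq2, pow_mul])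
  have two : (2 : F) = 0 := CharTwo.two_eq_zero
  have hadd : ∀ a b : F, (a + b) ^ q = a ^ q + b ^ q := by
    intro a b; rw [hq2]; exact add_pow_char_pow a b _ _
  have hadd0 : ∀ a b : F, (a + b) ^ q₀ = a ^ q₀ + b ^ q₀ := by
    intro a b; rw [hq₀]; exact add_pow_char_pow a b _ _
  obtain ⟨hker, hsurj⟩ := ska_addmaps q hq1 hadd hF
  have h4 : ∀ a : F, (((a ^ q) ^ q) ^ q) ^ q = a := by
    intro a
    have := FiniteField.pow_card a
    rw [hF] at this
    rw [← pow_mul, ← pow_mul, ← pow_mul]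
    convert this using 2; ring
  have hqq : 1 < q ^ 2 := by nlinarith
  have hm0 : m ≠ 0 := by omega
  have hsub : (q ^ 2 - 1) * (q ^ 2 + 1) = q ^ 4 - 1 := by
    obtain ⟨k, hk⟩ := Nat.exists_eq_add_of_le hqq.le
    have : q ^ 4 = (q ^ 2) ^ 2 := by ring
    rw [this, hk]
    have : (1 + k) ^ 2 - 1 = k * (k + 2) := by
      have : (1 + k) ^ 2 = k * (k + 2) + 1 := by ring
      omega
    rw [this, Nat.add_sub_cancel_left]; ring
  have hq21 : (q - 1) * (q + 1) = q ^ 2 - 1 := by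
    rw [mul_comm, ← Nat.sq_sub_sq, one_pow]
  have hmu : Nat.card {z : F | z ^ (q ^ 2 + 1) = 1} = q ^ 2 + 1 :=
    ska_mu (q ^ 2 - 1) (q ^ 2 + 1) (by omega) (by rw [hF, hsub]) (by omega)
  have key : ∀ a : F, a ^ q + a = 0 ↔ a ^ q = a := fun a =>
    ⟨fun h => by linear_combination h - a * two, fun h => by linear_combination h + a * two⟩
  -- nonzero fixed elements
  have hK : Nat.card {a : F | a ≠ 0 ∧ a ^ q = a} = q - 1 := by
    have e : {a : F | a ≠ 0 ∧ a ^ q = a} = {a : F | a ^ q + a = 0} \ {0} := by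
      ext a; simp only [Set.mem_ofPred_eq, Set.mem_sdiff, Set.mem_singleton_iff, key]; tauto
    rw [e, Nat.card_coe_set_eq, Set.ncard_sdiff_singleton_of_mem, ← Nat.card_coe_set_eq, hker]
    simp [show q ≠ 0 by omega]
  have hexist : ∀ z : F, z ^ (q ^ 2 + 1) = 1 → ∃ t : F, t ≠ 0 ∧ SkaP q q₀ (t ^ m) ∧
      t ^ (q ^ 2 - 1) = z := by
    intro z hz
    have hz0 : z ≠ 0 := by rintro rfl; simp at hz
    have hu : ∃ u : F, u ≠ 0 ∧ SkaP q q₀ u ∧ u ^ (q ^ 2 - 1) = z ^ m := by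
      by_cases hd1 : 1 + z ^ m = 0
      · refine ⟨1, one_ne_zero, ska_one q q₀ hadd hadd0 hsurj, ?_⟩
        rw [one_pow]; linear_combination -hd1 + two
      · refine ⟨(1 + z ^ m)⁻¹, inv_ne_zero hd1, ska_suf q q₀ hq hadd hadd0 hsurj _ ?_ hd1, ?_⟩
        · rw [← pow_mul, hmq, hz]
        · have h1 : ((1 + z ^ m)⁻¹) ^ (q ^ 2) = (1 + z ^ m)⁻¹ ^ (q ^ 2 - 1) * (1 + z ^ m)⁻¹ := by
            rw [← pow_succ]; congr 1; omega
          have h2 : (1 + z ^ m) ^ (q ^ 2) = 1 + (z ^ m)⁻¹ := by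
            rw [sq, pow_mul, hadd, hadd, one_pow, one_pow, ← pow_mul _ q q, ← sq]
            congr 1
            apply eq_inv_of_mul_eq_one_left
            rw [← pow_succ, ← pow_mul, mul_comm, pow_mul, hz, one_pow]
          have hzm : z ^ m ≠ 0 := pow_ne_zero _ hz0
          have h3 : 1 + (z ^ m)⁻¹ = (1 + z ^ m) / z ^ m := by field_simp; ring
          rw [inv_pow, h2, h3, inv_div, div_eq_mul_inv] at h1
          exact (mul_right_cancel₀ (inv_ne_zero hd1) h1).symm
    obtain ⟨u, hu0, hu1, hu2⟩ := hu
    have bez := Nat.gcd_eq_gcd_ab m (q ^ 2 - 1)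
    rw [hcop.gcd_eq_one] at bez
    set A := Nat.gcdA m (q ^ 2 - 1)
    set B := Nat.gcdB m (q ^ 2 - 1)
    have hu2' : u ^ ((q ^ 2 - 1 : ℕ) : ℤ) = z ^ (m : ℤ) := by simpa only [zpow_natCast] using hu2
    have ht : (u ^ A * z ^ B) ^ m = u := by
      rw [← zpow_natCast, mul_zpow, ← zpow_mul, ← zpow_mul, mul_comm B, zpow_mul z, ← hu2',
        ← zpow_mul, ← zpow_add₀ hu0, mul_comm A, ← bez]; simp
    refine ⟨u ^ A * z ^ B, mul_ne_zero (zpow_ne_zero _ hu0) (zpow_ne_zero _ hz0), ?_, ?_⟩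
    · rw [ht]; exact hu1
    · rw [← zpow_natCast, mul_zpow, ← zpow_mul, ← zpow_mul, mul_comm A, zpow_mul u, hu2',
        ← zpow_mul, ← zpow_add₀ hz0, mul_comm B, ← bez]; simp
  have huniq : ∀ t r : F, t ≠ 0 → r ≠ 0 → SkaP q q₀ (t ^ m) → SkaP q q₀ ((r * t) ^ m) →
      r ^ (q ^ 2 - 1) = 1 → r ^ q = r := by
    intro t r ht hr h1 h2 hr2
    have hrq : ∀ n, ((r ^ n) ^ q) ^ q = r ^ n := by
      intro n
      have : (r ^ q) ^ q = r := by
        rw [← pow_mul, ← sq, show q ^ 2 = (q ^ 2 - 1) + 1 by omega, pow_succ, hr2, one_mul]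
      rw [← pow_mul, ← pow_mul, show n * (q * q) = q * q * n by ring, pow_mul, pow_mul r q q, this]
    rw [mul_pow] at h2
    have hR := hrq m
    have hR0 : r ^ m ≠ 0 := pow_ne_zero _ hr
    have hu0 : t ^ m ≠ 0 := pow_ne_zero _ ht
    have n1 := ska_nec q q₀ hadd hadd0 h4 _ h1
    have n2 := ska_nec q q₀ hadd hadd0 h4 _ h2
    have hRq : (r ^ m) ^ q = r ^ m := by
      generalize r ^ m = R at *
      generalize t ^ m = u at *
      obtain ⟨a1, a2⟩ := n1
      obtain ⟨b1, b2⟩ := n2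
      simp only [mul_pow, hR] at b1 b2
      by_cases hT : (u ^ q) ^ q = u
      · have e1 := a2 hT
        rw [hT, e1] at b2
        exact mul_right_cancel₀ hu0 (b2 rfl)
      · have : (R ^ q - R) * ((u ^ q) ^ q - u) = 0 := by
          linear_combination R ^ q * a1 - b1 + (- (R ^ q) * u + R * u) * two
        rcases mul_eq_zero.1 this with h | h
        · linear_combination h
        · exact absurd (by linear_combination h) hT
    have c1 : (r ^ (q - 1)) ^ m = 1 := by
      rw [← pow_mul, mul_comm, pow_mul]
      have : (r ^ m) ^ (q - 1) * r ^ m = 1 * r ^ m := by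
        rw [← pow_succ, one_mul, show q - 1 + 1 = q by omega, hRq]
      exact mul_right_cancel₀ hR0 this
    have c2 : (r ^ (q - 1)) ^ (q + 1) = 1 := by rw [← pow_mul, hq21, hr2]
    have c3 : Nat.Coprime m (q + 1) := Nat.Coprime.coprime_dvd_right ⟨q - 1, by rw [← hq21, mul_comm]⟩ hcop
    have c4 : r ^ (q - 1) = 1 := by
      have := pow_gcd_eq_one.2 ⟨c1, c2⟩
      rwa [c3.gcd_eq_one, pow_one] at this
    rw [show q = q - 1 + 1 by omega, pow_succ, c4, one_mul]
  have hT1 : Nat.card {t : F | t ≠ 0 ∧ SkaP q q₀ (t ^ m)} = (q ^ 2 + 1) * (q - 1) := by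
    rw [← hmu]
    apply ska_fib_count _ _ (fun t => t ^ (q ^ 2 - 1))
    · rintro t ⟨ht, -⟩
      simp only [Set.mem_ofPred_eq]
      rw [← pow_mul, hsub, ← hF]; exact FiniteField.pow_card_sub_one_eq_one t ht
    · intro z hz
      obtain ⟨t, ht0, htP, htz⟩ := hexist z hz
      have hz0 : z ≠ 0 := by rw [← htz]; exact pow_ne_zero _ ht0
      rw [← hK]
      refine Nat.card_congr ⟨fun w => ⟨w.1 / t, ?_⟩, fun a => ⟨a.1 * t, ?_⟩, ?_, ?_⟩
      · obtain ⟨w, ⟨hw0, hwP⟩, hw⟩ := w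
        have : w / t ≠ 0 := div_ne_zero hw0 ht0
        refine ⟨this, huniq t _ ht0 this htP ?_ ?_⟩
        · rwa [div_mul_cancel₀ _ ht0]
        · rw [div_pow, hw, htz, div_self hz0]
      · obtain ⟨a, ha0, ha⟩ := a
        refine ⟨⟨mul_ne_zero ha0 ht0, ?_⟩, ?_⟩
        · rw [mul_pow]
          refine ska_scale _ _ _ _ ?_ htP
          change (a ^ m) ^ q = a ^ m
          rw [← pow_mul, mul_comm, pow_mul, ha]
        · have h1 : a ^ (q - 1) = 1 := by
            have : a ^ (q - 1) * a = 1 * a := by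
              rw [← pow_succ, one_mul, show q - 1 + 1 = q by omega, ha]
            exact mul_right_cancel₀ ha0 this
          simp only
          rw [mul_pow, htz, ← hq21, pow_mul, h1, one_pow, one_mul]
      · intro w; apply Subtype.ext; exact div_mul_cancel₀ _ ht0
      · intro a; apply Subtype.ext; exact mul_div_cancel_right₀ _ ht0
  have hT : Nat.card {t : F | SkaP q q₀ (t ^ m)} = (q ^ 2 + 1) * (q - 1) + 1 := by
    have e : {t : F | SkaP q q₀ (t ^ m)} = insert 0 {t : F | t ≠ 0 ∧ SkaP q q₀ (t ^ m)} := by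
      ext t
      simp only [Set.mem_ofPred_eq, Set.mem_insert_iff]
      have : SkaP q q₀ ((0 : F) ^ m) :=
        ⟨0, 0, by simp [show q ≠ 0 by omega], by simp [show q ≠ 0 by omega, hm0]⟩
      by_cases h : t = 0
      · subst h; simpa using this
      · simp [h]
    rw [e, Nat.card_coe_set_eq, Set.ncard_insert_of_notMem (by simp), ← Nat.card_coe_set_eq, hT1]
  have hfin : ((q ^ 2 + 1) * (q - 1) + 1) * q ^ 2 = q ^ 5 - q ^ 4 + q ^ 3 := by
    obtain ⟨k, rfl⟩ := Nat.exists_eq_add_of_lt hq1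
    have : (1 + k + 1) ^ 5 = (1 + k + 1) ^ 4 * (1 + k) + (1 + k + 1) ^ 4 := by ring
    rw [this, Nat.add_sub_cancel, Nat.add_sub_cancel]
    ring
  rw [← hfin, ← hT]
  apply ska_fib_count _ _ (fun p : F × F × F => p.2.2)
  · rintro ⟨x, y, t⟩ ⟨h1, h2⟩
    exact ⟨x, y, h1, h2⟩
  · intro t ht
    rw [← ska_fibre q q₀ hadd hadd0 hker _ ht]
    refine Nat.card_congr ⟨fun p => ⟨(p.1.1, p.1.2.1), ?_⟩, fun p => ⟨(p.1.1, p.1.2, t), ?_⟩, ?_, ?_⟩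
    · obtain ⟨⟨x, y, t'⟩, ⟨h1, h2⟩, h3⟩ := p
      simp only at h3; subst h3
      exact ⟨h1, h2⟩
    · exact ⟨p.2, rfl⟩
    · rintro ⟨⟨x, y, t'⟩, ⟨h1, h2⟩, h3⟩
      simp only at h3; subst h3; rfl
    · rintro ⟨⟨x, y⟩, h⟩; rfl
end

section
/- Let s ≥ 1, q₀ = 2^s, q = 2q₀², m = q − 2q₀ + 1, let F be a finite field with q⁴ elements, and let S = {(x, y, t) ∈ F³ : y^q + y = x^{q₀}(x^q + x) and t^m = x^q + x}. Then for every α ∈ F the number of elements of S whose last coordinate equals α is either 0 or q², and the number of α ∈ F for which this number equals q² is exactly q³ − q² + q. -/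
namespace Skab
open Finset
set_option linter.unusedSectionVars false

section
variable {F : Type*} [Field F] [Fintype F] [DecidableEq F]

lemma card_roots (d e : ℕ) (hde : d * e = Fintype.card F - 1) (c : F) (hc : c ^ e = 1) (he : e ≠ 0) (hd : d ≠ 0) :
    #{α : F | α ^ d = c} = d := by
  classical
  have hc0 : c ≠ 0 := by rintro rfl; rw [zero_pow he] at hc; exact zero_ne_one hc
  have hcard : Nat.card Fˣ = d * e := by rw [Nat.card_eq_fintype_card, Fintype.card_units, hde]
  have hk : ∀ a b : ℕ, a * b = d * e → a ≠ 0 → Nat.card (powMonoidHom a : Fˣ →* Fˣ).ker = a := by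
    intro a b hab ha
    rw [IsCyclic.card_powMonoidHom_ker, hcard, ← hab]; simp
  have hr : Nat.card (powMonoidHom d : Fˣ →* Fˣ).range = e := by
    rw [IsCyclic.card_powMonoidHom_range, hcard]; simp
    exact Nat.mul_div_cancel_left _ (Nat.pos_of_ne_zero hd)
  have hle : (powMonoidHom d : Fˣ →* Fˣ).range ≤ (powMonoidHom e : Fˣ →* Fˣ).ker := by
    rintro _ ⟨x, rfl⟩
    rw [MonoidHom.mem_ker]
    simp only [powMonoidHom_apply]
    rw [← pow_mul, ← hcard, pow_card_eq_one']
  have heq : (powMonoidHom d : Fˣ →* Fˣ).range = (powMonoidHom e : Fˣ →* Fˣ).ker := by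
    apply Subgroup.eq_of_le_of_card_ge hle
    rw [hr, hk e d (mul_comm _ _) he]
  have hmem : Units.mk0 c hc0 ∈ (powMonoidHom d : Fˣ →* Fˣ).range := by
    rw [heq, MonoidHom.mem_ker]; ext; simpa using hc
  have h1 := MonoidHom.card_fiber_eq_of_mem_range (powMonoidHom d : Fˣ →* Fˣ) hmem ⟨1, map_one _⟩
  have h2 : #{x : Fˣ | (powMonoidHom d : Fˣ →* Fˣ) x = 1} = d := by
    refine Eq.trans ?_ (hk d e rfl hd)
    rw [← Fintype.card_subtype, ← Nat.card_eq_fintype_card]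
    rfl
  rw [h2] at h1
  conv_rhs => rw [← h1]
  symm
  apply Finset.card_bij (fun (u : Fˣ) _ => (u : F))
  · intro u hu
    simp only [mem_filter, mem_univ, true_and, powMonoidHom_apply] at hu ⊢
    have := congrArg (Units.val) hu
    simpa using this
  · intro a _ b _ h; exact Units.ext h
  · intro b hb
    simp only [mem_filter, mem_univ, true_and] at hb
    have hb0 : b ≠ 0 := by rintro rfl; rw [zero_pow hd] at hb; exact hc0 hb.symm
    refine ⟨Units.mk0 b hb0, ?_, rfl⟩
    simp only [mem_filter, mem_univ, true_and, powMonoidHom_apply]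
    ext; simpa using hb

lemma card_fix (N n k : ℕ) (hF : Fintype.card F = 2 ^ N) (hN : N = n * k) (hn : n ≠ 0) (hk : k ≠ 0) :
    #{x : F | x ^ 2 ^ n = x} = 2 ^ n := by
  have h2 : 2 ≤ 2 ^ n := by
    calc 2 = 2 ^ 1 := rfl
      _ ≤ 2 ^ n := Nat.pow_le_pow_right (by norm_num) (by omega)
  obtain ⟨e, he⟩ : (2 ^ n - 1) ∣ (Fintype.card F - 1) := by
    rw [hF, hN, pow_mul]; simpa using Nat.sub_dvd_pow_sub_pow (2 ^ n) 1 k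
  have hFpos : 1 < Fintype.card F := Fintype.one_lt_card
  have he0 : e ≠ 0 := by rintro rfl; omega
  have := card_roots (F := F) (2 ^ n - 1) e he.symm 1 (one_pow _) he0 (by omega)
  have hs : ({x : F | x ^ 2 ^ n = x} : Finset F) = insert 0 ({x : F | x ^ (2 ^ n - 1) = 1} : Finset F) := by
    ext x
    simp only [mem_filter, mem_univ, true_and, mem_insert]
    obtain ⟨j, hj⟩ : ∃ j, 2 ^ n = j + 1 := ⟨2 ^ n - 1, by omega⟩
    rw [hj, Nat.add_sub_cancel, pow_succ]
    by_cases hx : x = 0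
    · simp [hx]
    · simp [hx]
  rw [hs, card_insert_of_notMem, this]
  · omega
  · simp only [mem_filter, mem_univ, true_and]
    rw [zero_pow (by omega)]; exact zero_ne_one

variable [CharP F 2]

lemma frob_add (n : ℕ) (x y : F) : (x + y) ^ 2 ^ n = x ^ 2 ^ n + y ^ 2 ^ n := by
  have : ExpChar F 2 := ExpChar.prime Nat.prime_two
  exact add_pow_expChar_pow x y 2 n

lemma frob_sum {ι : Type*} (n : ℕ) (t : Finset ι) (f : ι → F) : (∑ i ∈ t, f i) ^ 2 ^ n = ∑ i ∈ t, (f i) ^ 2 ^ n := by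
  have : ExpChar F 2 := ExpChar.prime Nat.prime_two
  exact sum_pow_char_pow 2 n t f

lemma tele (n k : ℕ) (x : F) : ∑ i ∈ range k, (x ^ 2 ^ n + x) ^ 2 ^ (n * i) = x ^ 2 ^ (n * k) + x := by
  induction k with
  | zero => simp [CharTwo.add_self_eq_zero]
  | succ k ih =>
    rw [sum_range_succ, ih, frob_add, ← pow_mul, ← pow_add, show n + n * k = n * (k+1) by ring]
    linear_combination (x ^ 2 ^ (n * k)) * (CharTwo.two_eq_zero (R := F))

lemma card_trace_le (n k : ℕ) (hn : n ≠ 0) (hk : k ≠ 0) :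
    #{c : F | ∑ i ∈ range k, c ^ 2 ^ (n * i) = 0} ≤ 2 ^ (n * (k - 1)) := by
  obtain ⟨k, rfl⟩ := Nat.exists_eq_succ_of_ne_zero hk
  rw [Nat.succ_sub_one]
  let P : Polynomial F := ∑ i ∈ range (k+1), Polynomial.X ^ 2 ^ (n * i)
  have hdeg : P.degree = ((2 ^ (n * k) : ℕ) : WithBot ℕ) := by
    simp only [P]
    rw [sum_range_succ, add_comm, Polynomial.degree_add_eq_left_of_degree_lt]
    · exact Polynomial.degree_X_pow _
    · rw [Polynomial.degree_X_pow]
      refine lt_of_le_of_lt (Polynomial.degree_sum_le _ _) ?_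
      rw [Finset.sup_lt_iff (WithBot.bot_lt_coe _)]
      intro i hi
      rw [Polynomial.degree_X_pow]
      rw [mem_range] at hi
      norm_cast
      apply Nat.pow_lt_pow_right (by norm_num)
      exact Nat.mul_lt_mul_of_pos_left hi (by omega)
  have hP : P ≠ 0 := by
    rintro h; rw [h, Polynomial.degree_zero] at hdeg; exact absurd hdeg WithBot.bot_ne_coe
  have : ({c : F | ∑ i ∈ range (k+1), c ^ 2 ^ (n * i) = 0} : Finset F) ⊆ P.roots.toFinset := by
    intro c hc
    simp only [mem_filter, mem_univ, true_and] at hc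
    rw [Multiset.mem_toFinset, Polynomial.mem_roots hP, Polynomial.IsRoot]
    simpa [P, Polynomial.eval_finsetSum] using hc
  refine (card_le_card this).trans ((Multiset.toFinset_card_le _).trans ((Polynomial.card_roots' P).trans ?_))
  rw [Polynomial.natDegree_eq_of_degree_eq_some hdeg]

lemma card_as (N n k : ℕ) (hF : Fintype.card F = 2 ^ N) (hN : N = n * k) (hn : n ≠ 0) (hk : k ≠ 0)
    (c : F) (hc : ∑ i ∈ range k, c ^ 2 ^ (n * i) = 0) :
    #{x : F | x ^ 2 ^ n + x = c} = 2 ^ n := by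
  let φ : F →+ F := AddMonoidHom.mk' (fun x => x ^ 2 ^ n + x) (by
    intro a b; simp only [frob_add]; ring)
  have hφ : ∀ x, φ x = x ^ 2 ^ n + x := fun _ => rfl
  have hker : #{x : F | φ x = 0} = 2 ^ n := by
    rw [← card_fix N n k hF hN hn hk]
    congr 1; ext x; simp only [mem_filter, mem_univ, true_and, hφ, CharTwo.add_eq_zero]
  have himg : (univ.image φ) = ({c : F | ∑ i ∈ range k, c ^ 2 ^ (n * i) = 0} : Finset F) := by
    apply Finset.eq_of_subset_of_card_le
    · intro y hy
      rw [mem_image] at hy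
      obtain ⟨x, -, rfl⟩ := hy
      simp only [mem_filter, mem_univ, true_and, hφ]
      rw [tele, ← hN, ← hF, FiniteField.pow_card, CharTwo.add_self_eq_zero]
    · refine (card_trace_le n k hn hk).trans ?_
      have h := Finset.card_eq_sum_card_image φ (univ : Finset F)
      rw [Finset.sum_const_nat (m := 2 ^ n), card_univ, hF, hN] at h
      · have : 2 ^ (n * (k-1)) * 2 ^ n = 2 ^ (n * k) := by
          rw [← pow_add]; congr 1; obtain ⟨k, rfl⟩ := Nat.exists_eq_succ_of_ne_zero hk; simp; ring
        have h3 : 0 < 2 ^ n := by positivity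
        apply le_of_eq
        apply Nat.eq_of_mul_eq_mul_right h3
        rw [this, h]
      · intro y hy
        rw [mem_image] at hy
        obtain ⟨x, -, rfl⟩ := hy
        rw [← hker]
        exact AddMonoidHom.card_fiber_eq_of_mem_range φ ⟨x, rfl⟩ ⟨0, map_zero _⟩
  have hcm : c ∈ univ.image φ := by rw [himg]; simpa using hc
  rw [mem_image] at hcm
  obtain ⟨x, -, rfl⟩ := hcm
  have := AddMonoidHom.card_fiber_eq_of_mem_range φ ⟨x, rfl⟩ ⟨0, map_zero _⟩
  rw [hker] at this
  exact this
end
section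
variable {F : Type*} [Field F] [Fintype F] [DecidableEq F] [CharP F 2]

def tr (n : ℕ) (z : F) : F := ∑ i ∈ range n, z ^ 2 ^ i

lemma tr_add (n : ℕ) (x y : F) : tr n (x + y) = tr n x + tr n y := by
  simp only [tr, frob_add, sum_add_distrib]

lemma tr_sq (n : ℕ) (x : F) (hx : x ^ 2 ^ n = x) : tr n (x ^ 2) = tr n x := by
  simp only [tr]
  rw [← add_left_inj (x ^ 2 ^ 0)]
  have : ∀ i, (x ^ 2) ^ 2 ^ i = x ^ 2 ^ (i + 1) := by intro i; rw [← pow_mul, pow_succ']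
  simp only [this]
  rw [← sum_range_succ' (fun i => x ^ 2 ^ i) n, sum_range_succ, hx]; simp

lemma fix_frob (n j : ℕ) (x : F) (hx : x ^ 2 ^ n = x) : (x ^ 2 ^ j) ^ 2 ^ n = x ^ 2 ^ j := by
  rw [← pow_mul, mul_comm, pow_mul, hx]

lemma tr_frob (n : ℕ) (x : F) (hx : x ^ 2 ^ n = x) (j : ℕ) : tr n (x ^ 2 ^ j) = tr n x := by
  induction j with
  | zero => simp
  | succ j ih => rw [pow_succ, pow_mul, tr_sq n _ (fix_frob n j x hx), ih]

lemma tr_01 (n : ℕ) (x : F) (hx : x ^ 2 ^ n = x) : tr n x = 0 ∨ tr n x = 1 := by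
  have h := tr_sq n x hx
  have h2 : tr n (x ^ 2) = (tr n x) ^ 2 := by
    have := frob_sum 1 (range n) (fun i => x ^ 2 ^ i)
    simp only [pow_one] at this
    simp only [tr]; rw [this]; apply sum_congr rfl; intro i _; rw [← pow_mul, ← pow_mul, mul_comm]
  rw [h2] at h
  have : tr n x * (tr n x - 1) = 0 := by linear_combination h
  rcases mul_eq_zero.mp this with h | h
  · exact Or.inl h
  · exact Or.inr (by linear_combination h)

def chi (z : F) : ℤ := if z = 0 then 1 else -1

lemma chi_add (a b : F) (ha : a = 0 ∨ a = 1) (hb : b = 0 ∨ b = 1) : chi (a + b) = chi a * chi b := by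
  rcases ha with rfl | rfl <;> rcases hb with rfl | rfl <;> simp [chi, CharTwo.add_self_eq_zero]

lemma fix_add (n : ℕ) (x y : F) (hx : x ^ 2 ^ n = x) (hy : y ^ 2 ^ n = y) : (x + y) ^ 2 ^ n = x + y := by
  rw [frob_add, hx, hy]

lemma fix_mul (n : ℕ) (x y : F) (hx : x ^ 2 ^ n = x) (hy : y ^ 2 ^ n = y) : (x * y) ^ 2 ^ n = x * y := by
  rw [mul_pow, hx, hy]

def A (F : Type*) [Field F] [Fintype F] [DecidableEq F] (n : ℕ) : Finset F := {x : F | x ^ 2 ^ n = x}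

lemma mem_A (n : ℕ) (x : F) : x ∈ A F n ↔ x ^ 2 ^ n = x := by simp [A]

lemma sum_shift (n : ℕ) (a : F) (ha : a ∈ A F n) (f : F → ℤ) : ∑ x ∈ A F n, f (a + x) = ∑ x ∈ A F n, f x := by
  have hm : ∀ x ∈ A F n, a + x ∈ A F n := by
    intro x hx; rw [mem_A] at *; exact fix_add n a x ha hx
  refine sum_bij' (fun x _ => a + x) (fun x _ => a + x) hm hm ?_ ?_ ?_
  · intro x _; rw [← add_assoc, CharTwo.add_self_eq_zero, zero_add]
  · intro x _; rw [← add_assoc, CharTwo.add_self_eq_zero, zero_add]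
  · intro x _; rfl

lemma sum_char (N n k : ℕ) (hF : Fintype.card F = 2 ^ N) (hN : N = n * k) (hn : n ≠ 0) (hk : k ≠ 0)
    (c : F) (hc : c ∈ A F n) :
    ∑ x ∈ A F n, chi (tr n (x * c)) = if c = 0 then (2 : ℤ) ^ n else 0 := by
  split_ifs with h0
  · subst h0
    simp only [mul_zero]
    have h1 : tr n (0 : F) = 0 := by simp [tr]
    rw [h1]
    simp only [chi, if_true, sum_const, nsmul_eq_mul, mul_one]
    rw [A, card_fix N n k hF hN hn hk]; simp
  · obtain ⟨z, hz, hz1⟩ : ∃ z ∈ A F n, tr n z ≠ 0 := by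
      by_contra! hcon
      have hsub : A F n ⊆ ({c : F | ∑ i ∈ range n, c ^ 2 ^ (1 * i) = 0} : Finset F) := by
        intro z hz; have := hcon z hz; simpa [tr] using this
      have h2 := (card_le_card hsub).trans (card_trace_le 1 n one_ne_zero hn)
      rw [A, card_fix N n k hF hN hn hk] at h2
      have : 2 ^ (1 * (n - 1)) < 2 ^ n := Nat.pow_lt_pow_right (by norm_num) (by omega)
      omega
    rw [mem_A] at hz hc
    have hz1 : tr n z = 1 := (tr_01 n z hz).resolve_left hz1
    have hx0 : (z / c) ∈ A F n := by rw [mem_A, div_pow, hz, hc]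
    have hs := sum_shift n (z / c) hx0 (fun x => chi (tr n (x * c)))
    have : ∑ x ∈ A F n, chi (tr n ((z / c + x) * c)) = ∑ x ∈ A F n, - chi (tr n (x * c)) := by
      apply sum_congr rfl
      intro x hx
      rw [mem_A] at hx
      rw [add_mul, div_mul_cancel₀ _ h0, tr_add, chi_add _ _ (tr_01 n z hz) (tr_01 n _ (fix_mul n x c hx hc)), hz1]
      simp only [chi]; split_ifs <;> simp_all
    rw [this, sum_neg_distrib] at hs
    omega

def E (s : ℕ) (x : F) : F := tr (2 * s + 1) (x ^ 2 ^ s * x + x)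

def G (F : Type*) [Field F] [Fintype F] [DecidableEq F] (s : ℕ) : ℤ := ∑ x ∈ A F (2 * s + 1), chi (E s x)

lemma fix_E (s : ℕ) (x : F) (hx : x ^ 2 ^ (2 * s + 1) = x) :
    (x ^ 2 ^ s * x + x) ^ 2 ^ (2 * s + 1) = x ^ 2 ^ s * x + x :=
  fix_add _ _ _ (fix_mul _ _ _ (fix_frob _ _ _ hx) hx) hx

lemma E_01 (s : ℕ) (x : F) (hx : x ^ 2 ^ (2 * s + 1) = x) : E s x = 0 ∨ E s x = 1 :=
  tr_01 _ _ (fix_E s x hx)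

lemma E_add (s : ℕ) (x h : F) (hx : x ^ 2 ^ (2 * s + 1) = x) (hh : h ^ 2 ^ (2 * s + 1) = h) :
    E s (x + h) = E s x + (E s h + tr (2 * s + 1) (x * (h ^ 2 ^ s + h ^ 2 ^ (s + 1)))) := by
  have h1 : tr (2 * s + 1) (x ^ 2 ^ s * h) = tr (2 * s + 1) (x * h ^ 2 ^ (s + 1)) := by
    rw [← tr_frob _ _ (fix_mul _ _ _ (fix_frob _ s _ hx) hh) (s + 1), mul_pow, ← pow_mul, ← pow_add,
      show s + (s + 1) = 2 * s + 1 by ring, hx]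
  simp only [E]
  rw [mul_add x, tr_add (2*s+1) (x * h ^ 2 ^ s), ← h1, frob_add, ← tr_add, ← tr_add, ← tr_add]
  congr 1; ring

lemma G_sq (N s k : ℕ) (hF : Fintype.card F = 2 ^ N) (hN : N = (2 * s + 1) * k) (hk : k ≠ 0) :
    (G F s) ^ 2 = 2 ^ (2 * s + 2) := by
  set n := 2 * s + 1 with hn
  have hn0 : n ≠ 0 := by omega
  calc (G F s) ^ 2 = ∑ x ∈ A F n, ∑ h ∈ A F n, chi (E s x) * chi (E s (x + h)) := by
        rw [sq, G, sum_mul]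
        apply sum_congr rfl
        intro x hx
        rw [mul_sum, sum_shift n x hx (fun y => chi (E s x) * chi (E s y))]
    _ = ∑ x ∈ A F n, ∑ h ∈ A F n, chi (E s h) * chi (tr n (x * (h ^ 2 ^ s + h ^ 2 ^ (s + 1)))) := by
        apply sum_congr rfl; intro x hx; apply sum_congr rfl; intro h hh
        rw [mem_A] at hx hh
        have h3 := tr_01 n _ (fix_mul n _ _ hx (fix_add _ _ _ (fix_frob n s h hh) (fix_frob n (s+1) h hh)))
        rw [E_add s x h hx hh, ← hn]
        have e1 := E_01 s x hx
        have e2 := E_01 s h hh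
        generalize E s x = a at *
        generalize E s h = b at *
        generalize tr n (x * (h ^ 2 ^ s + h ^ 2 ^ (s + 1))) = c at *
        rcases e1 with rfl | rfl <;> rcases e2 with rfl | rfl <;> rcases h3 with rfl | rfl <;> simp [chi, CharTwo.add_self_eq_zero]
    _ = ∑ h ∈ A F n, chi (E s h) * (if h ^ 2 ^ s + h ^ 2 ^ (s + 1) = 0 then (2:ℤ) ^ n else 0) := by
        rw [sum_comm]
        apply sum_congr rfl; intro h hh
        rw [← mul_sum, sum_char N n k hF hN hn0 hk]
        rw [mem_A] at *
        exact fix_add _ _ _ (fix_frob n s h hh) (fix_frob n (s+1) h hh)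
    _ = ∑ h ∈ ({0, 1} : Finset F), chi (E s h) * (if h ^ 2 ^ s + h ^ 2 ^ (s + 1) = 0 then (2:ℤ) ^ n else 0) := by
        symm
        apply sum_subset
        · intro h hh
          rw [mem_A]
          simp only [mem_insert, mem_singleton] at hh
          rcases hh with rfl | rfl
          · exact zero_pow (by positivity)
          · exact one_pow _
        · intro h _ hh
          rw [if_neg, mul_zero]
          intro h0
          apply hh
          rw [pow_succ', pow_mul, ← frob_add] at h0
          have : h * (h + 1) = 0 := by
            have := pow_eq_zero_iff (by positivity) |>.mp h0
            linear_combination this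
          simp only [mem_insert, mem_singleton]
          rcases mul_eq_zero.mp this with h | h
          · exact Or.inl h
          · exact Or.inr (CharTwo.add_eq_zero.mp h)
    _ = 2 ^ (2 * s + 2) := by
        rw [sum_pair zero_ne_one]
        simp [E, tr, chi, CharTwo.add_self_eq_zero]
        rw [hn]; ring

lemma G_count (N s k : ℕ) (hF : Fintype.card F = 2 ^ N) (hN : N = (2 * s + 1) * k) (hk : k ≠ 0) :
    G F s = 2 * (#{x ∈ A F (2 * s + 1) | E s x = 0} : ℤ) - 2 ^ (2 * s + 1) := by
  have h1 : ∀ x : F, chi (E s x) = 2 * (if E s x = 0 then 1 else 0) - 1 := by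
    intro x; simp only [chi]; split_ifs <;> norm_num
  simp only [G, h1]
  rw [sum_sub_distrib, ← mul_sum, sum_boole]
  simp only [sum_const, nsmul_eq_mul, mul_one]
  congr 1
  rw [A, card_fix N (2 * s + 1) k hF hN (by omega) hk]; simp

lemma count_mod (s t p : ℕ) (hp : p.Prime) (hst : 2 * s + 1 = p * (2 * t + 1)) (hp2 : Odd p) :
    #{x ∈ A F (2 * s + 1) | E s x = 0} ≡ #{x ∈ A F (2 * t + 1) | E t x = 0} [MOD p] := by
  have : Fact p.Prime := ⟨hp⟩
  set k := 2 * t + 1 with hk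
  have hE : ∀ x : F, x ^ 2 ^ (2 * s + 1) = x → E s (x ^ 2 ^ k) = E s x := by
    intro x hx
    simp only [E]
    rw [← tr_frob _ _ (fix_E s x hx) k, frob_add, mul_pow]
    congr 3
    rw [← pow_mul, ← pow_mul, mul_comm]
  let f : Function.End {x : F // x ∈ ({x ∈ A F (2 * s + 1) | E s x = 0} : Finset F)} := fun x => ⟨x.1 ^ 2 ^ k, by
    have := x.2
    rw [mem_filter, mem_A] at this ⊢
    exact ⟨fix_frob _ _ _ this.1, by rw [hE _ this.1]; exact this.2⟩⟩
  have hfi : ∀ i x, ((f ^ i) x).1 = x.1 ^ 2 ^ (k * i) := by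
    intro i
    induction i with
    | zero => intro x; simp; rfl
    | succ i ih =>
      intro x
      rw [pow_succ]
      change ((f ^ i) (f x)).1 = _
      rw [ih]
      change (x.1 ^ 2 ^ k) ^ 2 ^ (k * i) = _
      rw [← pow_mul, ← pow_add]; congr 2; ring
  have hf : f ^ p ^ 1 = 1 := by
    funext x
    apply Subtype.ext
    rw [hfi, pow_one, mul_comm k p, ← hst]
    have := x.2
    rw [mem_filter, mem_A] at this
    exact this.1
  have key := Equiv.Perm.card_fixedPoints_modEq hf
  rw [Fintype.card_coe] at key
  refine key.trans ?_
  have hEE : ∀ x : F, x ^ 2 ^ k = x → E s x = E t x := by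
    intro x hx
    obtain ⟨u, hu⟩ := hp2
    have hs : s = k * u + t := by
      subst hu; nlinarith
    have hfixm : ∀ (y : F) (j : ℕ), y ^ 2 ^ k = y → y ^ 2 ^ (k * j) = y := by
      intro y j hy
      induction j with
      | zero => simp
      | succ j ih => rw [mul_add, mul_one, pow_add, pow_mul, ih, hy]
    have hxs : x ^ 2 ^ s = x ^ 2 ^ t := by
      rw [hs, pow_add, pow_mul, hfixm x u hx]
    simp only [E]
    rw [hxs, ← hk, hst]
    have hz := fix_E t x hx
    rw [← hk] at hz
    generalize x ^ 2 ^ t * x + x = z at hz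
    have : ∀ j, tr (j * k) z = j * tr k z := by
      intro j
      induction j with
      | zero => simp [tr]
      | succ j ih =>
        have : tr ((j+1) * k) z = tr (j * k) z + tr k z := by
          simp only [tr]
          rw [add_mul, one_mul, sum_range_add]
          congr 1
          apply sum_congr rfl; intro i _
          rw [pow_add, pow_mul, mul_comm j k, hfixm z j hz]
        rw [this, ih]; push_cast; ring
    rw [this, hu]
    push_cast
    rw [CharTwo.two_eq_zero]; ring
  have : Fintype.card f.fixedPoints = #{x ∈ A F k | E t x = 0} := by
    rw [← Fintype.card_coe]
    refine Fintype.card_congr ⟨fun x => ⟨x.1.1, ?_⟩, fun x => ⟨⟨x.1, ?_⟩, ?_⟩, ?_, ?_⟩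
    · have h1 := x.2
      have h2 := x.1.2
      rw [Function.mem_fixedPoints, Function.IsFixedPt] at h1
      have h1 := congrArg Subtype.val h1
      simp only [f] at h1
      rw [mem_filter] at h2 ⊢
      rw [mem_A]
      exact ⟨h1, by rw [← hEE _ h1]; exact h2.2⟩
    · have h := x.2
      rw [mem_filter, mem_A] at h ⊢
      refine ⟨?_, by rw [hEE _ h.1]; exact h.2⟩
      rw [hst, mul_comm]
      have hfixm : ∀ (y : F) (j : ℕ), y ^ 2 ^ k = y → y ^ 2 ^ (k * j) = y := by
        intro y j hy
        induction j with
        | zero => simp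
        | succ j ih => rw [mul_add, mul_one, pow_add, pow_mul, ih, hy]
      exact hfixm _ _ h.1
    · have h := x.2
      rw [mem_filter, mem_A] at h
      rw [Function.mem_fixedPoints, Function.IsFixedPt]
      apply Subtype.ext
      exact h.1
    · intro x; rfl
    · intro x; rfl
  rw [this]

end
section
variable {F : Type*} [Field F] [Fintype F] [DecidableEq F] [CharP F 2]

lemma G_val (N : ℕ) (hF : Fintype.card F = 2 ^ N) (hN0 : N ≠ 0) (s : ℕ) (hN : (2 * s + 1) ∣ N) :
    G F s = jacobiSym 2 (2 * s + 1) * 2 ^ (s + 1) := by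
  induction s using Nat.strong_induction_on with
  | _ s ih =>
  obtain ⟨j, hj⟩ := hN
  have hj0 : j ≠ 0 := by rintro rfl; simp at hj; exact hN0 hj
  rcases Nat.eq_zero_or_pos s with rfl | hs
  · have h1 : ∀ x ∈ A F (2 * 0 + 1), chi (E 0 x) = 1 := by
      intro x hx
      rw [mem_A] at hx
      simp only [mul_zero, zero_add, pow_one] at hx
      simp [E, tr, chi]
      linear_combination hx + x * CharTwo.two_eq_zero (R := F)
    rw [G, sum_congr rfl h1]
    simp only [sum_const, nsmul_eq_mul, mul_one]
    rw [A, card_fix N _ j hF hj (by norm_num) hj0]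
    simp
  · have hn1 : 2 * s + 1 ≠ 1 := by omega
    set p := (2 * s + 1).minFac with hpdef
    have hp : p.Prime := Nat.minFac_prime hn1
    have hpf : Fact p.Prime := ⟨hp⟩
    obtain ⟨k, hk⟩ : p ∣ 2 * s + 1 := Nat.minFac_dvd _
    have hodd : Odd (p * k) := ⟨s, hk.symm⟩
    rw [Nat.odd_mul] at hodd
    obtain ⟨hpo, t, rfl⟩ := hodd
    have hp2 := hp.two_le
    have hp3 : p ≠ 2 := by rintro h; rw [h] at hpo; revert hpo; decide
    have hts : t < s := by nlinarith
    have iht := ih t hts (Dvd.dvd.trans ⟨p, by rw [hk]; ring⟩ ⟨j, hj⟩)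
    have hjt : N = (2 * t + 1) * (p * j) := by rw [hj, hk]; ring
    have hc1 := G_count N s j hF hj hj0
    have hc2 := G_count N t (p * j) hF hjt (mul_ne_zero hp.ne_zero hj0)
    have hm := count_mod (F := F) s t p hp hk hpo
    rw [← ZMod.natCast_eq_natCast_iff] at hm
    have hG : ((G F s : ℤ) : ZMod p) = ((G F t : ℤ) : ZMod p) := by
      rw [hc1, hc2]; push_cast
      rw [hm, hk, pow_mul, ZMod.pow_card]
    have hsq := G_sq N s j hF hj hj0
    obtain ⟨ε, hε, hGε⟩ : ∃ ε : ℤ, (ε = 1 ∨ ε = -1) ∧ G F s = ε * 2 ^ (s + 1) := by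
      have : (G F s) ^ 2 = (2 ^ (s + 1)) ^ 2 := by rw [hsq]; ring
      rcases sq_eq_sq_iff_eq_or_eq_neg.mp this with h | h
      · exact ⟨1, Or.inl rfl, by rw [h]; ring⟩
      · exact ⟨-1, Or.inr rfl, by rw [h]; ring⟩
    obtain ⟨u, hu⟩ := hpo
    have hsu : s + 1 = u * (2 * t + 1) + (t + 1) := by
      rw [hu] at hk; nlinarith
    have hleg : ((jacobiSym 2 p : ℤ) : ZMod p) = 2 ^ u := by
      rw [← jacobiSym.legendreSym.to_jacobiSym, legendreSym.eq_pow]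
      have : p / 2 = u := by omega
      rw [this]; push_cast; rfl
    have h2 : (2 : ZMod p) ≠ 0 := by
      intro h
      have : ((2 : ℕ) : ZMod p) = 0 := by exact_mod_cast h
      rw [ZMod.natCast_eq_zero_iff] at this
      exact hp3 ((Nat.prime_dvd_prime_iff_eq hp Nat.prime_two).mp this)
    have hjp : jacobiSym 2 p = 1 ∨ jacobiSym 2 p = -1 := by
      apply jacobiSym.eq_one_or_neg_one
      have : Nat.Coprime 2 p := (Nat.coprime_primes Nat.prime_two hp).mpr (Ne.symm hp3)
      simpa [Int.gcd] using this
    have hjk : jacobiSym 2 (2 * t + 1) = 1 ∨ jacobiSym 2 (2 * t + 1) = -1 := by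
      apply jacobiSym.eq_one_or_neg_one
      have : Nat.Coprime 2 (2 * t + 1) := by simp
      simp [Int.gcd]
    have hmul : jacobiSym 2 (2 * s + 1) = jacobiSym 2 p * jacobiSym 2 (2 * t + 1) := by
      rw [hk]
      have : NeZero p := ⟨hp.ne_zero⟩
      exact jacobiSym.mul_right 2 p (2 * t + 1)
    rw [hGε, iht] at hG
    push_cast at hG
    rw [hsu, pow_add _ (u * _), pow_mul, ← hleg, ← mul_assoc] at hG
    have hG2 := mul_right_cancel₀ (pow_ne_zero _ h2) hG
    rw [hGε, hmul]
    congr 1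
    have hne : (1 : ZMod p) ≠ -1 := by
      intro h; apply h2; linear_combination h
    rcases hε with rfl | rfl <;> rcases hjp with h | h <;> rcases hjk with h' | h' <;>
      rw [h, h'] at hG2 ⊢ <;> simp [Odd.neg_one_pow (⟨t, rfl⟩ : Odd (2 * t + 1))] at hG2 ⊢
    all_goals first | exact hne hG2 | exact hne hG2.symm

lemma kappa (s : ℕ) : ((∑ i ∈ range s, (s + i) : ℕ) : F) = if jacobiSym 2 (2 * s + 1) = 1 then 0 else 1 := by
  rw [jacobiSym.at_two ⟨s, rfl⟩, ZMod.χ₈_nat_eq_if_mod_eight]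
  have h := Finset.sum_range_id_mul_two s
  have h1 : ∑ i ∈ range s, (s + i) = s * s + ∑ i ∈ range s, i := by
    rw [sum_add_distrib]; simp
  have hpar : ∀ n : ℕ, (n : F) = if n % 2 = 0 then 0 else 1 := by
    intro n
    rcases Nat.even_or_odd' n with ⟨k, rfl | rfl⟩
    · simp [CharTwo.two_eq_zero]
    · have : (2 * k + 1) % 2 = 1 := by omega
      simp [CharTwo.two_eq_zero, this]
  rw [hpar, h1]
  generalize ∑ i ∈ range s, i = v at *
  have h3 : 2 * v + s = s * s := by
    rcases s with _ | s
    · simp at h; omega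
    · simp at h; nlinarith
  obtain ⟨a, b, hb, rfl⟩ : ∃ a b, b < 4 ∧ s = 4 * a + b := ⟨s / 4, s % 4, Nat.mod_lt _ (by norm_num), by omega⟩
  have h4 : v = 8 * (a * a) + 4 * a * b - 2 * a + (b * b - b) / 2 ∧ 2 * a ≤ 8 * (a * a) + 4 * a * b:= by
    have : a ≤ a * a := by nlinarith
    interval_cases b <;> constructor <;> ring_nf at h3 ⊢ <;> ring_nf at this <;> omega
  have h5 : ((4 * a + b) * (4 * a + b) + v) % 2 = (b * b + (b * b - b) / 2) % 2 := by
    obtain ⟨h4, h6⟩ := h4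
    interval_cases b <;> ring_nf at h4 h6 ⊢ <;> omega
  rw [h5]
  interval_cases b
  all_goals
    have e1 : (2 * (4 * a + 0) + 1) % 8 = 1 := by omega
    have e2 : (2 * (4 * a + 1) + 1) % 8 = 3 := by omega
    have e3 : (2 * (4 * a + 2) + 1) % 8 = 5 := by omega
    have e4 : (2 * (4 * a + 3) + 1) % 8 = 7 := by omega
    have e5 : ∀ b, (2 * (4 * a + b) + 1) % 2 = 1 := by omega
    simp [e5] 
    omega

lemma count_final (N : ℕ) (hF : Fintype.card F = 2 ^ N) (hN0 : N ≠ 0) (s : ℕ) (hN : (2 * s + 1) ∣ N) :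
    #{x ∈ A F (2 * s + 1) | E s x = ((∑ i ∈ range s, (s + i) : ℕ) : F)} = 2 ^ (2 * s) + 2 ^ s := by
  have hv := G_val N hF hN0 s hN
  obtain ⟨j, hj⟩ := hN
  have hj0 : j ≠ 0 := by rintro rfl; simp at hj; exact hN0 hj
  have hc := G_count N s j hF hj hj0
  have hjk : jacobiSym 2 (2 * s + 1) = 1 ∨ jacobiSym 2 (2 * s + 1) = -1 := by
    apply jacobiSym.eq_one_or_neg_one
    have : Nat.Coprime 2 (2 * s + 1) := by simp
    simp [Int.gcd]
  have hA : #(A F (2 * s + 1)) = 2 ^ (2 * s + 1) := card_fix N _ j hF hj (by omega) hj0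
  have hsplit : #{x ∈ A F (2 * s + 1) | E s x = 0} + #{x ∈ A F (2 * s + 1) | E s x = 1} = 2 ^ (2 * s + 1) := by
    rw [← hA, ← Finset.card_filter_add_card_filter_not (s := A F (2*s+1)) (fun x => E s x = 0)]
    congr 2
    apply filter_congr
    intro x hx
    rw [mem_A] at hx
    rcases E_01 s x hx with h | h <;> simp [h]
  rw [kappa]
  rw [hv] at hc
  zify at hsplit ⊢
  rw [pow_succ] at hc hsplit
  rw [pow_succ] at hc
  rcases hjk with h | h <;> rw [h] at hc ⊢
  · rw [if_pos rfl]; linarith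
  · rw [if_neg (by norm_num)]; linarith
end
section
variable {F : Type*} [Field F] [Fintype F] [DecidableEq F] [CharP F 2]

lemma ident (r : ℕ → F) (w : F) (t j : ℕ) :
    ∑ i ∈ range j, (r i + r (i+1) + 1) * (1 + r (t+i) + w + ((t : F) + (i : F))) =
     ∑ i ∈ range j, r (i+1) * r (t+i) + ∑ i ∈ range j, r i * r (t+i) + ∑ i ∈ range j, r (t+i)
      + w * (r j + r 0 + (j : F)) + ((t : F) + (j : F)) * r j + ∑ i ∈ range j, r i + (t : F) * r 0
      + ∑ i ∈ range j, (1 + (t : F) + (i : F)) := by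
  have h2 := CharTwo.two_eq_zero (R := F)
  induction j with
  | zero => simp; linear_combination (-(w * r 0) - t * r 0) * h2
  | succ j ih =>
    simp only [sum_range_succ, ih]
    push_cast
    linear_combination (w * r j + ((t:F) + j) * r j) * h2

def K (s : ℕ) (e : F) : F := (e + e ^ 2) * (1 + e ^ 2 ^ (s + 1))
def H (s : ℕ) (e : F) : F := e ^ 2 ^ s * e + e + 1

lemma om_pow (w : F) (hw : w ^ 2 = w + 1) (j : ℕ) : w ^ 2 ^ j = w + (j : F) := by
  induction j with
  | zero => simp
  | succ j ih =>
    have h1 : ((j : F)) ^ 2 = j := by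
      rcases Nat.even_or_odd' j with ⟨k, rfl | rfl⟩ <;> simp [CharTwo.two_eq_zero]
    rw [pow_succ, pow_mul, ih]
    have := frob_add 1 w (j : F)
    rw [pow_one] at this
    rw [this, hw, h1]; push_cast; ring

lemma ident2 (s : ℕ) (r w : F) (hw : w ^ 2 = w + 1) (hr : r ^ 2 ^ (2 * s + 1) = r) :
    tr s (K s (w + r)) + H s (w + r) = E s r + ((∑ i ∈ range s, (s + i) : ℕ) : F) := by
  have h2 := CharTwo.two_eq_zero (R := F)
  have he : ∀ j : ℕ, (w + r) ^ 2 ^ j = r ^ 2 ^ j + w + (j : F) := by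
    intro j; rw [frob_add, om_pow w hw]; ring
  have hK : ∀ i, (K s (w + r)) ^ 2 ^ i = (r ^ 2 ^ i + r ^ 2 ^ (i+1) + 1) *
      (1 + r ^ 2 ^ (s + 1 + i) + w + (((s + 1 : ℕ) : F) + (i : F))) := by
    intro i
    rw [K, mul_pow, frob_add i (w + r), frob_add i 1, one_pow, ← pow_mul, ← pow_mul, ← pow_succ', ← pow_add, he, he, he]
    push_cast
    linear_combination (w + i) * (1 + r ^ 2 ^ (s + 1 + i) + w + (s + 1 + (i : F))) * h2
  have hid := ident (fun i => r ^ 2 ^ i) w (s + 1) s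
  simp only [← hK] at hid
  rw [tr, hid, H, he, E, tr]
  have hE : ∑ i ∈ range (2 * s + 1), (r ^ 2 ^ s * r + r) ^ 2 ^ i =
      ∑ i ∈ range s, r ^ 2 ^ (i + 1) * r ^ 2 ^ (s + 1 + i) + r ^ 2 ^ s * r
      + ∑ i ∈ range s, r ^ 2 ^ i * r ^ 2 ^ (s + 1 + i)
      + (∑ i ∈ range s, r ^ 2 ^ i + r ^ 2 ^ s + ∑ i ∈ range s, r ^ 2 ^ (s + 1 + i)) := by
    simp only [frob_add, mul_pow, sum_add_distrib]
    rw [show 2 * s + 1 = (s + 1) + s by ring, sum_range_add, sum_range_add (fun i => r ^ 2 ^ i), sum_range_succ',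
      sum_range_succ (fun i => r ^ 2 ^ i)]
    congr 2
    · congr 1
      · apply sum_congr rfl; intro i _
        rw [← pow_mul, ← pow_add, mul_comm]; ring_nf
      · simp
    · apply sum_congr rfl; intro i _
      rw [← pow_mul, ← pow_add 2 s, show s + (s + 1 + i) = (2 * s + 1) + i by ring, pow_add, pow_mul, hr]
  rw [hE]
  push_cast
  have hk : ∑ i ∈ range s, (1 + ((s : F) + 1) + (i : F)) = ∑ i ∈ range s, ((s : F) + (i : F)) := by
    apply sum_congr rfl; intro i _; linear_combination h2
  rw [hk]
  simp only [pow_zero, pow_one]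
  linear_combination (w * (r ^ 2 ^ s + r + s) + s * r ^ 2 ^ s + (s + 1) * r + w + 1) * h2 + hw

lemma count_e (N : ℕ) (hF : Fintype.card F = 2 ^ N) (s : ℕ) (hN : N = (2 * s + 1) * 4) :
    #{e : F | e ^ 2 ^ (2 * s + 1) = e + 1 ∧ tr s (K s e) = H s e} = 2 ^ (2 * s) + 2 ^ s := by
  have h2 := CharTwo.two_eq_zero (R := F)
  obtain ⟨w, hw⟩ : ∃ w : F, w ^ 2 = w + 1 := by
    have h := card_as N 1 N hF (one_mul N).symm one_ne_zero (by omega) (1 : F) (by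
      simp [hN]; right; linear_combination 2 * h2)
    have : 0 < #{x : F | x ^ 2 ^ 1 + x = 1} := by rw [h]; norm_num
    obtain ⟨w, hw⟩ := card_pos.mp this
    simp only [mem_filter, mem_univ, true_and, pow_one] at hw
    exact ⟨w, by linear_combination hw - w * h2⟩
  have hwn : w ^ 2 ^ (2 * s + 1) = w + 1 := by
    rw [om_pow w hw]; push_cast; linear_combination s * h2
  rw [← count_final N hF (by omega) s ⟨4, hN⟩]
  symm
  apply card_bij' (fun r _ => w + r) (fun e _ => w + e)
  · intro r hr
    simp only [mem_filter, mem_univ, true_and, mem_A] at hr ⊢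
    refine ⟨?_, ?_⟩
    · rw [frob_add, hwn, hr.1]; ring
    · have := ident2 s r w hw hr.1
      rw [hr.2, CharTwo.add_self_eq_zero] at this
      exact CharTwo.add_eq_zero.mp this
  · intro e he
    simp only [mem_filter, mem_univ, true_and, mem_A] at he ⊢
    have hr : (w + e) ^ 2 ^ (2 * s + 1) = w + e := by
      rw [frob_add, hwn, he.1]; linear_combination h2
    refine ⟨hr, ?_⟩
    have := ident2 s (w + e) w hw hr
    rw [← add_assoc, CharTwo.add_self_eq_zero, zero_add, he.2, CharTwo.add_self_eq_zero] at this
    exact CharTwo.add_eq_zero.mp this.symm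
  · intro r _; rw [← add_assoc, CharTwo.add_self_eq_zero, zero_add]
  · intro r _; rw [← add_assoc, CharTwo.add_self_eq_zero, zero_add]

def T (n : ℕ) (c : F) : F := c + c ^ 2 ^ n + c ^ 2 ^ (n * 2) + c ^ 2 ^ (n * 3)

def B (s n : ℕ) (c : F) : F :=
  c ^ 2 ^ s * c + (c ^ 2 ^ s) ^ 2 ^ n * (c + c ^ 2 ^ n) + (c ^ 2 ^ s) ^ 2 ^ (n * 2) * c ^ 2 ^ (n * 3)

lemma fcomm (a b : ℕ) (x : F) : (x ^ 2 ^ a) ^ 2 ^ b = (x ^ 2 ^ b) ^ 2 ^ a := by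
  rw [← pow_mul, ← pow_mul, mul_comm]

lemma f2 (n : ℕ) (x : F) : x ^ 2 ^ (n * 2) = (x ^ 2 ^ n) ^ 2 ^ n := by
  rw [← pow_mul, ← pow_add]; congr 2; ring

lemma f3 (n : ℕ) (x : F) : x ^ 2 ^ (n * 3) = ((x ^ 2 ^ n) ^ 2 ^ n) ^ 2 ^ n := by
  rw [← pow_mul, ← pow_mul, ← pow_add, ← pow_add]; congr 2; ring

/-- key consequence -/
lemma key1 (s : ℕ) (c e : F) (he : e ^ 2 ^ (2 * s + 1) = e + 1) (hc : c ^ 2 ^ s = c + H s e) :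
    c ^ 2 ^ (2 * s + 1) = c ^ 2 + K s e + e := by
  have h2 := CharTwo.two_eq_zero (R := F)
  have hs : ∀ x : F, x ^ 2 ^ (2 * s + 1) = ((x ^ 2 ^ s) ^ 2 ^ s) ^ 2 := by
    intro x; rw [← pow_mul, ← pow_mul]; congr 1; ring
  have e2 : e ^ 2 ^ (s + 1) = (e ^ 2 ^ s) ^ 2 := by rw [← pow_mul, pow_succ]
  rw [hs] at he ⊢
  rw [hc, frob_add, hc, K, e2]
  have : (H s e) ^ 2 ^ s = (e ^ 2 ^ s) ^ 2 ^ s * e ^ 2 ^ s + e ^ 2 ^ s + 1 := by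
    rw [H, frob_add, frob_add, mul_pow, one_pow]
  rw [this, H]
  generalize (e ^ 2 ^ s) ^ 2 ^ s = g at *
  generalize e ^ 2 ^ s = f at *
  have sq2 : ∀ a b : F, (a + b) ^ 2 = a ^ 2 + b ^ 2 := fun a b => by
    have := frob_add 1 a b; simpa using this
  simp only [sq2, mul_pow, he]
  linear_combination (1 + e * f ^ 2 * 0 - e + f ^ 2 - 0) * h2

lemma B_C1 (s n : ℕ) (c : F) (hc : c ^ 2 ^ (n * 2) = c + 1) :
    B s n c = (c ^ 2 ^ n + c) ^ 2 ^ s * (c ^ 2 ^ n + c) + c ^ 2 ^ s + c ^ 2 ^ n + 1 := by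
  have h2 := CharTwo.two_eq_zero (R := F)
  have h3 : c ^ 2 ^ (n * 3) = c ^ 2 ^ n + 1 := by
    rw [f3, ← f2 n c, hc, frob_add, one_pow]
  rw [B, h3, fcomm s (n * 2), hc, frob_add, frob_add, one_pow, fcomm s n]
  ring

lemma C1_iff (s : ℕ) (c e : F) :
    (c ^ 2 ^ ((2 * s + 1) * 2) = c + 1 ∧ B s (2 * s + 1) c = 0 ∧ c ^ 2 ^ (2 * s + 1) + c = e) ↔
    ((e ^ 2 ^ (2 * s + 1) = e + 1 ∧ tr s (K s e) = H s e) ∧ c ^ 2 ^ 1 + c = K s e) := by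
  have h2 := CharTwo.two_eq_zero (R := F)
  have htele : ∀ k, c ^ 2 ^ 1 + c = k → tr s k = c ^ 2 ^ s + c := by
    rintro k rfl
    have := tele 1 s c
    simp only [one_mul] at this
    exact this
  constructor
  · rintro ⟨h1, hB, rfl⟩
    have he : (c ^ 2 ^ (2 * s + 1) + c) ^ 2 ^ (2 * s + 1) = (c ^ 2 ^ (2 * s + 1) + c) + 1 := by
      rw [frob_add, ← f2, h1]; ring
    rw [B_C1 s _ c h1] at hB
    have hc : c ^ 2 ^ s = c + H s (c ^ 2 ^ (2 * s + 1) + c) := by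
      rw [H]; linear_combination hB - (c + (c ^ 2 ^ (2 * s + 1) + c) ^ 2 ^ s * (c ^ 2 ^ (2 * s + 1) + c) + c ^ 2 ^ (2 * s + 1) + 1) * h2
    have hk := key1 s c _ he hc
    have hK : c ^ 2 ^ 1 + c = K s (c ^ 2 ^ (2 * s + 1) + c) := by
      rw [pow_one]
      linear_combination -hk - K s (c ^ 2 ^ (2 * s + 1) + c) * h2
    refine ⟨⟨he, ?_⟩, hK⟩
    rw [htele _ hK, hc]; linear_combination c * h2
  · rintro ⟨⟨he, ht⟩, hK⟩
    rw [htele _ hK] at ht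
    have hc : c ^ 2 ^ s = c + H s e := by linear_combination ht - c * h2
    have hk := key1 s c _ he hc
    rw [pow_one] at hK
    have h1 : c ^ 2 ^ (2 * s + 1) = c + e := by
      rw [hk]; linear_combination -hK + (c ^ 2) * h2
    have h3 : c ^ 2 ^ ((2 * s + 1) * 2) = c + 1 := by
      rw [f2, h1, frob_add, h1, he]; linear_combination e * h2
    refine ⟨h3, ?_, ?_⟩
    · rw [B_C1 s _ c h3, hc, h1, H]
      have : c + e + c = e := by linear_combination c * h2
      rw [this]
      linear_combination (e ^ 2 ^ s * e + c + e + 1) * h2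
    · rw [h1]; linear_combination c * h2

lemma K_fix (s : ℕ) (e : F) (he : e ^ 2 ^ (2 * s + 1) = e + 1) : e ^ 2 ^ ((2 * s + 1) * 2) = e := by
  rw [f2, he, frob_add, he, one_pow, add_assoc, CharTwo.add_self_eq_zero, add_zero]

lemma count_C1 (N : ℕ) (hF : Fintype.card F = 2 ^ N) (s : ℕ) (hN : N = (2 * s + 1) * 4) :
    #{c : F | c ^ 2 ^ ((2 * s + 1) * 2) = c + 1 ∧ B s (2 * s + 1) c = 0} = 2 ^ (2 * s + 1) + 2 * 2 ^ s := by
  rw [card_eq_sum_card_fiberwise (f := fun c => c ^ 2 ^ (2 * s + 1) + c)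
    (t := {e : F | e ^ 2 ^ (2 * s + 1) = e + 1 ∧ tr s (K s e) = H s e})]
  · rw [sum_const_nat (m := 2), count_e N hF s hN]
    · ring
    · intro e he
      simp only [mem_filter, mem_univ, true_and] at he
      rw [filter_filter]
      have : ∀ c : F, ((c ^ 2 ^ ((2 * s + 1) * 2) = c + 1 ∧ B s (2 * s + 1) c = 0) ∧ c ^ 2 ^ (2 * s + 1) + c = e) ↔
          c ^ 2 ^ 1 + c = K s e := by
        intro c
        rw [and_assoc, C1_iff]
        simp only [he, true_and, and_self]
      simp only [this]
      refine card_as N 1 N hF (one_mul N).symm one_ne_zero (by omega) (K s e) ?_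
      have hKf : (K s e) ^ 2 ^ ((2 * s + 1) * 2) = K s e := by
        have := K_fix s e he.1
        exact fix_mul _ _ _ (fix_add _ _ _ this (by rw [← pow_mul, mul_comm, pow_mul, this]))
          (fix_add _ _ _ (one_pow _) (fix_frob _ _ _ this))
      simp only [one_mul]
      rw [hN, show (2 * s + 1) * 4 = (2 * s + 1) * 2 + (2 * s + 1) * 2 by ring, sum_range_add]
      simp only [pow_add, pow_mul (K s e), hKf]
      exact CharTwo.add_self_eq_zero _
  · intro c hc
    simp only [coe_filter, mem_univ, true_and, Set.mem_ofPred_eq] at hc ⊢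
    exact ((C1_iff s c _).mp ⟨hc.1, hc.2, rfl⟩).1

lemma C1_norm (s : ℕ) (c : F) (h1 : c ^ 2 ^ ((2 * s + 1) * 2) = c + 1) (hB : B s (2 * s + 1) c = 0) :
    (c ^ (2 ^ (2 * s + 1) + 2 * 2 ^ s + 1)) ^ 2 ^ ((2 * s + 1) * 2) = c ^ (2 ^ (2 * s + 1) + 2 * 2 ^ s + 1) := by
  have h2 := CharTwo.two_eq_zero (R := F)
  obtain ⟨e, he0⟩ : ∃ e, c ^ 2 ^ (2 * s + 1) + c = e := ⟨_, rfl⟩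
  obtain ⟨⟨he, ht⟩, hK⟩ := (C1_iff s c e).mp ⟨h1, hB, he0⟩
  have htele : tr s (K s e) = c ^ 2 ^ s + c := by
    rw [← hK]
    have := tele 1 s c
    simp only [one_mul] at this
    exact this
  have hc : c ^ 2 ^ s = c + H s e := by
    rw [htele] at ht; linear_combination ht - c * h2
  have hcn : c ^ 2 ^ (2 * s + 1) = c + e := by linear_combination he0 - c * h2
  have hf := K_fix s e he
  have hfs := fix_frob _ s _ hf
  have hval : c ^ (2 ^ (2 * s + 1) + 2 * 2 ^ s + 1) = K s e * (K s e + H s e ^ 2 + 1 + e) := by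
    rw [pow_add, pow_add, hcn, mul_comm 2 (2 ^ s), pow_mul, hc, pow_one]
    rw [pow_one] at hK
    have hH : (1 + e) * (1 + K s e + H s e ^ 2) = K s e := by
      have e2 : e ^ 2 ^ (s + 1) = (e ^ 2 ^ s) ^ 2 := by rw [← pow_mul, pow_succ]
      rw [K, H, e2]
      generalize e ^ 2 ^ s = f
      linear_combination (1+e)*(1+e^2+e^2*f^2+f*e^2+f*e+e)*h2
    have hc2 : c ^ 2 = c + K s e := by linear_combination hK - c * h2
    have hA : (c + H s e) ^ 2 = c + K s e + H s e ^ 2 := by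
      linear_combination hc2 + c * H s e * h2
    have hB : (c + e) * c = c * (1 + e) + K s e := by linear_combination hc2
    have : (c + e) * (c + H s e) ^ 2 * c = ((c + e) * c) * (c + H s e) ^ 2 := by ring
    rw [this, hA, hB]
    linear_combination (1 + e) * hc2 + c * hH + c * K s e * h2
  have hKf : (K s e) ^ 2 ^ ((2 * s + 1) * 2) = K s e :=
    fix_mul _ _ _ (fix_add _ _ _ hf (by rw [← pow_mul, mul_comm, pow_mul, hf]))
          (fix_add _ _ _ (one_pow _) (fix_frob _ _ _ hf))
  have hHf : (H s e) ^ 2 ^ ((2 * s + 1) * 2) = H s e :=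
    fix_add _ _ _ (fix_add _ _ _ (fix_mul _ _ _ hfs hf) hf) (one_pow _)
  rw [hval]
  refine fix_mul _ _ _ hKf (fix_add _ _ _ (fix_add _ _ _ (fix_add _ _ _ hKf ?_) (one_pow _)) hf)
  rw [← pow_mul, mul_comm, pow_mul, hHf]
end
section
variable {F : Type*} [Field F] [Fintype F] [DecidableEq F] [CharP F 2]

def C (F : Type*) [Field F] [Fintype F] [DecidableEq F] (s n : ℕ) : Finset F :=
  {c : F | T n c = 0 ∧ B s n c = 0}

lemma mem_C (s n : ℕ) (c : F) : c ∈ C F s n ↔ T n c = 0 ∧ B s n c = 0 := by simp [C]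

lemma T_eq (n : ℕ) (c : F) : ∑ i ∈ range 4, c ^ 2 ^ (n * i) = T n c := by
  simp [sum_range_succ, T]

lemma T_iff (n : ℕ) (c : F) : T n c = 0 ↔ (c ^ 2 ^ (n * 2) + c) ^ 2 ^ n = c ^ 2 ^ (n * 2) + c := by
  rw [← CharTwo.add_eq_zero (a := (c ^ 2 ^ (n * 2) + c) ^ 2 ^ n), T, frob_add, f2, f3]
  have : c + c ^ 2 ^ n + (c ^ 2 ^ n) ^ 2 ^ n + ((c ^ 2 ^ n) ^ 2 ^ n) ^ 2 ^ n =
      ((c ^ 2 ^ n) ^ 2 ^ n) ^ 2 ^ n + c ^ 2 ^ n + ((c ^ 2 ^ n) ^ 2 ^ n + c) := by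
    generalize ((c ^ 2 ^ n) ^ 2 ^ n) ^ 2 ^ n = c3
    generalize (c ^ 2 ^ n) ^ 2 ^ n = c2
    ring
  rw [this]

lemma fix2 (n : ℕ) (a : F) (ha : a ^ 2 ^ n = a) : a ^ 2 ^ (n * 2) = a := by rw [f2, ha, ha]
lemma fix3 (n : ℕ) (a : F) (ha : a ^ 2 ^ n = a) : a ^ 2 ^ (n * 3) = a := by rw [f3, ha, ha, ha]

lemma B_smul (s n : ℕ) (a c : F) (ha : a ^ 2 ^ n = a) : B s n (a * c) = a ^ 2 ^ s * a * B s n c := by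
  simp only [B, mul_pow, ha, fix2 n a ha, fix3 n a ha, fix_frob n s a ha, fix2 n _ (fix_frob n s a ha)]
  ring

lemma T_smul (n : ℕ) (a c : F) (ha : a ^ 2 ^ n = a) : T n (a * c) = a * T n c := by
  simp only [T, mul_pow, ha, fix2 n a ha, fix3 n a ha]
  ring

lemma C0 (s n : ℕ) (c : F) (hc : c ^ 2 ^ (n * 2) = c) : B s n c = 0 ↔ c ^ 2 ^ n = c := by
  have : B s n c = (c ^ 2 ^ n + c) ^ 2 ^ s * (c ^ 2 ^ n + c) := by
    have h3 : c ^ 2 ^ (n * 3) = c ^ 2 ^ n := by rw [f3, ← f2 n c, hc]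
    rw [B, h3, fcomm s (n * 2), hc, frob_add, fcomm s n]
    ring
  rw [this, mul_eq_zero, pow_eq_zero_iff (by positivity), or_self, CharTwo.add_eq_zero]

/-- structure of `C` -/
lemma C_cases (s n : ℕ) (c : F) (hc : c ∈ C F s n) (hc0 : c ^ 2 ^ n ≠ c) :
    ∃ a d : F, a ≠ 0 ∧ a ^ 2 ^ n = a ∧ (d ^ 2 ^ (n * 2) = d + 1 ∧ B s n d = 0) ∧ a * d = c := by
  rw [mem_C, T_iff] at hc
  set a := c ^ 2 ^ (n * 2) + c with ha
  have ha0 : a ≠ 0 := by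
    intro h
    rw [ha, CharTwo.add_eq_zero] at h
    exact hc0 ((C0 s n c h).mp hc.2)
  have had : a * (a⁻¹ * c) = c := by field_simp
  have hai : (a⁻¹) ^ 2 ^ n = a⁻¹ := by rw [inv_pow, hc.1]
  refine ⟨a, a⁻¹ * c, ha0, hc.1, ⟨?_, ?_⟩, had⟩
  · rw [mul_pow, fix2 n _ hai]
    have : c ^ 2 ^ (n * 2) = c + a := by
      rw [ha]; linear_combination - c * CharTwo.two_eq_zero (R := F)
    rw [this]; field_simp
  · rw [B_smul s n _ _ hai, hc.2, mul_zero]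

lemma C_norm (s : ℕ) (c : F) (hc : c ∈ C F s (2 * s + 1)) :
    (c ^ (2 ^ (2 * s + 1) + 2 * 2 ^ s + 1)) ^ 2 ^ ((2 * s + 1) * 2) = c ^ (2 ^ (2 * s + 1) + 2 * 2 ^ s + 1) := by
  have hgen : ∀ a : F, a ^ 2 ^ (2 * s + 1) = a → ∀ j, (a ^ j) ^ 2 ^ ((2 * s + 1) * 2) = a ^ j := by
    intro a ha j
    rw [← pow_mul, mul_comm, pow_mul, fix2 _ a ha]
  by_cases h0 : c ^ 2 ^ (2 * s + 1) = c
  · exact hgen c h0 _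
  · obtain ⟨a, d, ha0, ha, ⟨hd1, hd2⟩, rfl⟩ := C_cases s _ c hc h0
    rw [mul_pow]
    exact fix_mul _ _ _ (hgen a ha _) (C1_norm s d hd1 hd2)

lemma card_C (N : ℕ) (hF : Fintype.card F = 2 ^ N) (s : ℕ) (hN : N = (2 * s + 1) * 4) :
    #(C F s (2 * s + 1)) = 1 + (2 ^ (2 * s + 1) - 1) * (2 ^ (2 * s + 1) + 2 * 2 ^ s + 1) := by
  set n := 2 * s + 1 with hn
  have hA : #(A F n) = 2 ^ n := card_fix N n 4 hF hN (by omega) (by norm_num)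
  have h0A : (0 : F) ∈ A F n := by rw [mem_A]; exact zero_pow (by positivity)
  have h1 : #{c ∈ C F s n | c ^ 2 ^ n = c} = 2 ^ n := by
    refine Eq.trans ?_ hA
    congr 1
    ext c
    rw [mem_filter, mem_A, and_iff_right_iff_imp]
    intro h
    rw [mem_C, C0 s n c (fix2 n c h), T_iff, fix2 n c h, CharTwo.add_self_eq_zero]
    exact ⟨zero_pow (by positivity), h⟩
  have h2 : #{c ∈ C F s n | ¬ c ^ 2 ^ n = c} = (2 ^ n - 1) * (2 ^ n + 2 * 2 ^ s) := by
    have hc1 := count_C1 N hF s hN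
    rw [← hn] at hc1
    have h3 : #((A F n).erase 0) = 2 ^ n - 1 := by rw [card_erase_of_mem h0A, hA]
    refine Eq.trans ?_ (congrArg₂ (· * ·) h3 hc1)
    rw [← card_product]
    symm
    apply card_bij (fun p _ => p.1 * p.2)
    · rintro ⟨a, d⟩ h
      simp only [mem_product, mem_erase, mem_A, mem_filter, mem_univ, true_and] at h ⊢
      obtain ⟨⟨ha0, ha⟩, hd1, hd2⟩ := h
      have hTd : T n d = 0 := by
        rw [T_iff, hd1]
        have : d + 1 + d = 1 := by linear_combination d * CharTwo.two_eq_zero (R := F)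
        rw [this, one_pow]
      refine ⟨?_, ?_⟩
      · rw [mem_C, T_smul n a d ha, B_smul s n a d ha, hTd, hd2]; simp
      · intro h
        rw [mul_pow, ha] at h
        have h := mul_left_cancel₀ ha0 h
        have h' := fix2 n d h
        rw [hd1] at h'
        simp at h'
    · rintro ⟨a, d⟩ h ⟨a', d'⟩ h' heq
      simp only [mem_product, mem_erase, mem_A, mem_filter, mem_univ, true_and] at h h' heq
      obtain ⟨⟨ha0, ha⟩, hd1, hd2⟩ := h
      obtain ⟨⟨ha0', ha'⟩, hd1', hd2'⟩ := h'
      have e1 := congrArg (fun x => x ^ 2 ^ (n * 2)) heq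
      simp only [mul_pow, fix2 n a ha, fix2 n a' ha', hd1, hd1'] at e1
      have : a = a' := by linear_combination e1 - heq
      subst this
      rw [mul_left_cancel₀ ha0 heq]
    · intro c hc
      rw [mem_filter] at hc
      obtain ⟨a, d, ha0, ha, hd, hc⟩ := C_cases s n c hc.1 hc.2
      refine ⟨(a, d), ?_, hc⟩
      simp only [mem_product, mem_erase, mem_A, mem_filter, mem_univ, true_and]
      exact ⟨⟨ha0, ha⟩, hd⟩
  rw [← card_filter_add_card_filter_not (s := C F s n) (fun c => c ^ 2 ^ n = c), h1, h2]
  have : 1 ≤ 2 ^ n := Nat.one_le_two_pow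
  obtain ⟨u, hu⟩ := Nat.exists_eq_add_of_le this
  rw [hu]; simp; ring

lemma Tz (s n : ℕ) (x c : F) (hx : x ^ 2 ^ n + x = c) (hT : T n c = 0) : T n (x ^ 2 ^ s * c) = B s n c := by
  have h2 := CharTwo.two_eq_zero (R := F)
  have hz : (x ^ 2 ^ s) ^ 2 ^ n = x ^ 2 ^ s + c ^ 2 ^ s := by
    rw [fcomm, ← hx, frob_add]; linear_combination - x ^ 2 ^ s * h2
  rw [T] at hT
  rw [T, B, mul_pow, mul_pow, mul_pow, f2 n (x ^ 2 ^ s), f3 n (x ^ 2 ^ s), f2 n (c ^ 2 ^ s), hz, frob_add, hz, frob_add, frob_add, hz]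
  generalize ((c ^ 2 ^ s) ^ 2 ^ n) ^ 2 ^ n = d2
  generalize (c ^ 2 ^ s) ^ 2 ^ n = d1
  generalize c ^ 2 ^ s = d at *
  generalize x ^ 2 ^ s = z
  linear_combination (z + d + d1) * hT - (d * c + d1 * (c + c ^ 2 ^ n)) * h2

lemma fiber (N : ℕ) (hF : Fintype.card F = 2 ^ N) (s n : ℕ) (hN : N = n * 4) (hn : n ≠ 0) (c : F) :
    #{p : F × F | p.1 ^ 2 ^ n + p.1 = c ∧ p.2 ^ 2 ^ n + p.2 = p.1 ^ 2 ^ s * c} =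
      if c ∈ C F s n then (2 ^ n) ^ 2 else 0 := by
  have htz : ∀ x : F, T n (x ^ 2 ^ n + x) = 0 := by
    intro x
    rw [← T_eq, tele, ← hN, ← hF, FiniteField.pow_card, CharTwo.add_self_eq_zero]
  split_ifs with hc
  · rw [mem_C] at hc
    rw [card_eq_sum_card_fiberwise (f := Prod.fst) (t := {x : F | x ^ 2 ^ n + x = c})]
    · rw [sum_const_nat (m := 2 ^ n), card_as N n 4 hF hN hn (by norm_num) c (by rw [T_eq]; exact hc.1), sq]
      intro x hx
      simp only [mem_filter, mem_univ, true_and] at hx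
      refine Eq.trans ?_ (card_as N n 4 hF hN hn (by norm_num) (x ^ 2 ^ s * c) (by rw [T_eq, Tz s n x c hx hc.1]; exact hc.2))
      symm
      apply card_bij (fun y _ => (x, y))
      · intro y hy
        simp only [mem_filter, mem_univ, true_and] at hy ⊢
        exact ⟨⟨hx, hy⟩, trivial⟩
      · intro y _ y' _ h; exact (Prod.mk.inj h).2
      · rintro ⟨x', y⟩ h
        simp only [mem_filter, mem_univ, true_and] at h
        obtain ⟨⟨h1, h2⟩, rfl⟩ := h
        exact ⟨y, by simpa using h2, rfl⟩
    · intro p hp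
      simp only [coe_filter, mem_univ, true_and, Set.mem_ofPred_eq] at hp ⊢
      exact hp.1
  · rw [card_eq_zero, filter_eq_empty_iff]
    rintro ⟨x, y⟩ _ ⟨h1, h2⟩
    simp only at h1 h2
    apply hc
    have hT : T n c = 0 := by rw [← h1]; exact htz x
    rw [mem_C]
    refine ⟨hT, ?_⟩
    rw [← Tz s n x c h1 hT, ← h2]; exact htz y

lemma card_U (N : ℕ) (hF : Fintype.card F = 2 ^ N) (s : ℕ) (hN : N = (2 * s + 1) * 4) (m : ℕ)
    (hm : m * (2 ^ (2 * s + 1) + 2 * 2 ^ s + 1) = (2 ^ (2 * s + 1)) ^ 2 + 1) :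
    #{α : F | α ^ m ∈ C F s (2 * s + 1)} =
      1 + m * ((2 ^ (2 * s + 1) - 1) * (2 ^ (2 * s + 1) + 2 * 2 ^ s + 1)) := by
  set n := 2 * s + 1 with hn
  have hm0 : m ≠ 0 := by rintro rfl; simp at hm
  have h0C : (0 : F) ∈ C F s n := by
    rw [mem_C]; simp [T, B]
  have hq : 2 ≤ 2 ^ n := by
    calc 2 = 2 ^ 1 := rfl
      _ ≤ 2 ^ n := Nat.pow_le_pow_right (by norm_num) (by omega)
  rw [card_eq_sum_card_fiberwise (f := fun α => α ^ m) (t := C F s n)]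
  · rw [← add_sum_erase _ _ h0C, sum_const_nat (m := m), card_erase_of_mem h0C, card_C N hF s hN, Nat.add_sub_cancel_left, mul_comm m]
    · congr 1
      rw [card_eq_one]
      refine ⟨0, ?_⟩
      ext α
      simp only [mem_filter, mem_univ, true_and, mem_singleton, pow_eq_zero_iff hm0]
      constructor
      · exact fun h => h.2
      · rintro rfl; exact ⟨by rw [zero_pow hm0]; exact h0C, rfl⟩
    · intro c hc
      rw [mem_erase] at hc
      have he : ({α ∈ ({α : F | α ^ m ∈ C F s n} : Finset F) | α ^ m = c}) = ({α : F | α ^ m = c} : Finset F) := by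
        ext α
        simp only [mem_filter, mem_univ, true_and, and_iff_right_iff_imp]
        rintro rfl; exact hc.2
      rw [he]
      have hnorm := C_norm s c hc.2
      rw [← hn] at hnorm
      have hpos : 1 < (2 ^ n) ^ 2 := by nlinarith
      refine card_roots m ((2 ^ n + 2 * 2 ^ s + 1) * ((2 ^ n) ^ 2 - 1)) ?_ c ?_ ?_ hm0
      · rw [← mul_assoc, hm, hF, hN, pow_mul]
        generalize 2 ^ n = Q at *
        obtain ⟨v, hv⟩ := Nat.exists_eq_add_of_lt hpos
        have : Q ^ 4 = (Q ^ 2) ^ 2 := by ring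
        rw [this, hv]
        have : (1 + v + 1) ^ 2 = (1 + v + 1 + 1) * (1 + v + 1 - 1) + 1 := by
          simp; ring
        rw [this]; simp
      · rw [pow_mul]
        have hy0 : c ^ (2 ^ n + 2 * 2 ^ s + 1) ≠ 0 := pow_ne_zero _ hc.1
        generalize c ^ (2 ^ n + 2 * 2 ^ s + 1) = y at *
        rw [pow_mul] at hnorm
        apply mul_left_cancel₀ hy0
        rw [mul_one, ← pow_succ']
        have : (2 ^ n) ^ 2 - 1 + 1 = 2 ^ (n * 2) := by rw [pow_mul]; omega
        rw [this, pow_mul]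
        exact hnorm
      · apply mul_ne_zero
        · omega
        · omega
  · intro α hα
    simp only [coe_filter, mem_univ, true_and, Set.mem_ofPred_eq] at hα ⊢
    exact hα
end
end Skab

/-- Fibers of the morphism `t` on the affine `F_{q⁴}`-points of the Skabelund curve
`S̃_q`: every fiber has `0` or `q²` points, and exactly `q³ - q² + q` values of `t`
have a fiber of size `q²`. -/
theorem skabelund_suzuki_weak_castle_fibers
    (s : ℕ) (hs : 1 ≤ s) (q₀ q m : ℕ)
    (hq₀ : q₀ = 2 ^ s) (hq : q = 2 * q₀ ^ 2) (hm : m = q - 2 * q₀ + 1)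
    (F : Type*) [Field F] [Fintype F] (hF : Fintype.card F = q ^ 4)
    (S : Set (F × F × F))
    (hS : S = {p : F × F × F |
        p.2.1 ^ q + p.2.1 = p.1 ^ q₀ * (p.1 ^ q + p.1) ∧
        p.2.2 ^ m = p.1 ^ q + p.1}) :
    (∀ α : F, Nat.card {p : F × F × F | p ∈ S ∧ p.2.2 = α} = 0 ∨
        Nat.card {p : F × F × F | p ∈ S ∧ p.2.2 = α} = q ^ 2) ∧
    Nat.card {α : F | Nat.card {p : F × F × F | p ∈ S ∧ p.2.2 = α} = q ^ 2}
      = q ^ 3 - q ^ 2 + q := by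
  classical
  have hqn : q = 2 ^ (2 * s + 1) := by rw [hq, hq₀]; ring
  have hF' : Fintype.card F = 2 ^ ((2 * s + 1) * 4) := by rw [hF, hqn, ← pow_mul]
  have hchar : CharP F 2 := by
    obtain ⟨p, hp⟩ := CharP.exists F
    obtain ⟨k, hpp, hk⟩ := FiniteField.card F p
    rw [hF'] at hk
    have : p ∣ 2 ^ ((2 * s + 1) * 4) := by
      rw [hk]; exact dvd_pow_self p k.ne_zero
    have := (Nat.prime_dvd_prime_iff_eq hpp Nat.prime_two).mp (hpp.dvd_of_dvd_pow this)
    rw [← this]; exact hp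
  have hfib : ∀ α : F, Nat.card {p : F × F × F | p ∈ S ∧ p.2.2 = α} =
      if α ^ m ∈ Skab.C F s (2 * s + 1) then q ^ 2 else 0 := by
    intro α
    have h := Skab.fiber _ hF' s (2 * s + 1) rfl (by omega) (α ^ m)
    rw [← hqn, ← hq₀] at h
    rw [← h, ← Fintype.card_subtype, ← Nat.card_eq_fintype_card]
    refine Nat.card_congr ⟨fun p => ⟨(p.1.1, p.1.2.1), ?_⟩, fun p => ⟨(p.1.1, p.1.2, α), ?_⟩, ?_, ?_⟩
    · obtain ⟨⟨x, y, t⟩, h1, h2⟩ := p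
      rw [hS] at h1
      obtain ⟨h1, h3⟩ := h1
      simp only at h1 h2 h3 ⊢
      subst h2
      rw [h3]
      exact ⟨rfl, h1⟩
    · obtain ⟨⟨x, y⟩, h1, h2⟩ := p
      simp only at h1 h2 ⊢
      refine ⟨?_, rfl⟩
      rw [hS]
      exact ⟨by simp only; rw [h1]; exact h2, h1.symm⟩
    · rintro ⟨⟨x, y, t⟩, h1, h2⟩
      simp only at h2
      subst h2
      rfl
    · rintro ⟨⟨x, y⟩, h1, h2⟩
      rfl
  have hs0 : 2 ≤ q₀ := by
    rw [hq₀]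
    calc 2 = 2 ^ 1 := rfl
      _ ≤ 2 ^ s := Nat.pow_le_pow_right (by norm_num) hs
  have hle : 2 * q₀ ≤ q := by rw [hq]; nlinarith
  refine ⟨fun α => ?_, ?_⟩
  · rw [hfib]; split_ifs
    · exact Or.inr rfl
    · exact Or.inl rfl
  · have hq2 : (0 : ℕ) ≠ q ^ 2 := by
      have : 0 < q ^ 2 := by apply pow_pos; omega
      omega
    have hset : {α : F | Nat.card {p : F × F × F | p ∈ S ∧ p.2.2 = α} = q ^ 2} =
        {α : F | α ^ m ∈ Skab.C F s (2 * s + 1)} := by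
      ext α
      change Nat.card {p : F × F × F | p ∈ S ∧ p.2.2 = α} = q ^ 2 ↔ α ^ m ∈ Skab.C F s (2 * s + 1)
      rw [hfib]
      split_ifs with h
      · simp [h]
      · simp [h, hq2]
    rw [hset]
    have hmz : (m : ℤ) = q - 2 * q₀ + 1 := by rw [hm]; push_cast [hle]; ring
    have hqz : (q : ℤ) = 2 * q₀ ^ 2 := by rw [hq]; push_cast; ring
    have hmm : m * (q + 2 * q₀ + 1) = q ^ 2 + 1 := by
      zify; rw [hmz, hqz]; ring
    have hU := Skab.card_U _ hF' s rfl m (by rw [← hqn, ← hq₀]; exact hmm)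
    rw [← hqn, ← hq₀, ← Fintype.card_subtype, ← Nat.card_eq_fintype_card] at hU
    refine Eq.trans hU ?_
    have h23 : q ^ 2 ≤ q ^ 3 := Nat.pow_le_pow_right (by omega) (by norm_num)
    have h1q : 1 ≤ q := by omega
    zify [h23, h1q]
    zify at hmm
    linear_combination ((q : ℤ) - 1) * hmm
end
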